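/- Let n ≥ 2 and (n−1)/2 < α < (n+1)/2. Suppose that for every γ < (n+1)/2 − α there exist p > 1 and a constant C > 0 such that for every real-valued even Schwartz function u₀ on ℝⁿ and every even finite Borel measure μ on ℝⁿ supported in B(0,4) with [μ]_α < ∞ one has (∫₀¹ ∫_{ℝⁿ} |cos(t√(−Δ) − (n−1)π/4)u₀(x)|^p dμ(x) dt)^{1/p} ≤ C [μ]_α^{1/p} ‖u₀‖_{H^{(n−α)/2 − γ}}. Then every compact set E ⊂ ℝⁿ whose Hausdorff dimension satisfies dim_H(E) > α has distance set {|x−y| : x, y ∈ E} of positive one-dimensional Lebesgue measure. -/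

import Mathlib

open MeasureTheory Real Metric
open scoped ENNReal RealInnerProductSpace

noncomputable section

abbrev E (n : ℕ) : Type := EuclideanSpace ℝ (Fin n)

/-- The Frostman constant `[μ]_α = sup_{x,r>0} μ(B(x,r))/r^α`. -/
def frostman {d : ℕ} (μ : Measure (E d)) (α : ℝ) : ℝ≥0∞ :=
  ⨆ (x : E d) (r : ℝ) (_ : 0 < r), μ (Metric.ball x r) / ENNReal.ofReal (r ^ α)

/-- The Fourier transform `f̂(ξ) = ∫ e^{-2πi x·ξ} f(x) dx`. -/
def FT {n : ℕ} (f : E n → ℂ) (ξ : E n) : ℂ :=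
  ∫ x, Complex.exp (((-2 * π * ⟪x, ξ⟫ : ℝ) : ℂ) * Complex.I) * f x

/-- The Sobolev norm `‖f‖_{H^s} = (∫ (1+|ξ|²)^s |f̂(ξ)|² dξ)^{1/2}`. -/
def sobolevNorm {n : ℕ} (f : E n → ℂ) (s : ℝ) : ℝ :=
  (∫ ξ : E n, (1 + ‖ξ‖ ^ 2) ^ s * ‖FT f ξ‖ ^ 2) ^ (1/2 : ℝ)

/-- The operator `cos(t√(-Δ) - (n-1)π/4)` applied to `f`. -/
def cosWave (n : ℕ) (f : E n → ℂ) (t : ℝ) (x : E n) : ℂ :=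
  ∫ ξ : E n, ((Real.cos (2 * π * t * ‖ξ‖ - ((n : ℝ) - 1) * π / 4) : ℝ) : ℂ) *
    Complex.exp (((2 * π * ⟪x, ξ⟫ : ℝ) : ℂ) * Complex.I) * FT f ξ

theorem card_mul_le_of_multicover {X : Type*} [MetricSpace X] {K : Set X} {s h : ℝ}
    (hcov : ∀ F : Finset (X × ℝ), (∀ b ∈ F, 0 < b.2) → K ⊆ ⋃ b ∈ F, ball b.1 b.2 →
      h ≤ ∑ b ∈ F, b.2 ^ s)
    (F : Finset (X × ℝ)) (hF : ∀ b ∈ F, 0 < b.2) (N : ℕ) (m : X × ℝ → ℕ)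
    (hm : ∀ x ∈ K, N ≤ ∑ b ∈ F, m b * (ball b.1 b.2).indicator 1 x) :
    N * h ≤ 5 ^ s * ∑ b ∈ F, (m b : ℝ) * b.2 ^ s := by
  classical
  induction N generalizing m with
  | zero =>
    simp only [Nat.cast_zero, zero_mul]
    refine mul_nonneg (by positivity) (Finset.sum_nonneg fun b hb => ?_)
    have := hF b hb
    positivity
  | succ N ih =>
    obtain ⟨R, hR⟩ := (F.finite_toSet.image (fun b => b.2)).bddAbove
    obtain ⟨u, hu, hdisj, henl⟩ := Vitali.exists_disjoint_subfamily_covering_enlargement_ball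
      {b : X × ℝ | b ∈ F ∧ m b ≠ 0} (fun b => b.1) (fun b => b.2) R
      (fun b hb => hR ⟨b, hb.1, rfl⟩) 5 (by norm_num)
    have hufin : u.Finite := F.finite_toSet.subset fun b hb => (hu hb).1
    set U := hufin.toFinset with hU
    have hUF : U ⊆ F := fun b hb => (hu (hufin.mem_toFinset.1 hb)).1
    have hUm : ∀ b ∈ U, m b ≠ 0 := fun b hb => (hu (hufin.mem_toFinset.1 hb)).2
    have h1 : h ≤ ∑ b ∈ U, (5 * b.2) ^ s := by
      have := hcov (U.image fun b => (b.1, 5 * b.2)) ?_ ?_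
      · rwa [Finset.sum_image] at this
        rintro ⟨a, b⟩ _ ⟨c, d⟩ _ hh
        simp at hh
        simp [hh]
      · intro b hb
        obtain ⟨c, hc, rfl⟩ := Finset.mem_image.1 hb
        have := hF c (hUF hc)
        simpa using this
      · intro x hx
        have h2 := hm x hx
        have : ∃ b ∈ F, m b * (ball b.1 b.2).indicator 1 x ≠ 0 := by
          by_contra! hcon
          rw [Finset.sum_eq_zero hcon] at h2
          omega
        obtain ⟨b, hb, hbx⟩ := this
        have hmb : m b ≠ 0 := left_ne_zero_of_mul hbx
        have hxb : x ∈ ball b.1 b.2 := by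
          by_contra hc
          exact hbx (by simp [Set.indicator_of_notMem hc])
        obtain ⟨c, hc, hbc⟩ := henl b ⟨hb, hmb⟩
        simp only [Set.mem_iUnion]
        exact ⟨(c.1, 5 * c.2), Finset.mem_image.2 ⟨c, hufin.mem_toFinset.2 hc, rfl⟩, hbc hxb⟩
    have h2 := ih (fun b => if b ∈ U then m b - 1 else m b) ?_
    · have e1 : ∑ b ∈ F, (m b : ℝ) * b.2 ^ s =
          ∑ b ∈ F, (((if b ∈ U then m b - 1 else m b : ℕ) : ℝ)) * b.2 ^ s
            + ∑ b ∈ U, b.2 ^ s := by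
        rw [← Finset.sum_filter_add_sum_filter_not F (· ∈ U) (fun b => (m b : ℝ) * b.2 ^ s),
          ← Finset.sum_filter_add_sum_filter_not F (· ∈ U)
            (fun b => (((if b ∈ U then m b - 1 else m b : ℕ) : ℝ)) * b.2 ^ s)]
        have e2 : F.filter (· ∈ U) = U := by
          ext b; simp only [Finset.mem_filter]; exact ⟨fun h => h.2, fun h => ⟨hUF h, h⟩⟩
        rw [e2]
        have e3 : ∑ b ∈ U, (m b : ℝ) * b.2 ^ s = ∑ b ∈ U,
            (((if b ∈ U then m b - 1 else m b : ℕ) : ℝ)) * b.2 ^ s + ∑ b ∈ U, b.2 ^ s := by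
          rw [← Finset.sum_add_distrib]
          refine Finset.sum_congr rfl fun b hb => ?_
          have : 1 ≤ m b := Nat.one_le_iff_ne_zero.2 (hUm b hb)
          rw [if_pos hb, Nat.cast_sub this]
          push_cast
          ring
        have e4 : ∑ b ∈ F with b ∉ U, (m b : ℝ) * b.2 ^ s = ∑ b ∈ F with b ∉ U,
            (((if b ∈ U then m b - 1 else m b : ℕ) : ℝ)) * b.2 ^ s := by
          refine Finset.sum_congr rfl fun b hb => ?_
          rw [if_neg (Finset.mem_filter.1 hb).2]
        rw [e3, e4]
        ring
      have e5 : ∑ b ∈ U, (5 * b.2) ^ s = 5 ^ s * ∑ b ∈ U, b.2 ^ s := by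
        rw [Finset.mul_sum]
        refine Finset.sum_congr rfl fun b hb => ?_
        rw [Real.mul_rpow (by norm_num) (hF b (hUF hb)).le]
      rw [e1, mul_add, ← e5]
      push_cast at h2 ⊢
      linarith
    · intro x hx
      have h3 := hm x hx
      have e1 : ∑ b ∈ F, m b * (ball b.1 b.2).indicator 1 x ≤
          ∑ b ∈ F, (if b ∈ U then m b - 1 else m b) * (ball b.1 b.2).indicator 1 x
          + ∑ b ∈ U, (ball b.1 b.2).indicator 1 x := by
        have : ∑ b ∈ U, (ball b.1 b.2).indicator (1 : X → ℕ) x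
            = ∑ b ∈ F, if b ∈ U then (ball b.1 b.2).indicator (1 : X → ℕ) x else 0 := by
          rw [← Finset.sum_filter]
          congr 1
          ext b; simp only [Finset.mem_filter]; exact ⟨fun h => ⟨hUF h, h⟩, fun h => h.2⟩
        rw [this, ← Finset.sum_add_distrib]
        refine Finset.sum_le_sum fun b _ => ?_
        by_cases hbU : b ∈ U
        · have : 1 ≤ m b := Nat.one_le_iff_ne_zero.2 (hUm b hbU)
          simp only [hbU, if_true]
          obtain ⟨k, hk⟩ := Nat.exists_eq_add_of_le this
          rw [hk, Nat.add_sub_cancel_left]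
          linarith
        · simp [hbU]
      have e2 : ∑ b ∈ U, (ball b.1 b.2).indicator (1 : X → ℕ) x ≤ 1 := by
        by_cases hex : ∃ b ∈ U, x ∈ ball b.1 b.2
        · obtain ⟨b, hb, hxb⟩ := hex
          rw [Finset.sum_eq_single b]
          · simp [hxb]
          · intro c hc hcb
            refine Set.indicator_of_notMem (fun hxc => ?_) _
            exact (Set.disjoint_left.1 (hdisj (hufin.mem_toFinset.1 hb) (hufin.mem_toFinset.1 hc)
              (Ne.symm hcb)) hxb) hxc
          · intro h; exact absurd hb h
        · push Not at hex
          rw [Finset.sum_eq_zero fun b hb => Set.indicator_of_notMem (hex b hb) _]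
          norm_num
      omega

theorem le_of_weighted_cover {X : Type*} [MetricSpace X] {K : Set X} {s h : ℝ}
    (hcov : ∀ F : Finset (X × ℝ), (∀ b ∈ F, 0 < b.2) → K ⊆ ⋃ b ∈ F, ball b.1 b.2 →
      h ≤ ∑ b ∈ F, b.2 ^ s)
    (F : Finset (X × ℝ)) (hF : ∀ b ∈ F, 0 < b.2) (w : X × ℝ → ℝ) (hw : ∀ b, 0 ≤ w b)
    (hm : ∀ x ∈ K, 1 ≤ ∑ b ∈ F, w b * (ball b.1 b.2).indicator 1 x) :
    h ≤ 5 ^ s * ∑ b ∈ F, w b * b.2 ^ s := by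
  set A := 5 ^ s * ∑ b ∈ F, b.2 ^ s with hA
  have key : ∀ N : ℕ, (N : ℝ) * (h - 5 ^ s * ∑ b ∈ F, w b * b.2 ^ s) ≤ A := by
    intro N
    have h1 := card_mul_le_of_multicover hcov F hF N (fun b => ⌈N * w b⌉₊) ?_
    · have h2 : ∑ b ∈ F, ((⌈N * w b⌉₊ : ℕ) : ℝ) * b.2 ^ s ≤
          N * (∑ b ∈ F, w b * b.2 ^ s) + ∑ b ∈ F, b.2 ^ s := by
        rw [Finset.mul_sum, ← Finset.sum_add_distrib]
        refine Finset.sum_le_sum fun b hb => ?_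
        have h3 := (Nat.ceil_lt_add_one (mul_nonneg (Nat.cast_nonneg N) (hw b))).le
        have h4 : 0 ≤ b.2 ^ s := Real.rpow_nonneg (hF b hb).le s
        nlinarith
      have h5 := mul_le_mul_of_nonneg_left h2 (by positivity : (0 : ℝ) ≤ 5 ^ s)
      rw [hA]
      nlinarith
    · intro x hx
      have h1 := hm x hx
      have h2 : (N : ℝ) ≤ ∑ b ∈ F, ((⌈N * w b⌉₊ : ℕ) : ℝ) * (ball b.1 b.2).indicator 1 x := by
        calc (N : ℝ) ≤ N * ∑ b ∈ F, w b * (ball b.1 b.2).indicator 1 x := by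
              have : (0 : ℝ) ≤ N := Nat.cast_nonneg N
              nlinarith
          _ = ∑ b ∈ F, (N * w b) * (ball b.1 b.2).indicator 1 x := by
              rw [Finset.mul_sum]
              exact Finset.sum_congr rfl fun b _ => by ring
          _ ≤ _ := Finset.sum_le_sum fun b _ => by
              gcongr
              · exact Set.indicator_nonneg (fun _ _ => zero_le_one) _
              · exact Nat.le_ceil _
      have h3 : ∑ b ∈ F, ((⌈N * w b⌉₊ : ℕ) : ℝ) * (ball b.1 b.2).indicator 1 x
          = ((∑ b ∈ F, ⌈N * w b⌉₊ * (ball b.1 b.2).indicator 1 x : ℕ) : ℝ) := by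
        push_cast
        refine Finset.sum_congr rfl fun b _ => ?_
        by_cases hx : x ∈ ball b.1 b.2 <;> simp [hx]
      rw [h3] at h2
      exact_mod_cast h2
  by_contra! hcon
  obtain ⟨N, hN⟩ := exists_nat_gt (A / (h - 5 ^ s * ∑ b ∈ F, w b * b.2 ^ s))
  rw [div_lt_iff₀ (by linarith)] at hN
  exact absurd (key N) (not_le.2 hN)

theorem exists_le_sum_rpow_of_hausdorffMeasure_ne_zero {X : Type*} [MetricSpace X]
    [MeasurableSpace X] [BorelSpace X] {K : Set X} {s : ℝ} (hs : 0 < s) (hK : μH[s] K ≠ 0) :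
    ∃ h : ℝ, 0 < h ∧ ∀ F : Finset (X × ℝ), (∀ b ∈ F, 0 < b.2) → K ⊆ ⋃ b ∈ F, ball b.1 b.2 →
      h ≤ ∑ b ∈ F, b.2 ^ s := by
  by_contra! hcon
  have hpos : ∀ k : ℕ, (0 : ℝ) < (1 / ((k : ℝ) + 1)) ^ s := fun k => by positivity
  choose F hF hcov hsum using fun k : ℕ => hcon _ (hpos k)
  apply hK
  have hrad : ∀ k, ∀ b ∈ F k, b.2 ≤ 1 / ((k : ℝ) + 1) := by
    intro k b hb
    have h1 : b.2 ^ s ≤ ∑ b ∈ F k, b.2 ^ s :=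
      Finset.single_le_sum (f := fun b : X × ℝ => b.2 ^ s)
        (fun c hc => Real.rpow_nonneg (hF k c hc).le s) hb
    have h2 := h1.trans (hsum k).le
    exact (Real.rpow_le_rpow_iff (hF k b hb).le (by positivity) hs).1 h2
  have hdiam : ∀ k, ∀ b ∈ F k, ediam (ball b.1 b.2) ≤ ENNReal.ofReal (2 * b.2) := by
    intro k b hb
    rw [← Metric.eball_ofReal]
    refine Metric.ediam_eball_le.trans ?_
    rw [ENNReal.ofReal_mul (by norm_num)]
    simp
  have h3 := Measure.hausdorffMeasure_le_liminf_sum (l := Filter.atTop) s K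
    (fun k : ℕ => ENNReal.ofReal (2 * (1 / ((k : ℝ) + 1)))) ?_
    (fun k (b : F k) => ball b.1.1 b.1.2) ?_ ?_
  · refine le_antisymm (h3.trans ?_) zero_le
    have hle : ∀ k, ∑ b : F k, ediam (ball b.1.1 b.1.2) ^ s ≤
        ENNReal.ofReal (2 ^ s * (1 / ((k : ℝ) + 1)) ^ s) := by
      intro k
      calc ∑ b : F k, ediam (ball b.1.1 b.1.2) ^ s
          ≤ ∑ b : F k, ENNReal.ofReal (2 ^ s * b.1.2 ^ s) := by
            refine Finset.sum_le_sum fun b _ => ?_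
            rw [← Real.mul_rpow (by norm_num) (hF k b.1 b.2).le,
              ← ENNReal.ofReal_rpow_of_nonneg (by have := hF k b.1 b.2; positivity) hs.le]
            exact ENNReal.rpow_le_rpow (hdiam k b.1 b.2) hs.le
        _ = ENNReal.ofReal (∑ b : F k, 2 ^ s * b.1.2 ^ s) := by
            rw [ENNReal.ofReal_sum_of_nonneg]
            intro b _
            have := hF k b.1 b.2
            positivity
        _ ≤ _ := by
            apply ENNReal.ofReal_le_ofReal
            rw [← Finset.mul_sum]
            have : ∑ b : F k, b.1.2 ^ s = ∑ b ∈ F k, b.2 ^ s :=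
              Finset.sum_coe_sort (F k) (fun b => b.2 ^ s)
            rw [this]
            gcongr
            exact (hsum k).le
    refine (Filter.liminf_le_liminf (Filter.Eventually.of_forall hle)).trans (le_of_eq ?_)
    apply Filter.Tendsto.liminf_eq
    rw [← ENNReal.ofReal_zero]
    apply ENNReal.tendsto_ofReal
    have h4 := (tendsto_one_div_add_atTop_nhds_zero_nat (𝕜 := ℝ)).rpow_const (p := s)
      (Or.inr hs.le)
    rw [Real.zero_rpow hs.ne'] at h4
    simpa using h4.const_mul (2 ^ s)
  · rw [← ENNReal.ofReal_zero]
    apply ENNReal.tendsto_ofReal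
    simpa using (tendsto_one_div_add_atTop_nhds_zero_nat (𝕜 := ℝ)).const_mul 2
  · refine Filter.Eventually.of_forall fun k b => (hdiam k b.1 b.2).trans ?_
    apply ENNReal.ofReal_le_ofReal
    have := hrad k b.1 b.2
    linarith
  · refine Filter.Eventually.of_forall fun k x hx => ?_
    have := hcov k hx
    simp only [Set.mem_iUnion] at this ⊢
    obtain ⟨b, hb, hx⟩ := this
    exact ⟨⟨b, hb⟩, hx⟩

open scoped CompactlySupported in
theorem exists_frostman_measure {X : Type*} [MetricSpace X] [ProperSpace X]
    [MeasurableSpace X] [BorelSpace X] {K : Set X} (hK : IsCompact K) {s : ℝ} (hs : 0 < s)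
    (hKs : μH[s] K ≠ 0) :
    ∃ ν : Measure X, IsFiniteMeasure ν ∧ ν Kᶜ = 0 ∧ ν ≠ 0 ∧
      ∀ x r, 0 < r → ν (ball x r) ≤ ENNReal.ofReal ((2 * r) ^ s) := by
  classical
  obtain ⟨h, hh, hcov⟩ := exists_le_sum_rpow_of_hausdorffMeasure_ne_zero hs hKs
  set cost : ((X × ℝ) →₀ ℝ) →ₗ[ℝ] ℝ := Finsupp.linearCombination ℝ (fun b => b.2 ^ s) with hcost
  set Φ : X → ((X × ℝ) →₀ ℝ) →ₗ[ℝ] ℝ := fun x =>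
    Finsupp.linearCombination ℝ (fun b => (ball b.1 b.2).indicator 1 x) with hΦ
  set S : C_c(X, ℝ) → Set ℝ := fun f => {v | ∃ c : (X × ℝ) →₀ ℝ, (∀ b ∈ c.support, 0 < b.2) ∧
    (∀ b, 0 ≤ c b) ∧ (∀ x ∈ K, f x ≤ Φ x c) ∧ v = cost c} with hS
  have cost_nonneg : ∀ c : (X × ℝ) →₀ ℝ, (∀ b ∈ c.support, 0 < b.2) → (∀ b, 0 ≤ c b) →
      0 ≤ cost c := by
    intro c hc1 hc2
    rw [hcost, Finsupp.linearCombination_apply, Finsupp.sum]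
    exact Finset.sum_nonneg fun b hb =>
      smul_nonneg (hc2 b) (Real.rpow_nonneg (hc1 b hb).le s)
  have Sbdd : ∀ f, BddBelow (S f) := by
    intro f
    refine ⟨0, ?_⟩
    rintro v ⟨c, hc1, hc2, -, rfl⟩
    exact cost_nonneg c hc1 hc2
  obtain ⟨x₀, hx₀⟩ : K.Nonempty := by
    rw [Set.nonempty_iff_ne_empty]
    rintro rfl
    simp at hKs
  obtain ⟨R, hRpos, hR⟩ : ∃ R, 0 < R ∧ K ⊆ ball x₀ R := by
    obtain ⟨R, hR⟩ := hK.isBounded.subset_ball_lt 0 x₀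
    exact ⟨R, hR.1, hR.2⟩
  have single_mem : ∀ (f : C_c(X, ℝ)) (x : X) (r M : ℝ), 0 < r → 0 ≤ M →
      (∀ y ∈ K, f y ≤ M * (ball x r).indicator 1 y) → M * r ^ s ∈ S f := by
    intro f x r M hr hM hf
    refine ⟨Finsupp.single (x, r) M, ?_, ?_, ?_, ?_⟩
    · intro b hb
      have := Finsupp.support_single_subset hb
      simp only [Finset.mem_singleton] at this
      rw [this]; exact hr
    · intro b
      rw [Finsupp.single_apply]
      split_ifs <;> simp [hM]
    · intro y hy
      simpa [hΦ, Finsupp.linearCombination_single] using hf y hy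
    · simp [hcost, Finsupp.linearCombination_single]
  have Sne : ∀ f, (S f).Nonempty := by
    intro f
    obtain ⟨M, hM⟩ := hK.bddAbove_image f.continuous.continuousOn
    refine ⟨_, single_mem f x₀ R (max M 0) hRpos (le_max_right _ _) fun y hy => ?_⟩
    rw [Set.indicator_of_mem (hR hy)]
    simpa using Or.inl (hM ⟨y, hy, rfl⟩)
  set p : C_c(X, ℝ) → ℝ := fun f => sInf (S f) with hp
  have p_le : ∀ f v, v ∈ S f → p f ≤ v := fun f v hv => csInf_le (Sbdd f) hv
  have p_nonneg : ∀ f, 0 ≤ p f := fun f => le_csInf (Sne f) (by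
    rintro v ⟨c, hc1, hc2, -, rfl⟩; exact cost_nonneg c hc1 hc2)
  have p_smul_le : ∀ t : ℝ, 0 < t → ∀ f, p (t • f) ≤ t * p f := by
    intro t ht f
    rw [← div_le_iff₀' ht]
    refine le_csInf (Sne f) ?_
    rintro v ⟨c, hc1, hc2, hc3, rfl⟩
    rw [div_le_iff₀' ht]
    refine p_le _ _ ⟨t • c, ?_, ?_, ?_, ?_⟩
    · intro b hb; exact hc1 b (Finsupp.support_smul hb)
    · intro b; exact mul_nonneg ht.le (hc2 b)
    · intro x hx
      rw [map_smul]
      exact mul_le_mul_of_nonneg_left (hc3 x hx) ht.le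
    · rw [map_smul]; rfl
  have p_smul : ∀ t : ℝ, 0 < t → ∀ f, p (t • f) = t * p f := by
    intro t ht f
    refine le_antisymm (p_smul_le t ht f) ?_
    have := p_smul_le t⁻¹ (inv_pos.2 ht) (t • f)
    rw [smul_smul, inv_mul_cancel₀ ht.ne', one_smul] at this
    calc t * p f ≤ t * (t⁻¹ * p (t • f)) := mul_le_mul_of_nonneg_left this ht.le
      _ = _ := by field_simp
  have p_add : ∀ f g, p (f + g) ≤ p f + p g := by
    intro f g
    rw [← sub_le_iff_le_add]
    refine le_csInf (Sne f) ?_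
    rintro v ⟨c, hc1, hc2, hc3, rfl⟩
    rw [sub_le_comm]
    refine le_csInf (Sne g) ?_
    rintro v ⟨d, hd1, hd2, hd3, rfl⟩
    rw [sub_le_iff_le_add']
    refine p_le _ _ ⟨c + d, ?_, ?_, ?_, ?_⟩
    · intro b hb
      rcases Finset.mem_union.1 (Finsupp.support_add hb) with h | h
      · exact hc1 b h
      · exact hd1 b h
    · intro b; exact add_nonneg (hc2 b) (hd2 b)
    · intro x hx
      rw [map_add]
      exact add_le_add (hc3 x hx) (hd3 x hx)
    · rw [map_add]
  obtain ⟨χ', hχ1, -, hχc, hχ01⟩ := exists_continuous_one_zero_of_isCompact hK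
    (isClosed_empty (X := X)) (Set.disjoint_empty K)
  let χ : C_c(X, ℝ) := ⟨χ', hχc⟩
  have hχK : ∀ x ∈ K, χ x = 1 := fun x hx => hχ1 hx
  have hχne : χ ≠ 0 := by
    intro h0
    have := hχK x₀ hx₀
    rw [h0] at this
    simp at this
  set h' := h / 5 ^ s with hh'
  have hh'pos : 0 < h' := by positivity
  have hpχ : h' ≤ p χ := by
    refine le_csInf (Sne χ) ?_
    rintro v ⟨c, hc1, hc2, hc3, rfl⟩
    rw [hh', div_le_iff₀' (by positivity)]
    refine (le_of_weighted_cover hcov c.support hc1 c hc2 fun x hx => ?_).trans (le_of_eq ?_)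
    · have := hc3 x hx
      rw [hχK x hx, hΦ, Finsupp.linearCombination_apply, Finsupp.sum] at this
      simpa using this
    · rw [hcost, Finsupp.linearCombination_apply, Finsupp.sum]
      simp
  obtain ⟨Λ, hΛ1, hΛ2⟩ := exists_extension_of_le_sublinear
    (LinearPMap.mkSpanSingleton χ h' hχne) p p_smul p_add (by
      rintro ⟨x, hx⟩
      obtain ⟨t, rfl⟩ := Submodule.mem_span_singleton.1 hx
      have e : (LinearPMap.mkSpanSingleton χ h' hχne) ⟨t • χ, hx⟩ = t * h' := by
        exact LinearPMap.mkSpanSingleton'_apply (σ := RingHom.id ℝ) χ h' _ t hx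
      rw [e]
      rcases le_or_gt t 0 with ht | ht
      · exact (mul_nonpos_of_nonpos_of_nonneg ht hh'pos.le).trans (p_nonneg _)
      · rw [p_smul t ht]
        exact mul_le_mul_of_nonneg_left hpχ ht.le)
  have hΛχ : Λ χ = h' := by
    have hm : χ ∈ Submodule.span ℝ {χ} :=
      Submodule.mem_span_singleton_self (R := ℝ) χ
    rw [hΛ1 ⟨χ, hm⟩]
    exact LinearPMap.mkSpanSingleton'_apply_self (σ := RingHom.id ℝ) χ h' _ hm
  have hΛ0 : ∀ f : C_c(X, ℝ), (∀ x ∈ K, f x ≤ 0) → Λ f ≤ 0 := by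
    intro f hf
    refine (hΛ2 f).trans (p_le f 0 ⟨0, by simp, by simp, ?_, by simp⟩)
    intro x hx
    simpa using hf x hx
  let Λ' : C_c(X, ℝ) →ₚ[ℝ] ℝ :=
    { toFun := Λ
      map_add' := map_add Λ
      map_smul' := map_smul Λ
      monotone' := by
        intro f g hfg
        have := hΛ0 (f - g) fun x _ => sub_nonpos.2 (hfg x)
        rw [map_sub] at this
        exact sub_nonpos.1 this }
  have hΛ' : ∀ f, Λ' f = Λ f := fun f => rfl
  set ν := RealRMK.rieszMeasure Λ' with hν
  have hball : ∀ x r, 0 < r → ν (ball x r) ≤ ENNReal.ofReal ((2 * r) ^ s) := by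
    intro x r hr
    obtain ⟨f, hf1, hf0, hfc, hf01⟩ := exists_continuous_one_zero_of_isCompact
      (isCompact_closedBall x r) (isOpen_ball (x := x) (ε := 2 * r)).isClosed_compl
      (Set.disjoint_compl_right_iff_subset.2 (closedBall_subset_ball (by linarith)))
    refine (measure_mono ball_subset_closedBall).trans
      ((RealRMK.rieszMeasure_le_of_eq_one Λ' (f := ⟨f, hfc⟩) (fun y => (hf01 y).1)
        (isCompact_closedBall x r) (fun y hy => hf1 hy)).trans ?_)
    refine ENNReal.ofReal_le_ofReal ((hΛ2 _).trans (p_le _ _ ?_))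
    rw [← one_mul ((2 * r) ^ s)]
    refine single_mem _ x (2 * r) 1 (by linarith) zero_le_one fun y _ => ?_
    by_cases hy : y ∈ ball x (2 * r)
    · rw [Set.indicator_of_mem hy]
      simpa using (hf01 y).2
    · rw [Set.indicator_of_notMem hy]
      have : f y = 0 := hf0 hy
      simpa using this.le
  have hKc : ν Kᶜ = 0 := by
    rw [hK.isClosed.isOpen_compl.measure_eq_iSup_isCompact]
    simp only [ENNReal.iSup_eq_zero]
    intro L hLK hL
    obtain ⟨f, hf1, hf0, hfc, hf01⟩ := exists_continuous_one_zero_of_isCompact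
      hL hK.isClosed (Set.disjoint_left.2 fun x hx hxK => hLK hx hxK)
    refine le_antisymm ((RealRMK.rieszMeasure_le_of_eq_one Λ' (f := ⟨f, hfc⟩)
      (fun y => (hf01 y).1) hL (fun y hy => hf1 hy)).trans ?_) zero_le
    exact (ENNReal.ofReal_eq_zero.2 (hΛ0 ⟨f, hfc⟩ fun x hx => le_of_eq (hf0 hx))).le
  refine ⟨ν, ⟨?_⟩, hKc, ?_, hball⟩
  · rw [← Set.union_compl_self K]
    refine (measure_union_le _ _).trans_lt ?_
    rw [hKc, add_zero]
    exact (measure_mono hR).trans_lt ((hball x₀ R hRpos).trans_lt ENNReal.ofReal_lt_top)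
  · intro h0
    have := RealRMK.integral_rieszMeasure Λ' χ
    rw [← hν, h0, integral_zero_measure, hΛ', hΛχ] at this
    exact hh'pos.ne this

theorem integrable_exp_neg_mul_norm {V : Type*} [NormedAddCommGroup V] [NormedSpace ℝ V]
    [FiniteDimensional ℝ V] [MeasurableSpace V] [BorelSpace V] (μ : Measure V)
    [μ.IsAddHaarMeasure] {c : ℝ} (hc : 0 < c) :
    Integrable (fun ξ : V => rexp (-c * ‖ξ‖)) μ := by
  set N := Module.finrank ℝ V + 1 with hN
  have h1 : Integrable (fun ξ : V => (1 + ‖ξ‖) ^ (-(N : ℝ))) μ :=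
    integrable_one_add_norm (by rw [hN]; push_cast; linarith)
  refine (h1.const_mul (N.factorial / c ^ N * rexp c)).mono' (by fun_prop)
    (Filter.Eventually.of_forall fun ξ => ?_)
  rw [Real.norm_of_nonneg (Real.exp_pos _).le]
  have h0 : 0 ≤ ‖ξ‖ := norm_nonneg ξ
  have h2 := Real.pow_div_factorial_le_exp (c * (1 + ‖ξ‖)) (by positivity) N
  rw [Real.rpow_neg (by positivity), Real.rpow_natCast]
  rw [div_le_iff₀ (by positivity), mul_pow] at h2
  have h3 : rexp (-c * ‖ξ‖) = rexp c * (rexp (c * (1 + ‖ξ‖)))⁻¹ := by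
    rw [← Real.exp_neg, ← Real.exp_add]; congr 1; ring
  rw [h3]
  have h4 : (rexp (c * (1 + ‖ξ‖)))⁻¹ ≤ N.factorial / c ^ N * ((1 + ‖ξ‖) ^ N)⁻¹ := by
    rw [inv_le_iff_one_le_mul₀ (Real.exp_pos _)]
    have h5 : 0 < c ^ N * (1 + ‖ξ‖) ^ N := by positivity
    calc (1 : ℝ) = (c ^ N * (1 + ‖ξ‖) ^ N) / (c ^ N * (1 + ‖ξ‖) ^ N) := (div_self h5.ne').symm
      _ ≤ (rexp (c * (1 + ‖ξ‖)) * N.factorial) / (c ^ N * (1 + ‖ξ‖) ^ N) := by gcongr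
      _ = _ := by field_simp
  calc rexp c * (rexp (c * (1 + ‖ξ‖)))⁻¹
      ≤ rexp c * (N.factorial / c ^ N * ((1 + ‖ξ‖) ^ N)⁻¹) := by gcongr
    _ = _ := by ring

theorem integral_exp_neg_pi_sq_comp {τ ρ : ℝ} (hτ : 0 < τ) (hρ : 0 < ρ) :
    IntegrableOn (fun v : ℝ => rexp (-π * τ ^ 2 * v ^ 2 - π * ρ ^ 2 / v ^ 2)) (Set.Ioi 0) ∧
    ∫ v in Set.Ioi (0 : ℝ), rexp (-π * τ ^ 2 * v ^ 2 - π * ρ ^ 2 / v ^ 2) =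
      rexp (-2 * π * τ * ρ) / (2 * τ) := by
  set e : ℝ → ℝ := fun x => ∫ t in (0 : ℝ)..x, rexp (-π * t ^ 2) with he
  have hcont : Continuous fun t : ℝ => rexp (-π * t ^ 2) := by fun_prop
  have hde : ∀ x, HasDerivAt e (rexp (-π * x ^ 2)) x := fun x =>
    (hcont.integral_hasStrictDerivAt 0 x).hasDerivAt
  have hhalf : ∫ t in Set.Ioi (0 : ℝ), rexp (-π * t ^ 2) = 1 / 2 := by
    rw [integral_gaussian_Ioi, div_self Real.pi_ne_zero, Real.sqrt_one]
  have htop : Filter.Tendsto e Filter.atTop (nhds (1 / 2)) := by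
    rw [← hhalf]
    exact intervalIntegral_tendsto_integral_Ioi 0
      (integrable_exp_neg_mul_sq Real.pi_pos).integrableOn Filter.tendsto_id
  have hodd : ∀ x, e (-x) = - e x := by
    intro x
    simp only [he]
    have := intervalIntegral.integral_comp_neg (a := 0) (b := x) (fun t : ℝ => rexp (-π * t ^ 2))
    rw [neg_zero] at this
    rw [intervalIntegral.integral_symm, ← this]
    simp
  have hbot : Filter.Tendsto e Filter.atBot (nhds (-(1 / 2))) := by
    have h1 : e = fun x => - e (-x) := by ext x; rw [hodd]; ring
    rw [h1]
    exact (htop.comp Filter.tendsto_neg_atBot_atTop).neg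
  set g : ℝ → ℝ := fun v => rexp (-2 * π * τ * ρ) / (2 * τ) *
    (e (τ * v - ρ / v) + rexp (4 * π * τ * ρ) * e (τ * v + ρ / v)) with hg
  have hdg : ∀ v ∈ Set.Ioi (0 : ℝ),
      HasDerivAt g (rexp (-π * τ ^ 2 * v ^ 2 - π * ρ ^ 2 / v ^ 2)) v := by
    intro v hv
    have hv0 : v ≠ 0 := (ne_of_gt hv)
    have hdiv : HasDerivAt (fun v => ρ / v) (-(ρ / v ^ 2)) v := by
      have := (hasDerivAt_inv hv0).const_mul ρ
      convert! this using 1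
      ring
    have hlin : HasDerivAt (fun v => τ * v) τ v := by
      simpa using (hasDerivAt_id v).const_mul τ
    have h1 := (hde (τ * v - ρ / v)).comp v (hlin.sub hdiv)
    have h2 := (hde (τ * v + ρ / v)).comp v (hlin.add hdiv)
    have h3 := (h1.add (h2.const_mul (rexp (4 * π * τ * ρ)))).const_mul
      (rexp (-2 * π * τ * ρ) / (2 * τ))
    convert! h3 using 1
    have e1 : rexp (-π * (τ * v - ρ / v) ^ 2) =
        rexp (-π * τ ^ 2 * v ^ 2 - π * ρ ^ 2 / v ^ 2) * rexp (2 * π * τ * ρ) := by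
      rw [← Real.exp_add]; congr 1; field_simp; ring
    have e2 : rexp (4 * π * τ * ρ) * rexp (-π * (τ * v + ρ / v) ^ 2) =
        rexp (-π * τ ^ 2 * v ^ 2 - π * ρ ^ 2 / v ^ 2) * rexp (2 * π * τ * ρ) := by
      rw [← Real.exp_add, ← Real.exp_add]; congr 1; field_simp; ring
    rw [← mul_assoc (rexp (4 * π * τ * ρ)), e1, e2]
    have e3 : rexp (-2 * π * τ * ρ) * rexp (2 * π * τ * ρ) = 1 := by
      rw [← Real.exp_add]; simp
    calc _ = rexp (-π * τ ^ 2 * v ^ 2 - π * ρ ^ 2 / v ^ 2) * 1 := (mul_one _).symm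
      _ = rexp (-π * τ ^ 2 * v ^ 2 - π * ρ ^ 2 / v ^ 2) *
          (rexp (-2 * π * τ * ρ) * rexp (2 * π * τ * ρ)) := by rw [e3]
      _ = _ := by field_simp; ring
  have hinv0 : Filter.Tendsto (fun v : ℝ => ρ / v) (nhdsWithin 0 (Set.Ioi 0)) Filter.atTop := by
    simpa [div_eq_mul_inv] using tendsto_inv_nhdsGT_zero.const_mul_atTop hρ
  have hlin0 : Filter.Tendsto (fun v : ℝ => τ * v) (nhdsWithin 0 (Set.Ioi 0)) (nhds 0) := by
    have : Filter.Tendsto (fun v : ℝ => τ * v) (nhds 0) (nhds (τ * 0)) :=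
      (continuous_const.mul continuous_id).tendsto 0
    rw [mul_zero] at this
    exact this.mono_left nhdsWithin_le_nhds
  have hinvT : Filter.Tendsto (fun v : ℝ => ρ / v) Filter.atTop (nhds 0) :=
    Filter.tendsto_id.const_div_atTop ρ
  have hlinT : Filter.Tendsto (fun v : ℝ => τ * v) Filter.atTop Filter.atTop :=
    Filter.tendsto_id.const_mul_atTop hτ
  have hg0 : Filter.Tendsto g (nhdsWithin 0 (Set.Ioi 0)) (nhds
      (rexp (-2 * π * τ * ρ) / (2 * τ) * (-(1 / 2) + rexp (4 * π * τ * ρ) * (1 / 2)))) := by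
    refine Filter.Tendsto.const_mul _ (Filter.Tendsto.add (hbot.comp ?_)
      ((htop.comp ?_).const_mul _))
    · simpa [sub_eq_add_neg] using hlin0.add_atBot (Filter.tendsto_neg_atTop_atBot.comp hinv0)
    · exact hlin0.add_atTop hinv0
  have hgT : Filter.Tendsto g Filter.atTop (nhds
      (rexp (-2 * π * τ * ρ) / (2 * τ) * (1 / 2 + rexp (4 * π * τ * ρ) * (1 / 2)))) := by
    refine Filter.Tendsto.const_mul _ (Filter.Tendsto.add (htop.comp ?_)
      ((htop.comp ?_).const_mul _))
    · simpa [sub_eq_add_neg] using hlinT.atTop_add hinvT.neg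
    · exact hlinT.atTop_add hinvT
  set G := Function.update g 0
    (rexp (-2 * π * τ * ρ) / (2 * τ) * (-(1 / 2) + rexp (4 * π * τ * ρ) * (1 / 2))) with hG
  have hGc : ContinuousWithinAt G (Set.Ici 0) 0 := by
    rw [hG, continuousWithinAt_update_same]
    simpa using hg0
  have hGd : ∀ v ∈ Set.Ioi (0 : ℝ),
      HasDerivAt G (rexp (-π * τ ^ 2 * v ^ 2 - π * ρ ^ 2 / v ^ 2)) v := by
    intro v hv
    refine (hdg v hv).congr_of_eventuallyEq ?_
    filter_upwards [Ioi_mem_nhds hv] with w hw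
    exact Function.update_of_ne (ne_of_gt hw) _ _
  have hGT : Filter.Tendsto G Filter.atTop (nhds
      (rexp (-2 * π * τ * ρ) / (2 * τ) * (1 / 2 + rexp (4 * π * τ * ρ) * (1 / 2)))) := by
    refine hgT.congr' ?_
    filter_upwards [Filter.Ioi_mem_atTop (0 : ℝ)] with w hw
    exact (Function.update_of_ne (ne_of_gt hw) _ _).symm
  refine ⟨integrableOn_Ioi_deriv_of_nonneg hGc hGd (fun v _ => (Real.exp_pos _).le) hGT, ?_⟩
  rw [integral_Ioi_of_hasDerivAt_of_nonneg hGc hGd (fun v _ => (Real.exp_pos _).le) hGT, hG,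
    Function.update_self]
  ring

theorem integral_gaussian_fourier {n : ℕ} (x : E n) {v : ℝ} (hv : 0 < v) :
    ∫ ξ : E n, ((rexp (-π / v ^ 2 * ‖ξ‖ ^ 2) : ℝ) : ℂ) *
      Complex.exp (((2 * π * ⟪x, ξ⟫ : ℝ) : ℂ) * Complex.I) =
      ((v ^ (n : ℝ) * rexp (-π * ‖x‖ ^ 2 * v ^ 2) : ℝ) : ℂ) := by
  have hb : 0 < ((π / v ^ 2 : ℝ) : ℂ).re := by
    rw [Complex.ofReal_re]; positivity
  have h := GaussianFourier.integral_cexp_neg_mul_sq_norm_add hb (2 * π * Complex.I) x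
  rw [finrank_euclideanSpace_fin] at h
  have e1 : ((π : ℂ) / ((π / v ^ 2 : ℝ) : ℂ)) ^ ((n : ℂ) / 2) = ((v ^ (n : ℝ) : ℝ) : ℂ) := by
    rw [← Complex.ofReal_div, show π / (π / v ^ 2) = v ^ 2 by field_simp,
      show ((n : ℂ) / 2) = ((n / 2 : ℝ) : ℂ) by push_cast; ring,
      ← Complex.ofReal_cpow (by positivity), ← Real.rpow_natCast v 2, ← Real.rpow_mul hv.le]
    congr 2
    push_cast
    ring
  have e2 : Complex.exp ((2 * π * Complex.I) ^ 2 * (‖x‖ : ℂ) ^ 2 / (4 * ((π / v ^ 2 : ℝ) : ℂ))) =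
      ((rexp (-π * ‖x‖ ^ 2 * v ^ 2) : ℝ) : ℂ) := by
    rw [Complex.ofReal_exp]
    congr 1
    push_cast
    have : (v : ℂ) ≠ 0 := by exact_mod_cast hv.ne'
    have : (π : ℂ) ≠ 0 := by exact_mod_cast Real.pi_ne_zero
    rw [mul_pow, Complex.I_sq]
    field_simp
    ring
  rw [e1, e2, ← Complex.ofReal_mul] at h
  rw [← h]
  refine integral_congr_ae (Filter.Eventually.of_forall fun ξ => ?_)
  simp only
  rw [Complex.ofReal_exp, ← Complex.exp_add]
  congr 1
  push_cast
  ring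

theorem integral_poisson_real {n : ℕ} (hn : n ≠ 0) (x : E n) {τ : ℝ} (hτ : 0 < τ) :
    ∫ ξ : E n, ((rexp (-2 * π * τ * ‖ξ‖) : ℝ) : ℂ) *
      Complex.exp (((2 * π * ⟪x, ξ⟫ : ℝ) : ℂ) * Complex.I) =
      ((τ * Real.Gamma (((n : ℝ) + 1) / 2) *
        (π * (τ ^ 2 + ‖x‖ ^ 2)) ^ (-(((n : ℝ) + 1) / 2)) : ℝ) : ℂ) := by
  have : Nonempty (Fin n) := ⟨⟨0, Nat.pos_of_ne_zero hn⟩⟩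
  have : Nontrivial (E n) := inferInstance
  set F : E n → ℝ → ℂ := fun ξ v =>
    ((rexp (-π * τ ^ 2 * v ^ 2 - π * ‖ξ‖ ^ 2 / v ^ 2) : ℝ) : ℂ) *
      Complex.exp (((2 * π * ⟪x, ξ⟫ : ℝ) : ℂ) * Complex.I) with hF
  have hnorm : ∀ ξ v, ‖F ξ v‖ = rexp (-π * τ ^ 2 * v ^ 2 - π * ‖ξ‖ ^ 2 / v ^ 2) := by
    intro ξ v
    rw [hF, norm_mul, Complex.norm_exp_ofReal_mul_I, mul_one, Complex.norm_real,
      Real.norm_of_nonneg (Real.exp_pos _).le]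
  have hne : ∀ᵐ ξ : E n, 0 < ‖ξ‖ := by
    have : ∀ᵐ ξ : E n, ξ ≠ 0 := by
      simp [ae_iff]
    filter_upwards [this] with ξ hξ
    exact norm_pos_iff.2 hξ
  have hmeas : AEStronglyMeasurable (Function.uncurry F)
      ((volume : Measure (E n)).prod (volume.restrict (Set.Ioi (0 : ℝ)))) := by
    refine Measurable.aestronglyMeasurable ?_
    simp only [hF, Function.uncurry_def]
    fun_prop
  have hint : Integrable (Function.uncurry F)
      ((volume : Measure (E n)).prod (volume.restrict (Set.Ioi (0 : ℝ)))) := by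
    rw [integrable_prod_iff hmeas]
    constructor
    · filter_upwards [hne] with ξ hξ
      refine (integral_exp_neg_pi_sq_comp hτ hξ).1.mono' ?_
        (Filter.Eventually.of_forall fun v => (hnorm ξ v).le)
      refine Measurable.aestronglyMeasurable ?_
      simp only [hF, Function.uncurry_def]
      fun_prop
    · have h1 : Integrable (fun ξ : E n => rexp (-(2 * π * τ) * ‖ξ‖) / (2 * τ)) :=
        (integrable_exp_neg_mul_norm volume (by positivity)).div_const _
      refine h1.congr ?_
      filter_upwards [hne] with ξ hξ
      simp only [Function.uncurry_apply_pair, hnorm]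
      rw [(integral_exp_neg_pi_sq_comp hτ hξ).2]
      congr 2
      ring
  have hswap := integral_integral_swap hint
  have hL : ∫ ξ : E n, ((rexp (-2 * π * τ * ‖ξ‖) : ℝ) : ℂ) *
      Complex.exp (((2 * π * ⟪x, ξ⟫ : ℝ) : ℂ) * Complex.I) =
      2 * τ * ∫ ξ : E n, ∫ v in Set.Ioi (0 : ℝ), F ξ v := by
    rw [← integral_const_mul]
    refine integral_congr_ae ?_
    filter_upwards [hne] with ξ hξ
    simp only [hF]
    rw [integral_mul_const, integral_complex_ofReal, (integral_exp_neg_pi_sq_comp hτ hξ).2]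
    have : (τ : ℂ) ≠ 0 := by exact_mod_cast hτ.ne'
    push_cast
    field_simp
  rw [hL, hswap]
  set X := π * (τ ^ 2 + ‖x‖ ^ 2) with hX
  have hXpos : 0 < X := by positivity
  have hin : ∀ v ∈ Set.Ioi (0 : ℝ), ∫ ξ : E n, F ξ v =
      ((v ^ (n : ℝ) * rexp (-X * v ^ (2 : ℝ)) : ℝ) : ℂ) := by
    intro v hv
    have h1 := integral_gaussian_fourier x (Set.mem_Ioi.1 hv)
    have h2 : ∀ ξ, F ξ v = ((rexp (-π * τ ^ 2 * v ^ 2) : ℝ) : ℂ) *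
        (((rexp (-π / v ^ 2 * ‖ξ‖ ^ 2) : ℝ) : ℂ) *
      Complex.exp (((2 * π * ⟪x, ξ⟫ : ℝ) : ℂ) * Complex.I)) := by
      intro ξ
      simp only [hF]
      rw [← mul_assoc, ← Complex.ofReal_mul, ← Real.exp_add]
      congr 4
      ring
    simp_rw [h2]
    rw [integral_const_mul, h1, ← Complex.ofReal_mul]
    congr 1
    rw [mul_left_comm, ← Real.exp_add, Real.rpow_two]
    congr 2
    rw [hX]; ring
  rw [setIntegral_congr_fun measurableSet_Ioi hin, integral_complex_ofReal,
    integral_rpow_mul_exp_neg_mul_rpow two_pos (by have := Nat.cast_nonneg (α := ℝ) n; linarith)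
      hXpos]
  push_cast
  rw [neg_div]
  ring

theorem differentiableAt_integral_cexp_neg_mul_norm {n : ℕ} (w : E n → ℂ) (hw : Measurable w)
    (hw1 : ∀ ξ, ‖w ξ‖ ≤ 1) {z : ℂ} (hz : 0 < z.re) :
    DifferentiableAt ℂ
      (fun z : ℂ => ∫ ξ : E n, Complex.exp (-2 * π * z * (‖ξ‖ : ℂ)) * w ξ) z := by
  have hbound : ∀ (c : ℝ) (ξ : E n), ‖(Complex.exp (c * (‖ξ‖ : ℂ)))‖ = rexp (c * ‖ξ‖) := by
    intro c ξ
    rw [← Complex.ofReal_mul, ← Complex.ofReal_exp, Complex.norm_real,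
      Real.norm_of_nonneg (Real.exp_pos _).le]
  have hnorm : ∀ (y : ℂ) (ξ : E n), ‖Complex.exp (-2 * π * y * (‖ξ‖ : ℂ))‖ =
      rexp (-2 * π * y.re * ‖ξ‖) := by
    intro y ξ
    rw [Complex.norm_exp]
    congr 1
    simp [Complex.mul_re]
  set δ := z.re / 2 with hδ
  have hδ0 : 0 < δ := by positivity
  have hs : Metric.ball z δ ∈ nhds z := Metric.ball_mem_nhds z hδ0
  have hre : ∀ y ∈ Metric.ball z δ, δ < y.re := by
    intro y hy
    have h1 : |(y - z).re| ≤ ‖y - z‖ := Complex.abs_re_le_norm _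
    have h2 : ‖y - z‖ < δ := by simpa [dist_eq_norm] using hy
    have h3 := (abs_lt.1 (h1.trans_lt h2)).1
    simp only [Complex.sub_re] at h3
    linarith
  have hmeas : ∀ y : ℂ, AEStronglyMeasurable
      (fun ξ : E n => Complex.exp (-2 * π * y * (‖ξ‖ : ℂ)) * w ξ) volume := by
    intro y
    exact Measurable.aestronglyMeasurable (by fun_prop)
  have key := hasDerivAt_integral_of_dominated_loc_of_deriv_le (μ := (volume : Measure (E n)))
    (F := fun (y : ℂ) (ξ : E n) => Complex.exp (-2 * π * y * (‖ξ‖ : ℂ)) * w ξ)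
    (F' := fun (y : ℂ) (ξ : E n) =>
      Complex.exp (-2 * π * y * (‖ξ‖ : ℂ)) * (-2 * π * (‖ξ‖ : ℂ)) * w ξ)
    (x₀ := z) (bound := fun ξ => (2 / δ) * rexp (-(π * δ) * ‖ξ‖)) hs
    (Filter.Eventually.of_forall hmeas) ?_ ?_ ?_ ?_ ?_
  · exact key.2.differentiableAt
  · refine (integrable_exp_neg_mul_norm (V := E n) volume (c := 2 * π * z.re)
      (by positivity)).mono' (hmeas z) (Filter.Eventually.of_forall fun ξ => ?_)
    rw [norm_mul, hnorm]
    calc _ ≤ rexp (-2 * π * z.re * ‖ξ‖) * 1 := by gcongr; exact hw1 ξ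
      _ = _ := by rw [mul_one]; congr 1; ring
  · exact Measurable.aestronglyMeasurable (by fun_prop)
  · refine Filter.Eventually.of_forall fun ξ y hy => ?_
    rw [norm_mul, norm_mul, hnorm]
    have h1 : ‖(-2 * π * (‖ξ‖ : ℂ) : ℂ)‖ = 2 * π * ‖ξ‖ := by
      simp [abs_of_pos Real.pi_pos]
    rw [h1]
    have h2 : π * δ * ‖ξ‖ ≤ rexp (π * δ * ‖ξ‖) := by
      have := Real.add_one_le_exp (π * δ * ‖ξ‖); linarith
    have h3 := hre y hy
    calc rexp (-2 * π * y.re * ‖ξ‖) * (2 * π * ‖ξ‖) * ‖w ξ‖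
        ≤ rexp (-2 * π * δ * ‖ξ‖) * (2 * π * ‖ξ‖) * 1 := by
          have : -2 * π * y.re * ‖ξ‖ ≤ -2 * π * δ * ‖ξ‖ := by
            have : π * δ * ‖ξ‖ ≤ π * y.re * ‖ξ‖ := by gcongr
            linarith
          gcongr
          exact hw1 ξ
      _ = (2 / δ) * (rexp (-2 * π * δ * ‖ξ‖) * (π * δ * ‖ξ‖)) := by field_simp
      _ ≤ (2 / δ) * (rexp (-2 * π * δ * ‖ξ‖) * rexp (π * δ * ‖ξ‖)) := by gcongr
      _ = _ := by rw [← Real.exp_add]; congr 2; ring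
  · exact (integrable_exp_neg_mul_norm (V := E n) volume (by positivity)).const_mul _
  · refine Filter.Eventually.of_forall fun ξ y _ => ?_
    have h : HasDerivAt (fun y : ℂ => -2 * π * y * (‖ξ‖ : ℂ)) (-2 * π * (‖ξ‖ : ℂ)) y := by
      have := ((hasDerivAt_id y).const_mul (-2 * π : ℂ)).mul_const (‖ξ‖ : ℂ)
      simpa using this
    exact (h.cexp).mul_const _

theorem integral_poisson_complex {n : ℕ} (hn : n ≠ 0) (x : E n) {z : ℂ} (hz : 0 < z.re) :
    ∫ ξ : E n, Complex.exp (-2 * π * z * (‖ξ‖ : ℂ)) *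
      Complex.exp (((2 * π * ⟪x, ξ⟫ : ℝ) : ℂ) * Complex.I) =
      ((Real.Gamma (((n : ℝ) + 1) / 2) * π ^ (-(((n : ℝ) + 1) / 2)) : ℝ) : ℂ) * z *
        ((z - ‖x‖ * Complex.I) ^ ((-(((n : ℝ) + 1) / 2) : ℝ) : ℂ) *
          (z + ‖x‖ * Complex.I) ^ ((-(((n : ℝ) + 1) / 2) : ℝ) : ℂ)) := by
  set U : Set ℂ := {z | 0 < z.re} with hU
  have hUo : IsOpen U := isOpen_lt continuous_const Complex.continuous_re
  have hconv : Convex ℝ U := convex_halfSpace_re_gt 0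
  set b : ℝ := -(((n : ℝ) + 1) / 2) with hb
  have hf : AnalyticOnNhd ℂ (fun z : ℂ => ∫ ξ : E n, Complex.exp (-2 * π * z * (‖ξ‖ : ℂ)) *
      Complex.exp (((2 * π * ⟪x, ξ⟫ : ℝ) : ℂ) * Complex.I)) U := by
    refine DifferentiableOn.analyticOnNhd (fun y hy => ?_) hUo
    exact (differentiableAt_integral_cexp_neg_mul_norm _ (by fun_prop)
      (fun ξ => (Complex.norm_exp_ofReal_mul_I _).le) hy).differentiableWithinAt
  have hg : AnalyticOnNhd ℂ (fun z : ℂ =>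
      ((Real.Gamma (((n : ℝ) + 1) / 2) * π ^ b : ℝ) : ℂ) * z *
        ((z - ‖x‖ * Complex.I) ^ (b : ℂ) * (z + ‖x‖ * Complex.I) ^ (b : ℂ))) U := by
    refine DifferentiableOn.analyticOnNhd (fun y hy => ?_) hUo
    refine DifferentiableAt.differentiableWithinAt ?_
    have hy' : 0 < y.re := hy
    have h1 : (y - ‖x‖ * Complex.I) ∈ Complex.slitPlane := Or.inl (by simpa using hy')
    have h2 : (y + ‖x‖ * Complex.I) ∈ Complex.slitPlane := Or.inl (by simpa using hy')
    have h3 : DifferentiableAt ℂ (fun z : ℂ => (z - ‖x‖ * Complex.I) ^ (b : ℂ)) y :=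
      DifferentiableAt.cpow (by fun_prop) (by fun_prop) h1
    have h4 : DifferentiableAt ℂ (fun z : ℂ => (z + ‖x‖ * Complex.I) ^ (b : ℂ)) y :=
      DifferentiableAt.cpow (by fun_prop) (by fun_prop) h2
    fun_prop
  have h1U : (1 : ℂ) ∈ U := by simp [hU]
  refine hf.eqOn_of_preconnected_of_frequently_eq hg hconv.isPreconnected h1U ?_ hz
  have ht : Filter.Tendsto (fun τ : ℝ => (τ : ℂ)) (nhdsWithin 1 {1}ᶜ)
      (nhdsWithin (1 : ℂ) {1}ᶜ) := by
    refine tendsto_nhdsWithin_of_tendsto_nhds_of_eventually_within _ ?_ ?_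
    · exact (Complex.continuous_ofReal.tendsto' 1 1 (by simp)).mono_left nhdsWithin_le_nhds
    · filter_upwards [self_mem_nhdsWithin] with τ hτ
      simpa using hτ
  refine ht.frequently (Filter.Eventually.frequently ?_)
  have hpos : ∀ᶠ τ : ℝ in nhdsWithin 1 {1}ᶜ, 0 < τ :=
    nhdsWithin_le_nhds (lt_mem_nhds one_pos)
  filter_upwards [hpos] with τ hτ
  have h := integral_poisson_real hn x hτ
  have e1 : ∀ ξ : E n, Complex.exp (-2 * π * (τ : ℂ) * (‖ξ‖ : ℂ)) =
      ((rexp (-2 * π * τ * ‖ξ‖) : ℝ) : ℂ) := by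
    intro ξ; push_cast; rfl
  simp only [e1]
  rw [h]
  have e2 : ((τ : ℂ) - ‖x‖ * Complex.I) ^ (b : ℂ) * ((τ : ℂ) + ‖x‖ * Complex.I) ^ (b : ℂ) =
      (((τ ^ 2 + ‖x‖ ^ 2) ^ b : ℝ) : ℂ) := by
    have hc : ((τ : ℂ) - ‖x‖ * Complex.I) =
        (starRingEnd ℂ) ((τ : ℂ) + ‖x‖ * Complex.I) := by
      simp [sub_eq_add_neg]
    set w : ℂ := (τ : ℂ) + ‖x‖ * Complex.I with hw
    have hwre : 0 < w.re := by simp [hw, hτ]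
    have harg : w.arg ≠ π := by
      intro h
      have := Complex.arg_eq_pi_iff.1 h
      linarith [this.1]
    have hns : Complex.normSq w = τ ^ 2 + ‖x‖ ^ 2 := by
      simp [hw, Complex.normSq_apply]; ring
    rw [hc, Complex.conj_cpow _ _ harg, Complex.conj_ofReal, mul_comm, Complex.mul_conj,
      ← hns, Complex.normSq_eq_norm_sq, Complex.normSq_eq_norm_sq,
      Complex.norm_cpow_of_ne_zero (by rintro h; simp [h] at hwre)]
    simp only [Complex.ofReal_re, Complex.ofReal_im, mul_zero, Real.exp_zero, div_one]
    rw [← Real.rpow_natCast, ← Real.rpow_natCast, ← Real.rpow_mul (norm_nonneg _),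
      ← Real.rpow_mul (norm_nonneg _), mul_comm b]
  rw [e2, Real.mul_rpow Real.pi_pos.le (by positivity)]
  push_cast
  ring

theorem integral_rpow_mul_add_rpow_le {a σ A : ℝ} (ha : 0 < a) (hσ : σ < 1) (hA : 0 < A) :
    IntegrableOn (fun s : ℝ => s ^ (a - 1) * (s + A) ^ (σ - (a + 1))) (Set.Ioi 0) ∧
    ∫ s in Set.Ioi (0 : ℝ), s ^ (a - 1) * (s + A) ^ (σ - (a + 1)) ≤
      (1 / a + 1 / (1 - σ)) * A ^ (σ - 1) := by
  have hneg : σ - (a + 1) ≤ 0 := by linarith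
  have hm : Measurable (fun s : ℝ => s ^ (a - 1) * (s + A) ^ (σ - (a + 1))) := by fun_prop
  have i1 : IntegrableOn (fun s : ℝ => s ^ (a - 1) * A ^ (σ - (a + 1))) (Set.Ioc 0 A) := by
    have := intervalIntegral.intervalIntegrable_rpow' (a := 0) (b := A) (r := a - 1)
      (by linarith)
    exact ((intervalIntegrable_iff_integrableOn_Ioc_of_le hA.le).1 this).mul_const _
  have i2 : IntegrableOn (fun s : ℝ => s ^ (σ - 2)) (Set.Ioi A) :=
    integrableOn_Ioi_rpow_of_lt (by linarith) hA
  have b1 : ∀ s ∈ Set.Ioc 0 A, s ^ (a - 1) * (s + A) ^ (σ - (a + 1)) ≤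
      s ^ (a - 1) * A ^ (σ - (a + 1)) := by
    intro s hs
    have := Real.rpow_nonneg hs.1.le (a - 1)
    exact mul_le_mul_of_nonneg_left
      (Real.rpow_le_rpow_of_nonpos hA (by linarith [hs.1]) hneg) this
  have b2 : ∀ s ∈ Set.Ioi A, s ^ (a - 1) * (s + A) ^ (σ - (a + 1)) ≤ s ^ (σ - 2) := by
    intro s hs
    have hs0 : 0 < s := hA.trans hs
    calc s ^ (a - 1) * (s + A) ^ (σ - (a + 1)) ≤ s ^ (a - 1) * s ^ (σ - (a + 1)) :=
          mul_le_mul_of_nonneg_left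
            (Real.rpow_le_rpow_of_nonpos hs0 (by linarith) hneg) (Real.rpow_nonneg hs0.le _)
      _ = _ := by rw [← Real.rpow_add hs0]; congr 1; ring
  have hpos : ∀ s ∈ Set.Ioi (0 : ℝ), 0 ≤ s ^ (a - 1) * (s + A) ^ (σ - (a + 1)) := by
    intro s hs
    have : (0 : ℝ) < s := hs
    positivity
  have j1 : IntegrableOn (fun s : ℝ => s ^ (a - 1) * (s + A) ^ (σ - (a + 1))) (Set.Ioc 0 A) := by
    refine Integrable.mono' i1 hm.aestronglyMeasurable ?_
    filter_upwards [ae_restrict_mem measurableSet_Ioc] with s hs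
    rw [Real.norm_of_nonneg (hpos s hs.1)]
    exact b1 s hs
  have j2 : IntegrableOn (fun s : ℝ => s ^ (a - 1) * (s + A) ^ (σ - (a + 1))) (Set.Ioi A) := by
    refine Integrable.mono' i2 hm.aestronglyMeasurable ?_
    filter_upwards [ae_restrict_mem measurableSet_Ioi] with s hs
    rw [Real.norm_of_nonneg (hpos s (hA.trans hs))]
    exact b2 s hs
  have hun : Set.Ioc 0 A ∪ Set.Ioi A = Set.Ioi 0 := Set.Ioc_union_Ioi_eq_Ioi hA.le
  refine ⟨hun ▸ j1.union j2, ?_⟩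
  rw [← hun, setIntegral_union (Set.Ioc_disjoint_Ioi le_rfl) measurableSet_Ioi j1 j2]
  have k1 := setIntegral_mono_on j1 i1 measurableSet_Ioc b1
  have k2 := setIntegral_mono_on j2 i2 measurableSet_Ioi b2
  rw [integral_Ioi_rpow_of_lt (by linarith) hA] at k2
  rw [integral_mul_const, ← intervalIntegral.integral_of_le (f := fun s : ℝ => s ^ (a - 1)) hA.le,
    integral_rpow (Or.inl (by linarith))] at k1
  have e1 : (A ^ (a - 1 + 1) - 0 ^ (a - 1 + 1)) / (a - 1 + 1) * A ^ (σ - (a + 1)) =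
      1 / a * A ^ (σ - 1) := by
    rw [show a - 1 + 1 = a by ring, Real.zero_rpow ha.ne', sub_zero, div_mul_eq_mul_div,
      ← Real.rpow_add hA, show a + (σ - (a + 1)) = σ - 1 by ring]
    ring
  have e2 : -A ^ (σ - 2 + 1) / (σ - 2 + 1) = 1 / (1 - σ) * A ^ (σ - 1) := by
    rw [show σ - 2 + 1 = σ - 1 by ring, show 1 - σ = -(σ - 1) by ring]
    have : σ - 1 ≠ 0 := by linarith
    field_simp
  rw [e1] at k1
  rw [e2] at k2
  linarith [add_mul (1 / a) (1 / (1 - σ)) (A ^ (σ - 1))]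

theorem half_add_le_norm_add {s : ℝ} (hs : 0 ≤ s) {ζ : ℂ} (hζ : 0 < ζ.re) :
    (s + ‖ζ‖) / 2 ≤ ‖(s : ℂ) + ζ‖ := by
  have h1 : s ≤ ‖(s : ℂ) + ζ‖ := by
    have := Complex.re_le_norm ((s : ℂ) + ζ)
    simp at this
    linarith
  have h2 : ‖ζ‖ ≤ ‖(s : ℂ) + ζ‖ := by
    rw [Complex.norm_def, Complex.norm_def]
    apply Real.sqrt_le_sqrt
    simp only [Complex.normSq_apply, Complex.add_re, Complex.ofReal_re, Complex.add_im,
      Complex.ofReal_im, zero_add]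
    nlinarith
  linarith

theorem norm_cpow_ofReal_of_re_pos {u : ℂ} (hu : u ≠ 0) (c : ℝ) :
    ‖u ^ (c : ℂ)‖ = ‖u‖ ^ c := by
  rw [Complex.norm_cpow_of_ne_zero hu]
  simp

theorem integral_rpow_mul_add_cpow {a : ℝ} (ha : 0 < a) {ζ : ℂ} (hζ : 0 < ζ.re) :
    IntegrableOn (fun s : ℝ => ((s ^ (a - 1) : ℝ) : ℂ) * (s + ζ) ^ ((-(a + 1) : ℝ) : ℂ))
      (Set.Ioi 0) ∧
    ∫ s in Set.Ioi (0 : ℝ), ((s ^ (a - 1) : ℝ) : ℂ) * (s + ζ) ^ ((-(a + 1) : ℝ) : ℂ) =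
      1 / (a * ζ) := by
  have hζ0 : ζ ≠ 0 := by rintro rfl; simp at hζ
  have hA : 0 < ‖ζ‖ := norm_pos_iff.2 hζ0
  have hre : ∀ s : ℝ, 0 ≤ s → 0 < ((s : ℂ) + ζ).re := by
    intro s hs; simp; linarith
  have hne : ∀ s : ℝ, 0 ≤ s → (s : ℂ) + ζ ≠ 0 := by
    intro s hs h; have := hre s hs; rw [h] at this; simp at this
  have hint : IntegrableOn
      (fun s : ℝ => ((s ^ (a - 1) : ℝ) : ℂ) * (s + ζ) ^ ((-(a + 1) : ℝ) : ℂ)) (Set.Ioi 0) := by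
    have h0 := (integral_rpow_mul_add_rpow_le ha (σ := 0) one_pos hA).1
    refine Integrable.mono' (h0.mul_const ((2 : ℝ) ^ (a + 1))) ?_ ?_
    · exact Measurable.aestronglyMeasurable (by fun_prop)
    · filter_upwards [ae_restrict_mem measurableSet_Ioi] with s hs
      have hs : (0 : ℝ) < s := hs
      rw [norm_mul, norm_cpow_ofReal_of_re_pos (hne s hs.le), Complex.norm_real,
        Real.norm_of_nonneg (by positivity), mul_assoc]
      gcongr
      have h1 := Real.rpow_le_rpow_of_nonpos (by positivity) (half_add_le_norm_add hs.le hζ)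
        (show -(a + 1) ≤ 0 by linarith)
      refine h1.trans (le_of_eq ?_)
      rw [Real.div_rpow (by positivity) (by norm_num), Real.rpow_neg (x := 2) (by norm_num),
        div_inv_eq_mul, zero_sub]
  refine ⟨hint, ?_⟩
  set f : ℝ → ℂ := fun s => ((s ^ a : ℝ) : ℂ) * (s + ζ) ^ ((-a : ℝ) : ℂ) / (a * ζ) with hf
  have haC : (a : ℂ) ≠ 0 := by exact_mod_cast ha.ne'
  have hcont : ContinuousWithinAt f (Set.Ici 0) 0 := by
    refine ContinuousAt.continuousWithinAt ?_
    have h1 : ContinuousAt (fun s : ℝ => ((s ^ a : ℝ) : ℂ)) 0 :=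
      Complex.continuous_ofReal.continuousAt.comp (Real.continuousAt_rpow_const 0 a (Or.inr ha.le))
    have h2 : ContinuousAt (fun s : ℝ => ((s : ℂ) + ζ) ^ ((-a : ℝ) : ℂ)) 0 := by
      refine ContinuousAt.cpow (by fun_prop) (by fun_prop) ?_
      exact Or.inl (hre 0 le_rfl)
    exact (h1.mul h2).div_const _
  have hderiv : ∀ s ∈ Set.Ioi (0 : ℝ), HasDerivAt f
      (((s ^ (a - 1) : ℝ) : ℂ) * (s + ζ) ^ ((-(a + 1) : ℝ) : ℂ)) s := by
    intro s hs
    have hs : (0 : ℝ) < s := hs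
    have h1 : HasDerivAt (fun s : ℝ => ((s ^ a : ℝ) : ℂ)) ((a * s ^ (a - 1) : ℝ) : ℂ) s :=
      (Real.hasDerivAt_rpow_const (Or.inl hs.ne')).ofReal_comp
    have h2 : HasDerivAt (fun w : ℂ => w + ζ) 1 (s : ℂ) := (hasDerivAt_id _).add_const ζ
    have h3 := (h2.cpow_const (c := ((-a : ℝ) : ℂ)) (Or.inl (hre s hs.le))).comp_ofReal
    refine ((h1.mul h3).div_const (a * ζ)).congr_deriv ?_
    have e1 : ((s : ℂ) + ζ) ^ ((-a : ℝ) : ℂ) =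
        ((s : ℂ) + ζ) ^ ((-(a + 1) : ℝ) : ℂ) * (s + ζ) := by
      rw [show ((-a : ℝ) : ℂ) = ((-(a + 1) : ℝ) : ℂ) + 1 by push_cast; ring,
        Complex.cpow_add _ _ (hne s hs.le), Complex.cpow_one]
    have e2 : ((-a : ℝ) : ℂ) - 1 = ((-(a + 1) : ℝ) : ℂ) := by push_cast; ring
    have e3 : s ^ a = s ^ (a - 1) * s := by
      rw [← Real.rpow_add_one hs.ne']; congr 1; ring
    rw [e2, e1, e3]
    push_cast
    field_simp
    ring
  have htend : Filter.Tendsto f Filter.atTop (nhds (1 / (a * ζ))) := by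
    have h1 : Filter.Tendsto (fun s : ℝ => ((1 : ℂ) + (s⁻¹ : ℝ) * ζ) ^ ((-a : ℝ) : ℂ))
        Filter.atTop (nhds 1) := by
      have : Filter.Tendsto (fun s : ℝ => ((1 : ℂ) + (s⁻¹ : ℝ) * ζ)) Filter.atTop (nhds 1) := by
        have h := (Complex.continuous_ofReal.tendsto 0).comp tendsto_inv_atTop_zero
        have h' := (h.mul_const ζ).const_add 1
        simpa using h'
      have hc : ContinuousAt (fun w : ℂ => w ^ ((-a : ℝ) : ℂ)) 1 :=
        ContinuousAt.cpow continuousAt_id continuousAt_const (by simp)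
      have h' := hc.tendsto.comp this
      rw [Complex.one_cpow] at h'
      exact h'
    refine (h1.div_const (a * ζ)).congr' ?_
    filter_upwards [Filter.eventually_gt_atTop 0] with s hs
    simp only [hf]
    congr 1
    have hsC : (s : ℂ) ≠ 0 := by exact_mod_cast hs.ne'
    have hw : ((1 : ℂ) + (s⁻¹ : ℝ) * ζ) ≠ 0 := by
      intro h
      have := congrArg Complex.re h
      have h' : 0 < s⁻¹ * ζ.re := by positivity
      simp [-Complex.ofReal_inv] at this
      linarith
    have e : (s : ℂ) + ζ = s * (1 + (s⁻¹ : ℝ) * ζ) := by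
      push_cast; field_simp
    rw [e, Complex.cpow_def_of_ne_zero hw, Complex.cpow_def_of_ne_zero (mul_ne_zero hsC hw),
      Complex.log_ofReal_mul hs hw, add_mul, Complex.exp_add, ← mul_assoc,
      ← Complex.ofReal_mul, ← Complex.ofReal_exp, ← Complex.ofReal_mul,
      ← Real.rpow_def_of_pos hs, ← Real.rpow_add hs]
    simp
  rw [integral_Ioi_of_hasDerivAt_of_tendsto hcont hderiv hint htend]
  simp [hf, Real.zero_rpow ha.ne']

theorem norm_add_mul_cpow_sub_le {a σ r : ℝ} (ha : 0 < a) (hσ0 : 0 < σ) (hσ1 : σ < 1)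
    (hr : 0 < r) {u : ℂ} (hu : -r ≤ u.im) :
    ‖(u + r * Complex.I) * (u + 2 * r * Complex.I) ^ ((-(a + 1) : ℝ) : ℂ) -
      (r * Complex.I) * (2 * r * Complex.I) ^ ((-(a + 1) : ℝ) : ℂ)‖ ≤
      (a + 2) * r ^ (-a - σ) * ‖u‖ ^ σ := by
  set V : Set ℂ := {v | -r ≤ v.im} with hV
  have hconv : Convex ℝ V := convex_halfSpace_im_ge (-r)
  set G : ℂ → ℂ := fun v =>
    (v + r * Complex.I) * (v + 2 * r * Complex.I) ^ ((-(a + 1) : ℝ) : ℂ) with hG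
  have him : ∀ v ∈ V, r ≤ (v + 2 * r * Complex.I).im := by
    intro v hv
    have hv : -r ≤ v.im := hv
    simp
    linarith
  have hnr : ∀ v ∈ V, r ≤ ‖v + 2 * r * Complex.I‖ := fun v hv =>
    (him v hv).trans (Complex.im_le_norm _)
  have hne : ∀ v ∈ V, v + 2 * r * Complex.I ≠ 0 := by
    intro v hv h
    have := hnr v hv
    rw [h, norm_zero] at this
    linarith
  have hle : ∀ v ∈ V, ‖v + r * Complex.I‖ ≤ ‖v + 2 * r * Complex.I‖ := by
    intro v hv
    have hv : -r ≤ v.im := hv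
    rw [Complex.norm_def, Complex.norm_def]
    apply Real.sqrt_le_sqrt
    simp only [Complex.normSq_apply, Complex.add_re, Complex.add_im, Complex.mul_re,
      Complex.mul_im, Complex.ofReal_re, Complex.ofReal_im, Complex.I_re, Complex.I_im,
      Complex.re_ofNat, Complex.im_ofNat]
    nlinarith
  have h0V : (0 : ℂ) ∈ V := by simp [hV, hr.le]
  have hpow : ∀ v ∈ V, ‖(v + 2 * r * Complex.I) ^ ((-(a + 1) : ℝ) : ℂ)‖ ≤ r ^ (-(a + 1)) := by
    intro v hv
    rw [norm_cpow_ofReal_of_re_pos (hne v hv)]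
    exact Real.rpow_le_rpow_of_nonpos hr (hnr v hv) (by linarith)
  have hGb : ∀ v ∈ V, ‖G v‖ ≤ r ^ (-a) := by
    intro v hv
    rw [hG, norm_mul, norm_cpow_ofReal_of_re_pos (hne v hv)]
    have h1 := hnr v hv
    have h2 : 0 < ‖v + 2 * r * Complex.I‖ := hr.trans_le h1
    calc ‖v + r * Complex.I‖ * ‖v + 2 * r * Complex.I‖ ^ (-(a + 1))
        ≤ ‖v + 2 * r * Complex.I‖ * ‖v + 2 * r * Complex.I‖ ^ (-(a + 1)) := by
          gcongr; exact hle v hv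
      _ = ‖v + 2 * r * Complex.I‖ ^ (-a) := by
          rw [mul_comm, ← Real.rpow_add_one h2.ne']; congr 1; ring
      _ ≤ r ^ (-a) := Real.rpow_le_rpow_of_nonpos hr h1 (by linarith)
  have hderiv : ∀ v ∈ V, HasDerivWithinAt G
      ((v + 2 * r * Complex.I) ^ ((-(a + 1) : ℝ) : ℂ) + (v + r * Complex.I) *
        (((-(a + 1) : ℝ) : ℂ) * (v + 2 * r * Complex.I) ^ (((-(a + 1) : ℝ) : ℂ) - 1))) V v := by
    intro v hv
    have h1 : HasDerivAt (fun v : ℂ => v + r * Complex.I) 1 v := (hasDerivAt_id v).add_const _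
    have h2 : HasDerivAt (fun v : ℂ => v + 2 * r * Complex.I) 1 v :=
      (hasDerivAt_id v).add_const _
    have h3 := h2.cpow_const (c := ((-(a + 1) : ℝ) : ℂ))
      (Or.inr (by have := him v hv; linarith))
    exact (h1.mul h3).hasDerivWithinAt.congr_deriv (by ring)
  have hdb : ∀ v ∈ V, ‖(v + 2 * r * Complex.I) ^ ((-(a + 1) : ℝ) : ℂ) + (v + r * Complex.I) *
        (((-(a + 1) : ℝ) : ℂ) * (v + 2 * r * Complex.I) ^ (((-(a + 1) : ℝ) : ℂ) - 1))‖ ≤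
        (a + 2) * r ^ (-(a + 1)) := by
    intro v hv
    have h2 : 0 < ‖v + 2 * r * Complex.I‖ := hr.trans_le (hnr v hv)
    have e : ((-(a + 1) : ℝ) : ℂ) - 1 = ((-(a + 1) - 1 : ℝ) : ℂ) := by push_cast; ring
    refine (norm_add_le _ _).trans ?_
    have h3 : ‖(v + r * Complex.I) *
        (((-(a + 1) : ℝ) : ℂ) * (v + 2 * r * Complex.I) ^ (((-(a + 1) : ℝ) : ℂ) - 1))‖ ≤
        (a + 1) * r ^ (-(a + 1)) := by
      rw [e, norm_mul, norm_mul, norm_cpow_ofReal_of_re_pos (hne v hv), Complex.norm_real,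
        Real.norm_eq_abs, abs_neg, abs_of_pos (by linarith : 0 < a + 1)]
      calc ‖v + r * Complex.I‖ * ((a + 1) * ‖v + 2 * r * Complex.I‖ ^ (-(a + 1) - 1))
          ≤ ‖v + 2 * r * Complex.I‖ * ((a + 1) * ‖v + 2 * r * Complex.I‖ ^ (-(a + 1) - 1)) := by
            gcongr; exact hle v hv
        _ = (a + 1) * ‖v + 2 * r * Complex.I‖ ^ (-(a + 1)) := by
            rw [mul_left_comm, mul_comm ‖_‖, ← Real.rpow_add_one h2.ne', sub_add_cancel]
        _ ≤ _ := by
            have := Real.rpow_le_rpow_of_nonpos hr (hnr v hv) (show -(a + 1) ≤ 0 by linarith)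
            gcongr
    linarith [hpow v hv]
  have hmv := hconv.norm_image_sub_le_of_norm_hasDerivWithin_le hderiv hdb h0V hu
  have e0 : G 0 = (r * Complex.I) * (2 * r * Complex.I) ^ ((-(a + 1) : ℝ) : ℂ) := by
    simp [hG]
  rw [← e0]
  change ‖G u - G 0‖ ≤ _
  rw [sub_zero] at hmv
  have e1 : r ^ (-(a + 1)) = r ^ (-a - σ) * r ^ (σ - 1) := by
    rw [← Real.rpow_add hr]; congr 1; ring
  have e2 : r ^ (-a) = r ^ (-a - σ) * r ^ σ := by
    rw [← Real.rpow_add hr]; congr 1; ring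
  rcases le_total ‖u‖ r with h | h
  · refine hmv.trans ?_
    rw [e1, ← mul_assoc, mul_assoc _ (r ^ (σ - 1))]
    gcongr
    rcases (norm_nonneg u).eq_or_lt with h0 | h0
    · rw [← h0, mul_zero]; positivity
    · calc r ^ (σ - 1) * ‖u‖ ≤ ‖u‖ ^ (σ - 1) * ‖u‖ := by
            have := Real.rpow_le_rpow_of_nonpos h0 h (show σ - 1 ≤ 0 by linarith)
            gcongr
        _ = _ := by rw [← Real.rpow_add_one h0.ne', sub_add_cancel]
  · calc ‖G u - G 0‖ ≤ ‖G u‖ + ‖G 0‖ := norm_sub_le _ _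
      _ ≤ 2 * r ^ (-a) := by linarith [hGb u hu, hGb 0 h0V]
      _ ≤ (a + 2) * r ^ (-a) := by gcongr; linarith
      _ = (a + 2) * r ^ (-a - σ) * r ^ σ := by rw [e2]; ring
      _ ≤ _ := by gcongr

theorem norm_integral_poisson_sub_le {a σ R : ℝ} (ha : 0 < a) (hσ0 : 0 < σ) (hσ1 : σ < 1)
    (hR : 0 < R) :
    ∃ C : ℝ, 0 < C ∧ ∀ r t ε : ℝ, 0 < r → r ≤ R → 0 < t → 0 < ε → t ≠ r →
      ‖(∫ s in Set.Ioi (0 : ℝ), ((s ^ (a - 1) * rexp (-(2 * π * s)) : ℝ) : ℂ) *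
          (((s : ℂ) + (ε + t * Complex.I)) *
            (((s : ℂ) + (ε + t * Complex.I) - r * Complex.I) ^ ((-(a + 1) : ℝ) : ℂ) *
              ((s : ℂ) + (ε + t * Complex.I) + r * Complex.I) ^ ((-(a + 1) : ℝ) : ℂ)))) -
        (r * Complex.I) * (2 * r * Complex.I) ^ ((-(a + 1) : ℝ) : ℂ) *
          (1 / (a * (ε + (t - r : ℝ) * Complex.I)))‖ ≤
        C * (r ^ (-a - σ) * |t - r| ^ (σ - 1)) := by
  set C₀ : ℝ := (a + 2) + (2 * π) ^ σ * R ^ σ with hC₀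
  set C₁ : ℝ := C₀ * 2 ^ (a + 1 - σ) with hC₁
  refine ⟨C₁ * (1 / a + 1 / (1 - σ)), ?_, ?_⟩
  · have : 0 < 1 - σ := by linarith
    positivity
  intro r t ε hr hrR ht hε htr
  set ζ : ℂ := ε + (t - r : ℝ) * Complex.I with hζ
  have hζre : 0 < ζ.re := by simp [hζ, hε]
  have hζim : ζ.im = t - r := by simp [hζ]
  have hζ0 : ζ ≠ 0 := by intro h; rw [h] at hζre; simp at hζre
  have hA : 0 < ‖ζ‖ := norm_pos_iff.2 hζ0
  set G0 : ℂ := (r * Complex.I) * (2 * r * Complex.I) ^ ((-(a + 1) : ℝ) : ℂ) with hG0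
  set G : ℂ → ℂ := fun v =>
    (v + r * Complex.I) * (v + 2 * r * Complex.I) ^ ((-(a + 1) : ℝ) : ℂ) with hG
  have hG0n : ‖G0‖ ≤ r ^ (-a) := by
    have h2 : ‖(2 * r * Complex.I : ℂ)‖ = 2 * r := by simp [abs_of_pos hr]
    have h2' : (2 * r * Complex.I : ℂ) ≠ 0 := by
      rw [← norm_pos_iff, h2]; positivity
    have h1 : ‖(r * Complex.I : ℂ)‖ = r := by simp [abs_of_pos hr]
    rw [hG0, norm_mul, norm_cpow_ofReal_of_re_pos h2', h2, h1]
    calc r * (2 * r) ^ (-(a + 1)) ≤ r * r ^ (-(a + 1)) := by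
          have := Real.rpow_le_rpow_of_nonpos hr (show r ≤ 2 * r by linarith)
            (show -(a + 1) ≤ 0 by linarith)
          gcongr
      _ = r ^ (-a) := by
          rw [mul_comm, ← Real.rpow_add_one hr.ne']; congr 1; ring
  obtain ⟨hmi, hme⟩ := integral_rpow_mul_add_cpow ha hζre
  obtain ⟨hbi, hbe⟩ := integral_rpow_mul_add_rpow_le ha hσ1 hA
  set D : ℝ → ℂ := fun s => ((s ^ (a - 1) : ℝ) : ℂ) * (s + ζ) ^ ((-(a + 1) : ℝ) : ℂ) *
    (rexp (-(2 * π * s)) * G (s + ζ) - G0) with hD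
  have hform : ∀ s : ℝ, ((s ^ (a - 1) * rexp (-(2 * π * s)) : ℝ) : ℂ) *
          (((s : ℂ) + (ε + t * Complex.I)) *
            (((s : ℂ) + (ε + t * Complex.I) - r * Complex.I) ^ ((-(a + 1) : ℝ) : ℂ) *
              ((s : ℂ) + (ε + t * Complex.I) + r * Complex.I) ^ ((-(a + 1) : ℝ) : ℂ))) =
      D s + G0 * (((s ^ (a - 1) : ℝ) : ℂ) * (s + ζ) ^ ((-(a + 1) : ℝ) : ℂ)) := by
    intro s
    have e1 : (s : ℂ) + (ε + t * Complex.I) - r * Complex.I = s + ζ := by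
      rw [hζ]; push_cast; ring
    have e2 : (s : ℂ) + (ε + t * Complex.I) + r * Complex.I = s + ζ + 2 * r * Complex.I := by
      rw [hζ]; push_cast; ring
    have e3 : (s : ℂ) + (ε + t * Complex.I) = s + ζ + r * Complex.I := by
      rw [hζ]; push_cast; ring
    rw [e1, e2, e3]
    simp only [hD, hG]
    push_cast
    ring
  have hDb : ∀ s ∈ Set.Ioi (0 : ℝ), ‖D s‖ ≤
      C₁ * r ^ (-a - σ) * (s ^ (a - 1) * (s + ‖ζ‖) ^ (σ - (a + 1))) := by
    intro s hs
    have hs : (0 : ℝ) < s := hs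
    have hhalf := half_add_le_norm_add hs.le hζre
    have hupos : 0 < ‖(s : ℂ) + ζ‖ := by
      have : 0 < (s + ‖ζ‖) / 2 := by positivity
      linarith
    have hsu : s ≤ ‖(s : ℂ) + ζ‖ := by
      have := Complex.re_le_norm ((s : ℂ) + ζ)
      simp at this
      linarith
    have hu0 : (s : ℂ) + ζ ≠ 0 := norm_pos_iff.1 hupos
    have h1 := norm_add_mul_cpow_sub_le ha hσ0 hσ1 hr (u := (s : ℂ) + ζ)
      (by simp [hζim]; linarith)
    have h2 : 1 - rexp (-(2 * π * s)) ≤ (2 * π * s) ^ σ := by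
      have hy : 0 < 2 * π * s := by positivity
      rcases le_total (2 * π * s) 1 with h | h
      · calc 1 - rexp (-(2 * π * s)) ≤ 2 * π * s := by
              have := Real.add_one_le_exp (-(2 * π * s)); linarith
          _ = (2 * π * s) ^ (1 : ℝ) := (Real.rpow_one _).symm
          _ ≤ _ := Real.rpow_le_rpow_of_exponent_ge hy h hσ1.le
      · calc 1 - rexp (-(2 * π * s)) ≤ 1 := by
              have := Real.exp_pos (-(2 * π * s)); linarith
          _ ≤ _ := Real.one_le_rpow h hσ0.le
    have hexp1 : rexp (-(2 * π * s)) ≤ 1 := Real.exp_le_one_iff.2 (by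
      have : 0 < 2 * π * s := by positivity
      linarith)
    have h3 : ‖(rexp (-(2 * π * s)) : ℂ) * G (s + ζ) - G0‖ ≤
        C₀ * r ^ (-a - σ) * ‖(s : ℂ) + ζ‖ ^ σ := by
      have e : (rexp (-(2 * π * s)) : ℂ) * G (s + ζ) - G0 =
          (rexp (-(2 * π * s)) : ℂ) * (G (s + ζ) - G0) -
            ((1 - rexp (-(2 * π * s)) : ℝ) : ℂ) * G0 := by push_cast; ring
      rw [e]
      refine (norm_sub_le _ _).trans ?_
      rw [norm_mul, norm_mul, Complex.norm_real, Complex.norm_real,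
        Real.norm_of_nonneg (Real.exp_pos _).le, Real.norm_of_nonneg (by linarith)]
      have k1 : rexp (-(2 * π * s)) * ‖G (s + ζ) - G0‖ ≤
          (a + 2) * r ^ (-a - σ) * ‖(s : ℂ) + ζ‖ ^ σ :=
        (mul_le_of_le_one_left (norm_nonneg _) hexp1).trans h1
      have k2 : (1 - rexp (-(2 * π * s))) * ‖G0‖ ≤
          (2 * π) ^ σ * R ^ σ * r ^ (-a - σ) * ‖(s : ℂ) + ζ‖ ^ σ := by
        calc (1 - rexp (-(2 * π * s))) * ‖G0‖ ≤ (2 * π * s) ^ σ * r ^ (-a) := by gcongr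
          _ = (2 * π) ^ σ * s ^ σ * (r ^ (-a - σ) * r ^ σ) := by
              rw [Real.mul_rpow (by positivity) hs.le, ← Real.rpow_add hr]
              congr 2; ring
          _ ≤ (2 * π) ^ σ * ‖(s : ℂ) + ζ‖ ^ σ * (r ^ (-a - σ) * R ^ σ) := by gcongr
          _ = _ := by ring
      rw [hC₀]
      linarith [add_mul ((a + 2)) ((2 * π) ^ σ * R ^ σ) (r ^ (-a - σ) * ‖(s : ℂ) + ζ‖ ^ σ)]
    rw [hD, norm_mul, norm_mul, norm_cpow_ofReal_of_re_pos hu0, Complex.norm_real,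
      Real.norm_of_nonneg (by positivity)]
    have h4 : ‖(s : ℂ) + ζ‖ ^ (σ - (a + 1)) ≤
        2 ^ (a + 1 - σ) * (s + ‖ζ‖) ^ (σ - (a + 1)) := by
      refine (Real.rpow_le_rpow_of_nonpos (by positivity) hhalf (by linarith)).trans
        (le_of_eq ?_)
      rw [Real.div_rpow (by positivity) (by norm_num), div_eq_mul_inv, ← Real.rpow_neg (by norm_num),
        neg_sub, mul_comm]
    calc s ^ (a - 1) * ‖(s : ℂ) + ζ‖ ^ (-(a + 1)) *
          ‖(rexp (-(2 * π * s)) : ℂ) * G (s + ζ) - G0‖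
        ≤ s ^ (a - 1) * ‖(s : ℂ) + ζ‖ ^ (-(a + 1)) *
          (C₀ * r ^ (-a - σ) * ‖(s : ℂ) + ζ‖ ^ σ) := by gcongr
      _ = C₀ * r ^ (-a - σ) * s ^ (a - 1) * ‖(s : ℂ) + ζ‖ ^ (σ - (a + 1)) := by
          rw [show σ - (a + 1) = -(a + 1) + σ by ring, Real.rpow_add hupos]; ring
      _ ≤ C₀ * r ^ (-a - σ) * s ^ (a - 1) *
          (2 ^ (a + 1 - σ) * (s + ‖ζ‖) ^ (σ - (a + 1))) := by gcongr
      _ = _ := by rw [hC₁]; ring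
  have hDm : Measurable D := by
    simp only [hD, hG]
    fun_prop
  have hbi' := hbi.const_mul (C₁ * r ^ (-a - σ))
  have hDi : IntegrableOn D (Set.Ioi 0) := by
    refine Integrable.mono' hbi' hDm.aestronglyMeasurable ?_
    filter_upwards [ae_restrict_mem measurableSet_Ioi] with s hs using hDb s hs
  simp_rw [hform]
  rw [integral_add hDi (hmi.const_mul G0), integral_const_mul, hme, add_sub_cancel_right]
  have hfin : ‖∫ s in Set.Ioi (0 : ℝ), D s‖ ≤
      ∫ s in Set.Ioi (0 : ℝ), C₁ * r ^ (-a - σ) * (s ^ (a - 1) * (s + ‖ζ‖) ^ (σ - (a + 1))) := by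
    refine norm_integral_le_of_norm_le hbi' ?_
    filter_upwards [ae_restrict_mem measurableSet_Ioi] with s hs using hDb s hs
  rw [integral_const_mul] at hfin
  refine hfin.trans ?_
  have habs : |t - r| ≤ ‖ζ‖ := by
    rw [← hζim]; exact Complex.abs_im_le_norm _
  have hpos : 0 < |t - r| := abs_pos.2 (sub_ne_zero.2 htr)
  have hlast := Real.rpow_le_rpow_of_nonpos hpos habs (show σ - 1 ≤ 0 by linarith)
  have h1σ : 0 < 1 - σ := by linarith
  calc C₁ * r ^ (-a - σ) * ∫ s in Set.Ioi (0 : ℝ), s ^ (a - 1) * (s + ‖ζ‖) ^ (σ - (a + 1))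
      ≤ C₁ * r ^ (-a - σ) * ((1 / a + 1 / (1 - σ)) * |t - r| ^ (σ - 1)) := by
        refine mul_le_mul_of_nonneg_left (hbe.trans ?_) (by positivity)
        gcongr
    _ = _ := by ring

theorem integral_one_add_norm_rpow_mul_cexp {n : ℕ} (hn : n ≠ 0) {a : ℝ} (ha : 0 < a) (x : E n)
    {z : ℂ} (hz : 0 < z.re) :
    ((Real.Gamma a * (2 * π) ^ (-a) : ℝ) : ℂ) *
      ∫ ξ : E n, (((1 + ‖ξ‖) ^ (-a) : ℝ) : ℂ) * (Complex.exp (-2 * π * z * (‖ξ‖ : ℂ)) *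
        Complex.exp (((2 * π * ⟪x, ξ⟫ : ℝ) : ℂ) * Complex.I)) =
    ((Real.Gamma (((n : ℝ) + 1) / 2) * π ^ (-(((n : ℝ) + 1) / 2)) : ℝ) : ℂ) *
      ∫ s in Set.Ioi (0 : ℝ), ((s ^ (a - 1) * rexp (-(2 * π * s)) : ℝ) : ℂ) *
        (((s : ℂ) + z) * (((s : ℂ) + z - ‖x‖ * Complex.I) ^ ((-(((n : ℝ) + 1) / 2) : ℝ) : ℂ) *
          ((s : ℂ) + z + ‖x‖ * Complex.I) ^ ((-(((n : ℝ) + 1) / 2) : ℝ) : ℂ))) := by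
  set F : E n → ℝ → ℂ := fun ξ s => ((s ^ (a - 1) * rexp (-(2 * π * s)) : ℝ) : ℂ) *
    (Complex.exp (-2 * π * (s + z) * (‖ξ‖ : ℂ)) *
      Complex.exp (((2 * π * ⟪x, ξ⟫ : ℝ) : ℂ) * Complex.I)) with hF
  have hnorm : ∀ (y : ℂ) (ξ : E n), ‖Complex.exp (-2 * π * y * (‖ξ‖ : ℂ))‖ =
      rexp (-(2 * π * y.re) * ‖ξ‖) := by
    intro y ξ
    rw [Complex.norm_exp]
    congr 1
    simp [Complex.mul_re]
  have hmeas : Measurable (Function.uncurry F) := by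
    simp only [hF, Function.uncurry_def]
    fun_prop
  have hi1 : IntegrableOn (fun s : ℝ => s ^ (a - 1) * rexp (-(2 * π * s))) (Set.Ioi 0) := by
    have := Real.GammaIntegral_convergent ha
    have h2 := (integrableOn_Ioi_comp_mul_left_iff
      (fun x : ℝ => rexp (-x) * x ^ (a - 1)) 0 (a := 2 * π) (by positivity)).2 (by simpa using this)
    refine IntegrableOn.congr_fun (h2.const_mul ((2 * π) ^ (-(a - 1)))) ?_ measurableSet_Ioi
    intro s hs
    have hs : (0 : ℝ) < s := hs
    simp only
    rw [Real.mul_rpow (by positivity) hs.le, Real.rpow_neg (by positivity)]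
    have : (2 * π) ^ (a - 1) ≠ 0 := by positivity
    field_simp
  have hi2 : Integrable (fun ξ : E n => rexp (-(2 * π * z.re) * ‖ξ‖)) :=
    integrable_exp_neg_mul_norm volume (by positivity)
  have hint : Integrable (Function.uncurry F)
      ((volume : Measure (E n)).prod (volume.restrict (Set.Ioi (0 : ℝ)))) := by
    refine (hi2.mul_prod hi1).mono' hmeas.aestronglyMeasurable ?_
    have h0 : ∀ᵐ p : E n × ℝ ∂((volume : Measure (E n)).prod (volume.restrict (Set.Ioi (0 : ℝ)))),
        0 < p.2 := by
      have := (ae_restrict_mem (measurableSet_Ioi (a := (0 : ℝ))) (μ := volume))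
      exact (Measure.quasiMeasurePreserving_snd
        (μ := (volume : Measure (E n))) (ν := volume.restrict (Set.Ioi (0 : ℝ)))).ae this
    filter_upwards [h0] with p hp
    obtain ⟨ξ, s⟩ := p
    have hs : 0 < s := hp
    simp only [Function.uncurry_apply_pair, hF]
    rw [norm_mul, norm_mul, hnorm, Complex.norm_exp_ofReal_mul_I, mul_one, Complex.norm_real,
      Real.norm_of_nonneg (by positivity), mul_comm]
    have hle : z.re ≤ ((s : ℂ) + z).re := by simp [hs.le]
    refine mul_le_mul_of_nonneg_right (Real.exp_le_exp.2 ?_) (by positivity)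
    refine mul_le_mul_of_nonneg_right (neg_le_neg ?_) (norm_nonneg _)
    exact mul_le_mul_of_nonneg_left hle (by positivity)
  have hswap := integral_integral_swap hint
  have hL : ∀ ξ : E n, ∫ s in Set.Ioi (0 : ℝ), F ξ s =
      ((Real.Gamma a * (2 * π) ^ (-a) : ℝ) : ℂ) *
      ((((1 + ‖ξ‖) ^ (-a) : ℝ) : ℂ) * (Complex.exp (-2 * π * z * (‖ξ‖ : ℂ)) *
        Complex.exp (((2 * π * ⟪x, ξ⟫ : ℝ) : ℂ) * Complex.I))) := by
    intro ξ
    have e : ∀ s : ℝ, F ξ s = ((s ^ (a - 1) * rexp (-(2 * π * (1 + ‖ξ‖) * s)) : ℝ) : ℂ) *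
        (Complex.exp (-2 * π * z * (‖ξ‖ : ℂ)) *
        Complex.exp (((2 * π * ⟪x, ξ⟫ : ℝ) : ℂ) * Complex.I)) := by
      intro s
      simp only [hF]
      rw [show -2 * π * (s + z) * (‖ξ‖ : ℂ) = ((-(2 * π * ‖ξ‖ * s) : ℝ) : ℂ) +
        -2 * π * z * (‖ξ‖ : ℂ) by push_cast; ring, Complex.exp_add, ← Complex.ofReal_exp,
        show -(2 * π * (1 + ‖ξ‖) * s) = -(2 * π * s) + -(2 * π * ‖ξ‖ * s) by ring, Real.exp_add]
      push_cast
      ring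
    simp_rw [e]
    rw [integral_mul_const, integral_complex_ofReal,
      Real.integral_rpow_mul_exp_neg_mul_Ioi ha (by positivity), one_div,
      Real.inv_rpow (by positivity), ← Real.rpow_neg (by positivity),
      Real.mul_rpow (by positivity) (by positivity)]
    push_cast
    ring
  simp_rw [hL] at hswap
  rw [integral_const_mul] at hswap
  rw [hswap, ← integral_const_mul]
  refine setIntegral_congr_fun measurableSet_Ioi fun s hs => ?_
  have hs : (0 : ℝ) < s := hs
  simp only [hF]
  rw [integral_const_mul, integral_poisson_complex hn x (z := s + z) (by simp; linarith)]
  ring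

theorem cexp_mul_cpow_ofReal_mul_I {r : ℝ} (hr : 0 < r) (a : ℝ) :
    Complex.exp ((a * π / 2 : ℝ) * Complex.I) *
      ((r * Complex.I) * (2 * r * Complex.I) ^ ((-(a + 1) : ℝ) : ℂ)) =
      ((2 ^ (-(a + 1)) * r ^ (-a) : ℝ) : ℂ) := by
  have h2 : (2 * r * Complex.I : ℂ) = ((2 * r : ℝ) : ℂ) * Complex.I := by push_cast; ring
  have h3 : (((2 * r : ℝ) : ℂ) * Complex.I) ≠ 0 := by
    refine mul_ne_zero ?_ Complex.I_ne_zero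
    exact_mod_cast (by positivity : (2 * r : ℝ) ≠ 0)
  rw [h2, Complex.cpow_def_of_ne_zero h3, Complex.log_ofReal_mul (by positivity) Complex.I_ne_zero,
    Complex.log_I, add_mul, Complex.exp_add, ← Complex.ofReal_mul, ← Complex.ofReal_exp,
    ← Real.rpow_def_of_pos (by positivity), Real.mul_rpow (by norm_num) hr.le]
  have e1 : Complex.exp ((π : ℂ) / 2 * Complex.I * ((-(a + 1) : ℝ) : ℂ)) =
      Complex.exp (-((a * π / 2 : ℝ) * Complex.I)) * (-Complex.I) := by
    rw [← Complex.exp_neg_pi_div_two_mul_I, ← Complex.exp_add]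
    congr 1
    push_cast
    ring
  rw [e1, Complex.exp_neg]
  have h5 := Complex.exp_ne_zero ((a * π / 2 : ℝ) * Complex.I)
  have h6 : r ^ (-a) = r * r ^ (-(a + 1)) := by
    rw [mul_comm, ← Real.rpow_add_one hr.ne']; congr 1; ring
  rw [h6]
  field_simp
  push_cast
  ring_nf
  rw [Complex.I_sq]
  ring

/-- The regularised symbol `(1+|ξ|)^{-(n-1)/2} e^{-2πε|ξ|}`. -/
def waveWeight (n : ℕ) (ε : ℝ) (ξ : E n) : ℝ :=
  (1 + ‖ξ‖) ^ (-(((n : ℝ) - 1) / 2)) * rexp (-(2 * π * ε * ‖ξ‖))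

/-- The oscillating factor `cos(2πt|ξ| - (n-1)π/4)` of the wave propagator. -/
def wavePhase (n : ℕ) (t : ℝ) (ξ : E n) : ℝ :=
  Real.cos (2 * π * t * ‖ξ‖ - ((n : ℝ) - 1) * π / 4)

/-- The convolution kernel with symbol `waveWeight * wavePhase`. -/
def waveKernel (n : ℕ) (ε t : ℝ) (x : E n) : ℝ :=
  ∫ ξ : E n, waveWeight n ε ξ * wavePhase n t ξ * Real.cos (2 * π * ⟪x, ξ⟫)

theorem waveWeight_nonneg {n : ℕ} {ε : ℝ} (ξ : E n) : 0 ≤ waveWeight n ε ξ := by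
  unfold waveWeight; positivity

theorem measurable_waveWeight {n : ℕ} {ε : ℝ} : Measurable (waveWeight n ε) := by
  unfold waveWeight; fun_prop

theorem abs_wavePhase_le {n : ℕ} (t : ℝ) (ξ : E n) : |wavePhase n t ξ| ≤ 1 :=
  Real.abs_cos_le_one _

theorem waveWeight_le {n : ℕ} (hn : 2 ≤ n) {ε : ℝ} (ξ : E n) :
    waveWeight n ε ξ ≤ rexp (-(2 * π * ε) * ‖ξ‖) := by
  have hn' : (2 : ℝ) ≤ n := by exact_mod_cast hn
  unfold waveWeight
  rw [show -(2 * π * ε * ‖ξ‖) = -(2 * π * ε) * ‖ξ‖ by ring]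
  refine mul_le_of_le_one_left (Real.exp_pos _).le ?_
  exact Real.rpow_le_one_of_one_le_of_nonpos (by linarith [norm_nonneg ξ]) (by linarith)

theorem integrable_waveWeight {n : ℕ} (hn : 2 ≤ n) {ε : ℝ} (hε : 0 < ε) :
    Integrable (waveWeight n ε) := by
  refine (integrable_exp_neg_mul_norm (V := E n) volume (c := 2 * π * ε) (by positivity)).mono'
    measurable_waveWeight.aestronglyMeasurable (Filter.Eventually.of_forall fun ξ => ?_)
  rw [Real.norm_of_nonneg (waveWeight_nonneg ξ)]
  exact waveWeight_le hn ξ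

theorem waveKernel_asymptotic {n : ℕ} (hn : 2 ≤ n) {σ R : ℝ} (hσ0 : 0 < σ) (hσ1 : σ < 1)
    (hR : 0 < R) :
    ∃ C c : ℝ, 0 < C ∧ 0 < c ∧ ∀ x : E n, 0 < ‖x‖ → ‖x‖ ≤ R → ∀ t ε : ℝ, 0 < t → 0 < ε →
      t ≠ ‖x‖ →
      |waveKernel n ε t x - c * (‖x‖ ^ (-(((n : ℝ) - 1) / 2)) * (ε / (ε ^ 2 + (t - ‖x‖) ^ 2)))| ≤
        C * (‖x‖ ^ (-(((n : ℝ) - 1) / 2) - σ) * |t - ‖x‖| ^ (σ - 1)) := by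
  have hn' : (2 : ℝ) ≤ n := by exact_mod_cast hn
  set a : ℝ := ((n : ℝ) - 1) / 2 with ha
  have ha0 : 0 < a := by rw [ha]; linarith
  have hab : ((n : ℝ) + 1) / 2 = a + 1 := by rw [ha]; ring
  have hφ : ((n : ℝ) - 1) * π / 4 = a * π / 2 := by rw [ha]; ring
  obtain ⟨C, hC, hest⟩ := norm_integral_poisson_sub_le ha0 hσ0 hσ1 hR
  have hGa : 0 < Real.Gamma a * (2 * π) ^ (-a) :=
    mul_pos (Real.Gamma_pos_of_pos ha0) (by positivity)
  have hGb : 0 < Real.Gamma (a + 1) * π ^ (-(a + 1)) :=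
    mul_pos (Real.Gamma_pos_of_pos (by linarith)) (by positivity)
  set κ : ℝ := (Real.Gamma (a + 1) * π ^ (-(a + 1))) / (Real.Gamma a * (2 * π) ^ (-a)) with hκ
  have hκ0 : 0 < κ := div_pos hGb hGa
  refine ⟨κ * C, κ * (2 ^ (-(a + 1)) / a), by positivity, by positivity, ?_⟩
  intro x hx hxR t ε ht hε htx
  set z : ℂ := ε + t * Complex.I with hz
  have hzre : 0 < z.re := by simp [hz, hε]
  set J : E n → ℂ := fun y => ∫ ξ : E n, (((1 + ‖ξ‖) ^ (-a) : ℝ) : ℂ) *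
    (Complex.exp (-2 * π * z * (‖ξ‖ : ℂ)) *
        Complex.exp (((2 * π * ⟪y, ξ⟫ : ℝ) : ℂ) * Complex.I)) with hJ
  set T : ℂ := ∫ s in Set.Ioi (0 : ℝ), ((s ^ (a - 1) * rexp (-(2 * π * s)) : ℝ) : ℂ) *
        (((s : ℂ) + z) * (((s : ℂ) + z - ‖x‖ * Complex.I) ^ ((-(a + 1) : ℝ) : ℂ) *
          ((s : ℂ) + z + ‖x‖ * Complex.I) ^ ((-(a + 1) : ℝ) : ℂ))) with hT
  have hJT : ∀ y : E n, ‖y‖ = ‖x‖ → J y = κ * T := by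
    intro y hy
    have h := integral_one_add_norm_rpow_mul_cexp (by lia : n ≠ 0) ha0 y hzre
    rw [hab, hy] at h
    have hne : ((Real.Gamma a * (2 * π) ^ (-a) : ℝ) : ℂ) ≠ 0 := by exact_mod_cast hGa.ne'
    have h' : J y = ((Real.Gamma (a + 1) * π ^ (-(a + 1)) : ℝ) : ℂ) * T /
        ((Real.Gamma a * (2 * π) ^ (-a) : ℝ) : ℂ) := by
      rw [eq_div_iff hne, mul_comm]
      exact h
    rw [h', hκ]
    push_cast
    ring
  have hre : waveKernel n ε t x =
      (Complex.exp ((a * π / 2 : ℝ) * Complex.I) * (J x + J (-x))).re / 2 := by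
    have hpt : ∀ y ξ : E n, Complex.exp ((a * π / 2 : ℝ) * Complex.I) *
        ((((1 + ‖ξ‖) ^ (-a) : ℝ) : ℂ) *
        (Complex.exp (-2 * π * z * (‖ξ‖ : ℂ)) *
        Complex.exp (((2 * π * ⟪y, ξ⟫ : ℝ) : ℂ) * Complex.I))) =
        ((waveWeight n ε ξ : ℝ) : ℂ) * Complex.exp
          (((2 * π * ⟪y, ξ⟫ - (2 * π * t * ‖ξ‖ - a * π / 2) : ℝ) : ℂ) * Complex.I) := by
      intro y ξ
      unfold waveWeight
      rw [← ha]
      generalize (1 + ‖ξ‖) ^ (-a) = w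
      rw [Complex.ofReal_mul w, Complex.ofReal_exp, mul_left_comm, ← Complex.exp_add,
        ← Complex.exp_add, mul_assoc (w : ℂ), ← Complex.exp_add]
      congr 2
      rw [hz]
      push_cast
      ring
    have hint : ∀ y : E n, Integrable (fun ξ : E n => ((waveWeight n ε ξ : ℝ) : ℂ) * Complex.exp
          (((2 * π * ⟪y, ξ⟫ - (2 * π * t * ‖ξ‖ - a * π / 2) : ℝ) : ℂ) * Complex.I)) := by
      intro y
      refine (integrable_waveWeight hn hε).mono' ?_ (Filter.Eventually.of_forall fun ξ => ?_)
      · have := measurable_waveWeight (n := n) (ε := ε)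
        exact Measurable.aestronglyMeasurable (by fun_prop)
      · rw [norm_mul, Complex.norm_exp_ofReal_mul_I, mul_one, Complex.norm_real,
          Real.norm_of_nonneg (waveWeight_nonneg ξ)]
    rw [mul_add, hJ]
    simp only
    rw [← integral_const_mul, ← integral_const_mul]
    simp_rw [hpt]
    rw [← integral_add (hint x) (hint (-x))]
    have hre' := integral_re ((hint x).add (hint (-x)))
    simp only [RCLike.re_to_complex, Pi.add_apply] at hre'
    rw [← hre', ← integral_div]
    unfold waveKernel
    refine integral_congr_ae (Filter.Eventually.of_forall fun ξ => ?_)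
    simp only
    rw [← mul_add, Complex.re_ofReal_mul, Complex.add_re, Complex.exp_ofReal_mul_I_re,
      Complex.exp_ofReal_mul_I_re, inner_neg_left]
    unfold wavePhase
    rw [hφ]
    generalize 2 * π * t * ‖ξ‖ - a * π / 2 = B
    rw [Real.cos_sub, show 2 * π * -⟪x, ξ⟫ - B = -(2 * π * ⟪x, ξ⟫ + B) by ring, Real.cos_neg,
      Real.cos_add]
    ring
  rw [hJT x rfl, hJT (-x) (norm_neg x)] at hre
  have hre2 : waveKernel n ε t x = κ * (Complex.exp ((a * π / 2 : ℝ) * Complex.I) * T).re := by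
    rw [hre, show Complex.exp ((a * π / 2 : ℝ) * Complex.I) * (κ * T + κ * T) =
      ((2 * κ : ℝ) : ℂ) * (Complex.exp ((a * π / 2 : ℝ) * Complex.I) * T) by push_cast; ring,
      Complex.re_ofReal_mul]
    ring
  have h1 := hest ‖x‖ t ε hx hxR ht hε htx
  rw [← hz, ← hT] at h1
  set Q : ℂ := 1 / (a * (ε + (t - ‖x‖ : ℝ) * Complex.I)) with hQ
  have hQre : Q.re = 1 / a * (ε / (ε ^ 2 + (t - ‖x‖) ^ 2)) := by
    have : Q = ((1 / a : ℝ) : ℂ) * (ε + (t - ‖x‖ : ℝ) * Complex.I)⁻¹ := by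
      rw [hQ, one_div, mul_inv]; push_cast; rw [one_div]
    rw [this, Complex.re_ofReal_mul, Complex.inv_re]
    congr 2
    · simp
    · simp [Complex.normSq_apply]; ring
  have h2 : (Complex.exp ((a * π / 2 : ℝ) * Complex.I) *
      (T - ‖x‖ * Complex.I * (2 * ‖x‖ * Complex.I) ^ ((-(a + 1) : ℝ) : ℂ) * Q)).re =
      (Complex.exp ((a * π / 2 : ℝ) * Complex.I) * T).re -
        2 ^ (-(a + 1)) * ‖x‖ ^ (-a) * (1 / a * (ε / (ε ^ 2 + (t - ‖x‖) ^ 2))) := by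
    rw [mul_sub, Complex.sub_re, ← mul_assoc, cexp_mul_cpow_ofReal_mul_I hx, Complex.re_ofReal_mul,
      hQre]
  have h3 : |(Complex.exp ((a * π / 2 : ℝ) * Complex.I) *
      (T - ‖x‖ * Complex.I * (2 * ‖x‖ * Complex.I) ^ ((-(a + 1) : ℝ) : ℂ) * Q)).re| ≤
      C * (‖x‖ ^ (-a - σ) * |t - ‖x‖| ^ (σ - 1)) := by
    refine (Complex.abs_re_le_norm _).trans ?_
    rw [norm_mul, Complex.norm_exp_ofReal_mul_I, one_mul]
    exact h1
  rw [h2] at h3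
  have h4 : waveKernel n ε t x -
      κ * (2 ^ (-(a + 1)) / a) * (‖x‖ ^ (-a) * (ε / (ε ^ 2 + (t - ‖x‖) ^ 2))) =
      κ * ((Complex.exp ((a * π / 2 : ℝ) * Complex.I) * T).re -
        2 ^ (-(a + 1)) * ‖x‖ ^ (-a) * (1 / a * (ε / (ε ^ 2 + (t - ‖x‖) ^ 2)))) := by
    rw [hre2]; ring
  rw [h4, abs_mul, abs_of_pos hκ0, mul_assoc κ C]
  exact mul_le_mul_of_nonneg_left h3 hκ0.le

theorem ofReal_rpow_neg_le_tsum {u q : ℝ} (hu : 0 ≤ u) (hq : 0 < q) :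
    ENNReal.ofReal (u ^ (-q)) ≤ 1 + ∑' k : ℕ, Set.indicator {u : ℝ | u < 2 * (1 / 2) ^ k}
      (fun _ => ENNReal.ofReal ((1 / 2 : ℝ) ^ (-(q * (k + 1))))) u := by
  rcases hu.eq_or_lt with h0 | h0
  · rw [← h0, Real.zero_rpow (by linarith)]
    simp
  rcases le_or_gt 1 u with h1 | h1
  · have : u ^ (-q) ≤ 1 := Real.rpow_le_one_of_one_le_of_nonpos h1 (by linarith)
    calc ENNReal.ofReal (u ^ (-q)) ≤ 1 := ENNReal.ofReal_le_one.2 this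
      _ ≤ _ := le_self_add
  · obtain ⟨k, hk1, hk2⟩ := exists_nat_pow_near_of_lt_one h0 h1.le (y := (1 / 2 : ℝ))
      (by norm_num) (by norm_num)
    refine le_trans ?_ (le_add_of_nonneg_left zero_le_one)
    refine le_trans ?_ (ENNReal.le_tsum k)
    have hpos : (0 : ℝ) < (1 / 2) ^ k := by positivity
    rw [Set.indicator_of_mem (by simp only [Set.mem_ofPred_eq]; linarith)]
    refine ENNReal.ofReal_le_ofReal ?_
    calc u ^ (-q) ≤ ((1 / 2 : ℝ) ^ (k + 1)) ^ (-q) :=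
          Real.rpow_le_rpow_of_nonpos (by positivity) hk1.le (by linarith)
      _ = _ := by
        rw [← Real.rpow_natCast, ← Real.rpow_mul (by norm_num)]
        congr 1
        push_cast
        ring

theorem lintegral_norm_sub_rpow_neg_le {V : Type*} [NormedAddCommGroup V] [MeasurableSpace V]
    [BorelSpace V] {q s C : ℝ} (hq : 0 < q) (hqs : q < s)
    (hC : 0 ≤ C) {μ : Measure V}
    (hμ : ∀ x r, 0 < r → μ (ball x r) ≤ ENNReal.ofReal (C * r ^ s)) (x : V) :
    ∫⁻ y, ENNReal.ofReal (‖x - y‖ ^ (-q)) ∂μ ≤ μ Set.univ +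
      ENNReal.ofReal (∑' k : ℕ, (1 / 2 : ℝ) ^ (-(q * (k + 1))) * (C * (2 * (1 / 2) ^ k) ^ s)) := by
  have hball : ∀ k : ℕ, MeasurableSet (ball x (2 * (1 / 2) ^ k)) := fun k => measurableSet_ball
  have hsum : Summable
      (fun k : ℕ => (1 / 2 : ℝ) ^ (-(q * (k + 1))) * (C * (2 * (1 / 2) ^ k) ^ s)) := by
    have hg : Summable (fun k : ℕ => ((1 / 2 : ℝ) ^ (s - q)) ^ k) :=
      summable_geometric_of_lt_one (by positivity)
        (Real.rpow_lt_one (by norm_num) (by norm_num) (by linarith))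
    refine (hg.mul_left ((1 / 2 : ℝ) ^ (-q) * C * 2 ^ s)).congr fun k => ?_
    rw [Real.mul_rpow (by norm_num) (by positivity), ← Real.rpow_natCast, ← Real.rpow_natCast,
      ← Real.rpow_mul (by norm_num), ← Real.rpow_mul (by norm_num),
      show -(q * ((k : ℝ) + 1)) = -q + -(q * k) by ring,
      show (s - q) * (k : ℝ) = -(q * k) + k * s by ring, Real.rpow_add (by norm_num),
      Real.rpow_add (by norm_num)]
    ring
  calc ∫⁻ y, ENNReal.ofReal (‖x - y‖ ^ (-q)) ∂μ
      ≤ ∫⁻ y, (1 + ∑' k : ℕ, Set.indicator (ball x (2 * (1 / 2) ^ k))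
      (fun _ => ENNReal.ofReal ((1 / 2 : ℝ) ^ (-(q * (k + 1))))) y) ∂μ := by
        refine lintegral_mono fun y => ?_
        refine (ofReal_rpow_neg_le_tsum (norm_nonneg (x - y)) hq).trans (le_of_eq ?_)
        congr 2
        ext k
        simp only [Set.indicator, Set.mem_ofPred_eq, mem_ball, dist_eq_norm, norm_sub_rev x y]
    _ = μ Set.univ + ∑' k : ℕ, ENNReal.ofReal ((1 / 2 : ℝ) ^ (-(q * (k + 1)))) *
          μ (ball x (2 * (1 / 2) ^ k)) := by
        rw [lintegral_add_left measurable_const, lintegral_const, one_mul,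
          lintegral_tsum fun k => (measurable_const.indicator (hball k)).aemeasurable]
        congr 2
        ext k
        rw [lintegral_indicator_const (hball k)]
    _ ≤ _ := by
        gcongr
        rw [ENNReal.ofReal_tsum_of_nonneg (fun k => by positivity) hsum]
        refine ENNReal.tsum_le_tsum fun k => ?_
        rw [ENNReal.ofReal_mul (by positivity)]
        gcongr
        exact hμ x _ (by positivity)

theorem integrable_norm_sub_rpow_neg {V : Type*} [NormedAddCommGroup V] [MeasurableSpace V]
    [BorelSpace V] [SecondCountableTopology V] {q s C : ℝ} (hq : 0 < q) (hqs : q < s)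
    (hC : 0 ≤ C) {μ : Measure V} [IsFiniteMeasure μ]
    (hμ : ∀ x r, 0 < r → μ (ball x r) ≤ ENNReal.ofReal (C * r ^ s)) :
    Integrable (fun p : V × V => ‖p.1 - p.2‖ ^ (-q)) (μ.prod μ) := by
  have hm : Measurable (fun p : V × V => ‖p.1 - p.2‖ ^ (-q)) := by fun_prop
  refine ⟨hm.aestronglyMeasurable, ?_⟩
  rw [hasFiniteIntegral_iff_ofReal (Filter.Eventually.of_forall fun p => by positivity),
    lintegral_prod _ hm.ennreal_ofReal.aemeasurable]
  refine (lintegral_mono fun x => lintegral_norm_sub_rpow_neg_le hq hqs hC hμ x).trans_lt ?_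
  rw [lintegral_const]
  exact ENNReal.mul_lt_top (ENNReal.add_lt_top.2 ⟨measure_lt_top _ _, ENNReal.ofReal_lt_top⟩)
    (measure_lt_top _ _)

theorem ae_prod_ne_of_measure_ball_le {V : Type*} [NormedAddCommGroup V] [MeasurableSpace V]
    [BorelSpace V] [SecondCountableTopology V] {s C : ℝ} (hs : 0 < s)
    {μ : Measure V} [IsFiniteMeasure μ]
    (hμ : ∀ x r, 0 < r → μ (ball x r) ≤ ENNReal.ofReal (C * r ^ s)) :
    ∀ᵐ p : V × V ∂(μ.prod μ), p.1 ≠ p.2 := by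
  have hsing : ∀ x : V, μ {x} = 0 := by
    intro x
    have ht : Filter.Tendsto (fun r : ℝ => ENNReal.ofReal (C * r ^ s))
        (nhdsWithin 0 (Set.Ioi 0)) (nhds 0) := by
      have h1 : Filter.Tendsto (fun r : ℝ => C * r ^ s) (nhds 0) (nhds (C * 0 ^ s)) :=
        ((Real.continuousAt_rpow_const 0 s (Or.inr hs.le)).tendsto).const_mul C
      rw [Real.zero_rpow hs.ne', mul_zero] at h1
      have h2 := (ENNReal.tendsto_ofReal h1)
      rw [ENNReal.ofReal_zero] at h2
      exact h2.mono_left nhdsWithin_le_nhds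
    refine le_antisymm (ge_of_tendsto ht ?_) bot_le
    filter_upwards [self_mem_nhdsWithin] with r hr
    exact (measure_mono (Set.singleton_subset_iff.2 (mem_ball_self hr))).trans (hμ x r hr)
  have hd : MeasurableSet {p : V × V | p.1 ≠ p.2} :=
    (measurableSet_eq_fun measurable_fst measurable_snd).compl
  rw [Measure.ae_prod_iff_ae_ae hd]
  refine Filter.Eventually.of_forall fun x => ?_
  have : {x}ᶜ ∈ ae μ := by rw [mem_ae_iff, compl_compl]; exact hsing x
  filter_upwards [this] with y hy
  exact fun h => hy (by simp [h])

/-- The cosine transform of a measure. -/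
def cosTransform {n : ℕ} (μ : Measure (E n)) (ξ : E n) : ℝ :=
  ∫ y, Real.cos (2 * π * ⟪y, ξ⟫) ∂μ

theorem continuous_cosTransform {n : ℕ} (μ : Measure (E n)) [IsFiniteMeasure μ] :
    Continuous (cosTransform μ) := by
  unfold cosTransform
  refine continuous_of_dominated (bound := fun _ => 1) (fun ξ => ?_) (fun ξ => ?_)
    (integrable_const _) (Filter.Eventually.of_forall fun y => by fun_prop)
  · exact Continuous.aestronglyMeasurable (by fun_prop)
  · exact Filter.Eventually.of_forall fun y => Real.abs_cos_le_one _

theorem cosTransform_neg {n : ℕ} (μ : Measure (E n)) (ξ : E n) :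
    cosTransform μ (-ξ) = cosTransform μ ξ := by
  unfold cosTransform
  refine integral_congr_ae (Filter.Eventually.of_forall fun y => ?_)
  simp only
  rw [inner_neg_right, mul_neg, Real.cos_neg]

theorem abs_cosTransform_le {n : ℕ} (μ : Measure (E n)) [IsFiniteMeasure μ] (ξ : E n) :
    |cosTransform μ ξ| ≤ μ.real Set.univ := by
  unfold cosTransform
  have := norm_integral_le_of_norm_le_const (μ := μ)
    (f := fun y => Real.cos (2 * π * ⟪y, ξ⟫)) (C := 1)
    (Filter.Eventually.of_forall fun y => Real.abs_cos_le_one _)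
  simpa using this

theorem integral_prod_cos_sub {n : ℕ} (μ : Measure (E n)) [IsFiniteMeasure μ] (ξ : E n) :
    ∫ p : E n × E n, Real.cos (2 * π * ⟪p.1 - p.2, ξ⟫) ∂(μ.prod μ) =
      cosTransform μ ξ ^ 2 + (∫ y, Real.sin (2 * π * ⟪y, ξ⟫) ∂μ) ^ 2 := by
  have hc : Integrable (fun y : E n => Real.cos (2 * π * ⟪y, ξ⟫)) μ :=
    (integrable_const (1 : ℝ)).mono' (Continuous.aestronglyMeasurable (by fun_prop))
      (Filter.Eventually.of_forall fun y => Real.abs_cos_le_one _)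
  have hs : Integrable (fun y : E n => Real.sin (2 * π * ⟪y, ξ⟫)) μ :=
    (integrable_const (1 : ℝ)).mono' (Continuous.aestronglyMeasurable (by fun_prop))
      (Filter.Eventually.of_forall fun y => Real.abs_sin_le_one _)
  have e : ∀ p : E n × E n, Real.cos (2 * π * ⟪p.1 - p.2, ξ⟫) =
      Real.cos (2 * π * ⟪p.1, ξ⟫) * Real.cos (2 * π * ⟪p.2, ξ⟫) +
      Real.sin (2 * π * ⟪p.1, ξ⟫) * Real.sin (2 * π * ⟪p.2, ξ⟫) := by
    intro p
    rw [inner_sub_left, mul_sub, Real.cos_sub]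
  simp_rw [e]
  rw [integral_add (hc.mul_prod hc) (hs.mul_prod hs),
    integral_prod_mul (fun y : E n => Real.cos (2 * π * ⟪y, ξ⟫))
      (fun y : E n => Real.cos (2 * π * ⟪y, ξ⟫)),
    integral_prod_mul (fun y : E n => Real.sin (2 * π * ⟪y, ξ⟫))
      (fun y : E n => Real.sin (2 * π * ⟪y, ξ⟫)), sq, sq]
  rfl

theorem rpow_mul_exp_neg_le {p y : ℝ} (hp : 0 < p) (hy : 0 < y) :
    rexp (-y) ≤ p ^ p * y ^ (-p) := by
  have h1 : y / p ≤ rexp (y / p) := by linarith [Real.add_one_le_exp (y / p)]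
  have h2 : (y / p) ^ p ≤ rexp y := by
    calc (y / p) ^ p ≤ (rexp (y / p)) ^ p := Real.rpow_le_rpow (by positivity) h1 hp.le
      _ = rexp y := by rw [← Real.exp_mul]; congr 1; field_simp
  rw [Real.div_rpow hy.le hp.le, div_le_iff₀ (by positivity)] at h2
  rw [Real.rpow_neg hy.le, Real.exp_neg, ← div_eq_mul_inv, inv_eq_one_div,
    div_le_div_iff₀ (Real.exp_pos _) (by positivity)]
  linarith

theorem integral_gaussian_cos {n : ℕ} (x : E n) {l : ℝ} (hl : 0 < l) :
    ∫ ξ : E n, rexp (-l * ‖ξ‖ ^ 2) * Real.cos (2 * π * ⟪x, ξ⟫) =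
      (π / l) ^ ((n : ℝ) / 2) * rexp (-(π * (‖x‖ ^ 2 * (π / l)))) := by
  have hpl : 0 < π / l := by positivity
  have h := integral_gaussian_fourier x (v := √(π / l)) (by positivity)
  have hv : √(π / l) ^ 2 = π / l := Real.sq_sqrt hpl.le
  have hint : Integrable (fun ξ : E n => ((rexp (-π / √(π / l) ^ 2 * ‖ξ‖ ^ 2) : ℝ) : ℂ) *
      Complex.exp (((2 * π * ⟪x, ξ⟫ : ℝ) : ℂ) * Complex.I)) := by
    by_contra hcon
    rw [integral_undef hcon] at h
    have : (0 : ℝ) < √(π / l) ^ (n : ℝ) * rexp (-π * ‖x‖ ^ 2 * √(π / l) ^ 2) := by positivity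
    exact this.ne (by exact_mod_cast h)
  have h2 := integral_re hint
  simp only [RCLike.re_to_complex] at h2
  rw [h, Complex.ofReal_re] at h2
  have e1 : -π / √(π / l) ^ 2 = -l := by rw [hv]; field_simp
  rw [e1] at h2
  simp_rw [Complex.re_ofReal_mul, Complex.exp_ofReal_mul_I_re] at h2
  rw [h2, hv]
  congr 1
  · rw [Real.sqrt_eq_rpow, ← Real.rpow_mul hpl.le]; congr 1; ring
  · congr 1; ring

theorem integrable_exp_neg_mul_norm_sq {n : ℕ} {l : ℝ} (hl : 0 < l) :
    Integrable (fun ξ : E n => rexp (-l * ‖ξ‖ ^ 2)) := by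
  have h := integral_gaussian_cos (0 : E n) hl
  by_contra hcon
  simp only [inner_zero_left, mul_zero, Real.cos_zero, mul_one] at h
  rw [integral_undef hcon] at h
  have : (0 : ℝ) < (π / l) ^ ((n : ℝ) / 2) * rexp (-(π * (‖(0 : E n)‖ ^ 2 * (π / l)))) := by
    positivity
  exact this.ne h

theorem integral_gaussian_mul_integral_cos_le {n : ℕ} {q : ℝ} (hq : 0 < q)
    {μ : Measure (E n)} [IsFiniteMeasure μ]
    (hI : Integrable (fun p : E n × E n => ‖p.1 - p.2‖ ^ (-q)) (μ.prod μ))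
    (hne : ∀ᵐ p : E n × E n ∂(μ.prod μ), p.1 ≠ p.2) {l : ℝ} (hl : 0 < l) :
    Integrable (fun ξ : E n => rexp (-l * ‖ξ‖ ^ 2) *
      ∫ p : E n × E n, Real.cos (2 * π * ⟪p.1 - p.2, ξ⟫) ∂(μ.prod μ)) ∧
    ∫ ξ : E n, rexp (-l * ‖ξ‖ ^ 2) *
      ∫ p : E n × E n, Real.cos (2 * π * ⟪p.1 - p.2, ξ⟫) ∂(μ.prod μ) ≤
      (π / l) ^ (((n : ℝ) - q) / 2) * ((q / 2) ^ (q / 2) * π ^ (-(q / 2)) *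
        ∫ p : E n × E n, ‖p.1 - p.2‖ ^ (-q) ∂(μ.prod μ)) := by
  have hpl : 0 < π / l := by positivity
  have hint : Integrable (Function.uncurry fun (ξ : E n) (p : E n × E n) =>
      rexp (-l * ‖ξ‖ ^ 2) * Real.cos (2 * π * ⟪p.1 - p.2, ξ⟫))
      ((volume : Measure (E n)).prod (μ.prod μ)) := by
    have h1 := (integrable_exp_neg_mul_norm_sq (n := n) hl).mul_prod
      (integrable_const (1 : ℝ) (μ := μ.prod μ))
    refine h1.mono' ?_ (Filter.Eventually.of_forall fun p => ?_)
    · refine Continuous.aestronglyMeasurable ?_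
      simp only [Function.uncurry_def]
      fun_prop
    · simp only [Function.uncurry_def]
      rw [norm_mul, Real.norm_of_nonneg (Real.exp_pos _).le]
      exact mul_le_mul_of_nonneg_left (Real.abs_cos_le_one _) (Real.exp_pos _).le
  have hswap := integral_integral_swap hint
  have hleft := hint.integral_prod_left
  simp only [Function.uncurry_apply_pair, integral_const_mul] at hleft
  refine ⟨hleft, ?_⟩
  simp_rw [integral_const_mul] at hswap
  rw [hswap]
  simp_rw [fun p : E n × E n => integral_gaussian_cos (p.1 - p.2) hl]
  rw [integral_const_mul]
  have hb : ∀ᵐ p : E n × E n ∂(μ.prod μ),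
      rexp (-(π * (‖p.1 - p.2‖ ^ 2 * (π / l)))) ≤
        (q / 2) ^ (q / 2) * π ^ (-(q / 2)) * (π / l) ^ (-(q / 2)) * ‖p.1 - p.2‖ ^ (-q) := by
    filter_upwards [hne] with p hp
    have hp' : 0 < ‖p.1 - p.2‖ := norm_pos_iff.2 (sub_ne_zero.2 hp)
    refine (rpow_mul_exp_neg_le (p := q / 2) (by positivity) (by positivity)).trans
      (le_of_eq ?_)
    rw [Real.mul_rpow Real.pi_pos.le (by positivity), Real.mul_rpow (by positivity) hpl.le,
      ← Real.rpow_natCast, ← Real.rpow_mul hp'.le]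
    rw [show ((2 : ℕ) : ℝ) * -(q / 2) = -q by push_cast; ring]
    ring
  have hm : ∫ p : E n × E n, rexp (-(π * (‖p.1 - p.2‖ ^ 2 * (π / l)))) ∂(μ.prod μ) ≤
      ∫ p : E n × E n, (q / 2) ^ (q / 2) * π ^ (-(q / 2)) * (π / l) ^ (-(q / 2)) *
        ‖p.1 - p.2‖ ^ (-q) ∂(μ.prod μ) :=
    integral_mono_of_nonneg (Filter.Eventually.of_forall fun p => (Real.exp_pos _).le)
      (hI.const_mul _) hb
  calc (π / l) ^ ((n : ℝ) / 2) *
        ∫ p : E n × E n, rexp (-(π * (‖p.1 - p.2‖ ^ 2 * (π / l)))) ∂(μ.prod μ)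
      ≤ (π / l) ^ ((n : ℝ) / 2) * ∫ p : E n × E n, (q / 2) ^ (q / 2) * π ^ (-(q / 2)) *
        (π / l) ^ (-(q / 2)) * ‖p.1 - p.2‖ ^ (-q) ∂(μ.prod μ) := by gcongr
    _ = _ := by
      rw [integral_const_mul,
        show ((n : ℝ) - q) / 2 = n / 2 + -(q / 2) by ring, Real.rpow_add hpl]
      ring

theorem integrable_bessel_mul_cosTransform_sq {n : ℕ} {β q : ℝ} (hq : 0 < q) (hβq : β < q)
    (hβn : β < n) {μ : Measure (E n)} [IsFiniteMeasure μ]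
    (hI : Integrable (fun p : E n × E n => ‖p.1 - p.2‖ ^ (-q)) (μ.prod μ))
    (hne : ∀ᵐ p : E n × E n ∂(μ.prod μ), p.1 ≠ p.2) :
    Integrable (fun ξ : E n => (1 + ‖ξ‖ ^ 2) ^ (-(((n : ℝ) - β) / 2)) *
      cosTransform μ ξ ^ 2) := by
  set κ : ℝ := ((n : ℝ) - β) / 2 with hκ
  have hκ0 : 0 < κ := by rw [hκ]; linarith
  set P : E n → ℝ := fun ξ =>
    ∫ p : E n × E n, Real.cos (2 * π * ⟪p.1 - p.2, ξ⟫) ∂(μ.prod μ) with hP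
  have hPc : ∀ ξ, cosTransform μ ξ ^ 2 ≤ P ξ := by
    intro ξ
    rw [hP]
    simp only
    rw [integral_prod_cos_sub]
    linarith [sq_nonneg (∫ y, Real.sin (2 * π * ⟪y, ξ⟫) ∂μ)]
  have hP0 : ∀ ξ, 0 ≤ P ξ := fun ξ => (sq_nonneg _).trans (hPc ξ)
  have hPm : Continuous P := by
    refine continuous_of_dominated (bound := fun _ => 1) (fun ξ => ?_) (fun ξ => ?_)
      (integrable_const _) (Filter.Eventually.of_forall fun y => by fun_prop)
    · exact Continuous.aestronglyMeasurable (by fun_prop)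
    · exact Filter.Eventually.of_forall fun y => Real.abs_cos_le_one _
  set A : ℝ := (q / 2) ^ (q / 2) * π ^ (-(q / 2)) *
        ∫ p : E n × E n, ‖p.1 - p.2‖ ^ (-q) ∂(μ.prod μ) with hA
  set F : E n → ℝ → ℝ := fun ξ l =>
    (l ^ (κ - 1) * rexp (-l)) * (rexp (-l * ‖ξ‖ ^ 2) * P ξ) with hF
  have hFm : Measurable (Function.uncurry F) := by
    have := hPm.measurable
    simp only [hF, Function.uncurry_def]
    fun_prop
  have hint : Integrable (Function.uncurry F)
      ((volume : Measure (E n)).prod (volume.restrict (Set.Ioi (0 : ℝ)))) := by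
    rw [integrable_prod_iff' hFm.aestronglyMeasurable]
    have hmem := ae_restrict_mem (measurableSet_Ioi (a := (0 : ℝ))) (μ := volume)
    constructor
    · filter_upwards [hmem] with l hl
      exact (integral_gaussian_mul_integral_cos_le hq hI hne hl).1.const_mul
        (l ^ (κ - 1) * rexp (-l))
    · have hG : IntegrableOn (fun l : ℝ => π ^ (((n : ℝ) - q) / 2) * A *
          (rexp (-l) * l ^ ((q - β) / 2 - 1))) (Set.Ioi 0) :=
        (Real.GammaIntegral_convergent (by linarith)).const_mul _
      refine Integrable.mono' hG
        hFm.norm.stronglyMeasurable.integral_prod_left'.aestronglyMeasurable ?_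
      filter_upwards [hmem] with l hl
      have hl : 0 < l := hl
      have h0 : ∀ ξ, ‖F ξ l‖ = F ξ l := by
        intro ξ
        have := hP0 ξ
        refine Real.norm_of_nonneg ?_
        simp only [hF]
        positivity
      simp only [Function.uncurry_apply_pair, h0]
      rw [Real.norm_of_nonneg (integral_nonneg fun ξ => by
        simp only; rw [← h0]; exact norm_nonneg _)]
      simp only [hF]
      rw [integral_const_mul]
      have hle := (integral_gaussian_mul_integral_cos_le hq hI hne hl).2
      rw [← hA] at hle
      calc _ ≤ (l ^ (κ - 1) * rexp (-l)) * ((π / l) ^ (((n : ℝ) - q) / 2) * A) := by gcongr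
        _ = _ := by
          rw [Real.div_rpow Real.pi_pos.le hl.le, div_eq_mul_inv, ← Real.rpow_neg hl.le,
            show (q - β) / 2 - 1 = (κ - 1) + -(((n : ℝ) - q) / 2) by rw [hκ]; ring,
            Real.rpow_add hl]
          ring
  have hleft := hint.integral_prod_left
  refine Integrable.mono' (hleft.const_mul (1 / Real.Gamma κ)) ?_ ?_
  · have := (continuous_cosTransform μ).measurable
    exact Measurable.aestronglyMeasurable (by fun_prop)
  · refine Filter.Eventually.of_forall fun ξ => ?_
    rw [Real.norm_of_nonneg (by positivity)]
    simp only [Function.uncurry_apply_pair]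
    have e : ∀ l, F ξ l = (l ^ (κ - 1) * rexp (-((1 + ‖ξ‖ ^ 2) * l))) * P ξ := by
      intro l
      simp only [hF]
      rw [show -((1 + ‖ξ‖ ^ 2) * l) = -l + -l * ‖ξ‖ ^ 2 by ring, Real.exp_add]
      ring
    simp_rw [e]
    rw [integral_mul_const, Real.integral_rpow_mul_exp_neg_mul_Ioi hκ0 (by positivity), one_div, one_div,
      Real.inv_rpow (by positivity), ← Real.rpow_neg (by positivity)]
    have hΓ := Real.Gamma_pos_of_pos hκ0
    calc (1 + ‖ξ‖ ^ 2) ^ (-κ) * cosTransform μ ξ ^ 2 ≤ (1 + ‖ξ‖ ^ 2) ^ (-κ) * P ξ := by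
          gcongr; exact hPc ξ
      _ = _ := by field_simp

theorem exists_one_add_sq_rpow_mul_exp_le (M : ℝ) {c : ℝ} (hc : 0 < c) :
    ∃ C, 0 < C ∧ ∀ r : ℝ, 0 ≤ r → (1 + r ^ 2) ^ M * rexp (-(c * r)) ≤ C := by
  obtain ⟨p, hp, hMp⟩ : ∃ p, 0 < p ∧ M ≤ p := ⟨max M 1, by positivity, le_max_left _ _⟩
  refine ⟨(2 * p) ^ (2 * p) * c ^ (-(2 * p)) * rexp c, by positivity, fun r hr => ?_⟩
  have h1 : (1 + r ^ 2) ^ M ≤ (1 + r) ^ (2 * p) := by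
    rw [Real.rpow_mul (by positivity)]
    refine (Real.rpow_le_rpow_of_exponent_le (by nlinarith) hMp).trans ?_
    refine Real.rpow_le_rpow (by positivity) ?_ hp.le
    norm_cast
    nlinarith
  have h2 := rpow_mul_exp_neg_le (p := 2 * p) (y := c * (1 + r)) (by positivity) (by positivity)
  have h3 : rexp (-(c * r)) = rexp (-(c * (1 + r))) * rexp c := by
    rw [← Real.exp_add]; congr 1; ring
  rw [Real.mul_rpow hc.le (by positivity)] at h2
  calc (1 + r ^ 2) ^ M * rexp (-(c * r))
      ≤ (1 + r) ^ (2 * p) *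
        (((2 * p) ^ (2 * p) * (c ^ (-(2 * p)) * (1 + r) ^ (-(2 * p)))) * rexp c) := by
        rw [h3]; gcongr
    _ = (2 * p) ^ (2 * p) * c ^ (-(2 * p)) * rexp c *
        ((1 + r) ^ (2 * p) * (1 + r) ^ (-(2 * p))) := by ring
    _ = _ := by
      rw [← Real.rpow_add (by positivity)]; simp

theorem integrable_one_add_sq_rpow_mul_sq {n : ℕ} {g : E n → ℝ} (hg : Continuous g) {A c : ℝ}
    (hc : 0 < c) (hgA : ∀ ξ, |g ξ| ≤ A * rexp (-(c * ‖ξ‖))) (M : ℝ) :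
    Integrable (fun ξ => (1 + ‖ξ‖ ^ 2) ^ M * g ξ ^ 2) := by
  obtain ⟨C, hC, hC'⟩ := exists_one_add_sq_rpow_mul_exp_le M hc
  have hcont : Continuous (fun ξ : E n => (1 + ‖ξ‖ ^ 2) ^ M * g ξ ^ 2) := by
    refine Continuous.mul ?_ (by fun_prop)
    exact Continuous.rpow_const (by fun_prop) fun ξ => Or.inl (by positivity)
  refine (((integrable_exp_neg_mul_norm (volume : Measure (E n)) hc).const_mul
    (C * A ^ 2))).mono' hcont.aestronglyMeasurable (.of_forall fun ξ => ?_)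
  have h1 : g ξ ^ 2 ≤ (A * rexp (-(c * ‖ξ‖))) ^ 2 := by
    rw [← sq_abs]
    exact pow_le_pow_left₀ (abs_nonneg _) (hgA ξ) 2
  have h2 := hC' ‖ξ‖ (norm_nonneg _)
  rw [Real.norm_of_nonneg (by positivity)]
  calc (1 + ‖ξ‖ ^ 2) ^ M * g ξ ^ 2
      ≤ (1 + ‖ξ‖ ^ 2) ^ M * (A * rexp (-(c * ‖ξ‖))) ^ 2 := by gcongr
    _ = ((1 + ‖ξ‖ ^ 2) ^ M * rexp (-(c * ‖ξ‖))) * (A ^ 2 * rexp (-(c * ‖ξ‖))) := by ring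
    _ ≤ C * (A ^ 2 * rexp (-(c * ‖ξ‖))) := by gcongr
    _ = C * A ^ 2 * rexp (-c * ‖ξ‖) := by rw [neg_mul]; ring

/-- Even Schwartz functions are dense, in `L²`, among the even continuous functions. -/
theorem exists_even_schwartz_integral_sub_sq_le {n : ℕ} {G : E n → ℝ} (hG : Continuous G)
    (heven : ∀ ξ, G (-ξ) = G ξ) (hGi : Integrable (fun ξ => G ξ ^ 2)) {δ : ℝ} (hδ : 0 < δ) :
    ∃ h : SchwartzMap (E n) ℝ, (∀ ξ, h (-ξ) = h ξ) ∧
      Integrable (fun ξ => (h ξ - G ξ) ^ 2) ∧ ∫ ξ, (h ξ - G ξ) ^ 2 ≤ δ := by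
  have hGm : MemLp G 2 volume := (memLp_two_iff_integrable_sq hG.aestronglyMeasurable).2 hGi
  obtain ⟨f, hf1, hf2, hf3⟩ := hGm.exist_eLpNorm_sub_le (by simp) (by simp)
    (Real.sqrt_pos.2 hδ)
  let F : SchwartzMap (E n) ℝ := hf1.toSchwartzMap hf2
  have hF : ∀ ξ, F ξ = f ξ := fun ξ => rfl
  have hFm : MemLp (G - ⇑F) 2 volume := hGm.sub (F.memLp 2 volume)
  have hint : Integrable (fun ξ => (F ξ - G ξ) ^ 2) := by
    have := hFm.integrable_sq
    refine this.congr (.of_forall fun ξ => ?_)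
    simp only [Pi.sub_apply]; ring
  have hle : ∫ ξ, (F ξ - G ξ) ^ 2 ≤ δ := by
    have h1 := hFm.eLpNorm_eq_integral_rpow_norm (by simp) (by simp)
    have h2 : eLpNorm (G - ⇑F) 2 volume ≤ ENNReal.ofReal (√δ) := hf3
    rw [h1, ENNReal.ofReal_le_ofReal_iff (by positivity)] at h2
    have h3 : (fun ξ => ‖(G - ⇑F) ξ‖ ^ (2 : ℝ≥0∞).toReal) = fun ξ => (F ξ - G ξ) ^ 2 := by
      funext ξ
      simp only [Pi.sub_apply, ENNReal.toReal_ofNat, Real.norm_eq_abs]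
      norm_cast
      rw [sq_abs]; ring
    rw [h3] at h2
    have h4 : (0 : ℝ) ≤ ∫ ξ, (F ξ - G ξ) ^ 2 := integral_nonneg fun ξ => sq_nonneg _
    rw [ENNReal.toReal_ofNat, show (2 : ℝ)⁻¹ = 1 / 2 by norm_num, ← Real.sqrt_eq_rpow] at h2
    exact (Real.sqrt_le_sqrt_iff hδ.le).1 h2
  have hint' : Integrable (fun ξ => (F (-ξ) - G ξ) ^ 2) := by
    have := hint.comp_neg
    simpa only [heven] using this
  have hle' : ∫ ξ, (F (-ξ) - G ξ) ^ 2 = ∫ ξ, (F ξ - G ξ) ^ 2 := by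
    rw [← integral_neg_eq_self]
    simp only [neg_neg, heven]
  let N : SchwartzMap (E n) ℝ :=
    SchwartzMap.compCLMOfContinuousLinearEquiv ℝ (ContinuousLinearEquiv.neg ℝ (M := E n)) F
  have hN : ∀ ξ, N ξ = F (-ξ) := fun ξ => rfl
  have hval : ∀ ξ, ((1 / 2 : ℝ) • (F + N)) ξ = (F ξ + F (-ξ)) / 2 := fun ξ => by
    simp only [smul_apply, add_apply, hN, smul_eq_mul]; ring
  have hpt : ∀ ξ, (((1 / 2 : ℝ) • (F + N)) ξ - G ξ) ^ 2 ≤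
      ((F ξ - G ξ) ^ 2 + (F (-ξ) - G ξ) ^ 2) / 2 := fun ξ => by
    rw [hval]
    nlinarith [sq_nonneg (F ξ - F (-ξ))]
  have hI := ((hint.add hint').div_const 2)
  refine ⟨(1 / 2 : ℝ) • (F + N), fun ξ => ?_, ?_, ?_⟩
  · rw [hval, hval, neg_neg, add_comm]
  · refine hI.mono' ?_ (.of_forall fun ξ => ?_)
    · exact Continuous.aestronglyMeasurable (by fun_prop)
    · rw [Real.norm_of_nonneg (sq_nonneg _)]
      exact hpt ξ
  · calc _ ≤ ∫ ξ, ((F ξ - G ξ) ^ 2 + (F (-ξ) - G ξ) ^ 2) / 2 :=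
          integral_mono_of_nonneg (.of_forall fun ξ => sq_nonneg _) hI (.of_forall hpt)
      _ = (∫ ξ, (F ξ - G ξ) ^ 2) := by
          rw [integral_div, integral_add hint hint', hle']; ring
      _ ≤ δ := hle

theorem exists_even_schwartz_approx {n : ℕ} {g : E n → ℝ} (hg : Continuous g)
    (heven : ∀ ξ, g (-ξ) = g ξ) {A c : ℝ} (hc : 0 < c)
    (hgA : ∀ ξ, |g ξ| ≤ A * rexp (-(c * ‖ξ‖))) (s : ℝ) {κ : ℝ} (hκ : 0 < κ) :
    ∃ h : SchwartzMap (E n) ℝ, (∀ ξ, h (-ξ) = h ξ) ∧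
      ∫ ξ, |h ξ - g ξ| ≤ κ ∧
      ∫ ξ, (1 + ‖ξ‖ ^ 2) ^ s * h ξ ^ 2 ≤ 2 * (∫ ξ, (1 + ‖ξ‖ ^ 2) ^ s * g ξ ^ 2) + κ := by
  obtain ⟨M, hMn, hMs⟩ : ∃ M : ℝ, (n : ℝ) < 4 * M ∧ s ≤ 2 * M :=
    ⟨max n (max s 1), by
      have h1 := le_max_left (n : ℝ) (max s 1)
      have h2 := (le_max_right s 1).trans (le_max_right (n : ℝ) (max s 1))
      linarith, by
      have h1 := (le_max_left s 1).trans (le_max_right (n : ℝ) (max s 1))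
      have h2 := (le_max_right s 1).trans (le_max_right (n : ℝ) (max s 1))
      linarith⟩
  have hw : ∀ ξ : E n, (1 : ℝ) ≤ 1 + ‖ξ‖ ^ 2 := fun ξ => by nlinarith [sq_nonneg ‖ξ‖]
  have hw0 : ∀ ξ : E n, (0 : ℝ) < 1 + ‖ξ‖ ^ 2 := fun ξ => by positivity
  have hI1 : Integrable (fun ξ : E n => (1 + ‖ξ‖ ^ 2) ^ (-(2 * M))) := by
    have := integrable_rpow_neg_one_add_norm_sq (E := E n) (μ := volume) (r := 4 * M) (by simpa)
    refine this.congr (.of_forall fun ξ => ?_)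
    simp only; congr 1; ring
  set I := ∫ ξ : E n, (1 + ‖ξ‖ ^ 2) ^ (-(2 * M)) with hIdef
  have hI0 : 0 ≤ I := integral_nonneg fun ξ => by positivity
  set η := κ / (I + 1) with hη
  have hη0 : 0 < η := by positivity
  have hG : Continuous (fun ξ : E n => (1 + ‖ξ‖ ^ 2) ^ M * g ξ) :=
    (Continuous.rpow_const (by fun_prop) fun ξ => Or.inl (hw0 ξ).ne').mul hg
  obtain ⟨H, hH1, hH2, hH3⟩ := exists_even_schwartz_integral_sub_sq_le hG
    (fun ξ => by rw [norm_neg, heven]) (by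
      refine (integrable_one_add_sq_rpow_mul_sq hg hc hgA (2 * M)).congr
        (.of_forall fun ξ => ?_)
      simp only
      rw [mul_pow, ← Real.rpow_mul_natCast (hw0 ξ).le]
      push_cast
      rw [mul_comm M]) (δ := min (η * κ) (κ / 2)) (by positivity)
  set J := ∫ ξ, (H ξ - (1 + ‖ξ‖ ^ 2) ^ M * g ξ) ^ 2 with hJ
  have hJ1 : J ≤ η * κ := hH3.trans (min_le_left _ _)
  have hJ2 : J ≤ κ / 2 := hH3.trans (min_le_right _ _)
  let h : SchwartzMap (E n) ℝ :=
    SchwartzMap.smulLeftCLM ℝ (fun ξ : E n => (1 + ‖ξ‖ ^ 2) ^ (-M)) H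
  have hh : ∀ ξ, h ξ = (1 + ‖ξ‖ ^ 2) ^ (-M) * H ξ := fun ξ =>
    SchwartzMap.smulLeftCLM_apply_apply
      (Function.hasTemperateGrowth_one_add_norm_sq_rpow (E n) (-M)) H ξ
  have hdiff : ∀ ξ, h ξ - g ξ =
      (1 + ‖ξ‖ ^ 2) ^ (-M) * (H ξ - (1 + ‖ξ‖ ^ 2) ^ M * g ξ) := fun ξ => by
    rw [hh, mul_sub, ← mul_assoc, ← Real.rpow_add (hw0 ξ), neg_add_cancel, Real.rpow_zero,
      one_mul]
  have hsq : ∀ ξ : E n, ((1 + ‖ξ‖ ^ 2) ^ (-M)) ^ 2 = (1 + ‖ξ‖ ^ 2) ^ (-(2 * M)) := fun ξ => by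
    rw [← Real.rpow_mul_natCast (hw0 ξ).le]
    congr 1; push_cast; ring
  refine ⟨h, fun ξ => by rw [hh, hh, norm_neg, hH1], ?_, ?_⟩
  · have hpt : ∀ ξ, |h ξ - g ξ| ≤ η / 2 * (1 + ‖ξ‖ ^ 2) ^ (-(2 * M)) +
        (2 * η)⁻¹ * (H ξ - (1 + ‖ξ‖ ^ 2) ^ M * g ξ) ^ 2 := fun ξ => by
      rw [hdiff, abs_mul, abs_of_pos (Real.rpow_pos_of_pos (hw0 ξ) _), ← hsq,
        ← sq_abs (H ξ - _)]
      have := sq_nonneg (η * (1 + ‖ξ‖ ^ 2) ^ (-M) - |H ξ - (1 + ‖ξ‖ ^ 2) ^ M * g ξ|)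
      rw [← sub_nonneg]
      have h2 : η / 2 * ((1 + ‖ξ‖ ^ 2) ^ (-M)) ^ 2 +
          (2 * η)⁻¹ * |H ξ - (1 + ‖ξ‖ ^ 2) ^ M * g ξ| ^ 2 -
          (1 + ‖ξ‖ ^ 2) ^ (-M) * |H ξ - (1 + ‖ξ‖ ^ 2) ^ M * g ξ| =
          (2 * η)⁻¹ * (η * (1 + ‖ξ‖ ^ 2) ^ (-M) - |H ξ - (1 + ‖ξ‖ ^ 2) ^ M * g ξ|) ^ 2 := by
        field_simp; ring
      rw [h2]; positivity
    calc _ ≤ ∫ ξ, (η / 2 * (1 + ‖ξ‖ ^ 2) ^ (-(2 * M)) +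
        (2 * η)⁻¹ * (H ξ - (1 + ‖ξ‖ ^ 2) ^ M * g ξ) ^ 2) :=
          integral_mono_of_nonneg (.of_forall fun ξ => abs_nonneg _)
            ((hI1.const_mul _).add (hH2.const_mul _)) (.of_forall hpt)
      _ = η / 2 * I + (2 * η)⁻¹ * J := by
          rw [integral_add (hI1.const_mul _) (hH2.const_mul _), integral_const_mul,
            integral_const_mul]
      _ ≤ η / 2 * (I + 1) + (2 * η)⁻¹ * (η * κ) := by gcongr; linarith
      _ = κ := by rw [hη]; field_simp; ring
  · have hint := integrable_one_add_sq_rpow_mul_sq hg hc hgA s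
    have hpt : ∀ ξ, (1 + ‖ξ‖ ^ 2) ^ s * h ξ ^ 2 ≤ 2 * ((1 + ‖ξ‖ ^ 2) ^ s * g ξ ^ 2) +
        2 * (H ξ - (1 + ‖ξ‖ ^ 2) ^ M * g ξ) ^ 2 := fun ξ => by
      have h1 : h ξ ^ 2 ≤ 2 * g ξ ^ 2 + 2 * (h ξ - g ξ) ^ 2 := by
        nlinarith [sq_nonneg (h ξ - 2 * g ξ)]
      have h2 : (1 + ‖ξ‖ ^ 2) ^ s * (1 + ‖ξ‖ ^ 2) ^ (-(2 * M)) ≤ 1 := by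
        rw [← Real.rpow_add (hw0 ξ)]
        exact Real.rpow_le_one_of_one_le_of_nonpos (hw ξ) (by linarith)
      calc (1 + ‖ξ‖ ^ 2) ^ s * h ξ ^ 2
          ≤ (1 + ‖ξ‖ ^ 2) ^ s * (2 * g ξ ^ 2 + 2 * (h ξ - g ξ) ^ 2) := by gcongr
        _ = 2 * ((1 + ‖ξ‖ ^ 2) ^ s * g ξ ^ 2) + ((1 + ‖ξ‖ ^ 2) ^ s *
            (1 + ‖ξ‖ ^ 2) ^ (-(2 * M))) * (2 * (H ξ - (1 + ‖ξ‖ ^ 2) ^ M * g ξ) ^ 2) := by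
            rw [hdiff, mul_pow, hsq]; ring
        _ ≤ 2 * ((1 + ‖ξ‖ ^ 2) ^ s * g ξ ^ 2) + 1 *
            (2 * (H ξ - (1 + ‖ξ‖ ^ 2) ^ M * g ξ) ^ 2) := by gcongr
        _ = _ := by ring
    calc _ ≤ ∫ ξ, (2 * ((1 + ‖ξ‖ ^ 2) ^ s * g ξ ^ 2) +
        2 * (H ξ - (1 + ‖ξ‖ ^ 2) ^ M * g ξ) ^ 2) :=
          integral_mono_of_nonneg (.of_forall fun ξ => by positivity)
            ((hint.const_mul _).add (hH2.const_mul _)) (.of_forall hpt)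
      _ = 2 * (∫ ξ, (1 + ‖ξ‖ ^ 2) ^ s * g ξ ^ 2) + 2 * J := by
          rw [integral_add (hint.const_mul _) (hH2.const_mul _), integral_const_mul,
            integral_const_mul]
      _ ≤ _ := by linarith

/-- An even real Schwartz function is the Fourier transform of an even real one. -/
theorem exists_schwartz_FT_eq {n : ℕ} (h : SchwartzMap (E n) ℝ) (heven : ∀ ξ, h (-ξ) = h ξ) :
    ∃ u : SchwartzMap (E n) ℂ, (∀ x, (u x).im = 0) ∧ (∀ x, u (-x) = u x) ∧
      ∀ ξ, FT u ξ = ((h ξ : ℝ) : ℂ) := by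
  let k : SchwartzMap (E n) ℂ := SchwartzMap.postcompCLM Complex.ofRealCLM h
  have hk : ∀ ξ, k ξ = ((h ξ : ℝ) : ℂ) := fun ξ => rfl
  let u : SchwartzMap (E n) ℂ := FourierTransformInv.fourierInv k
  have hu : ∀ x, u x = ∫ v, Complex.exp ((((2 * π * ⟪v, x⟫ : ℝ) : ℂ)) * Complex.I) • k v := by
    intro x
    have : u x = FourierTransformInv.fourierInv (k : E n → ℂ) x := by
      rw [← SchwartzMap.fourierInv_coe]
    rw [this, Real.fourierInv_eq']
  have hueven : ∀ x, u (-x) = u x := fun x => by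
    rw [hu, hu, ← integral_neg_eq_self]
    simp only [hk, heven, inner_neg_neg]
  refine ⟨u, fun x => ?_, hueven, fun ξ => ?_⟩
  · have hconj : (starRingEnd ℂ) (u x) = u (-x) := by
      rw [hu, hu, ← integral_conj]
      refine integral_congr_ae (.of_forall fun v => ?_)
      simp only [hk, smul_eq_mul, map_mul, Complex.conj_ofReal, ← Complex.exp_conj,
        Complex.conj_I, inner_neg_right]
      congr 2
      push_cast; ring
    rw [← Complex.conj_eq_iff_im, hconj, hueven]
  · have h1 : FourierTransform.fourier u = k := FourierTransform.fourier_fourierInv_eq k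
    have h2 : FourierTransform.fourier (u : E n → ℂ) ξ = k ξ := by
      rw [← SchwartzMap.fourier_coe, h1]
    rw [← hk, ← h2, Real.fourier_eq']
    rfl

/-- The wave `cos(t√(-Δ) - (n-1)π/4)` whose initial datum has Fourier transform `g`. -/
def waveSynthesis (n : ℕ) (g : E n → ℝ) (t : ℝ) (x : E n) : ℂ :=
  ∫ ξ : E n, ((wavePhase n t ξ : ℝ) : ℂ) *
    Complex.exp (((2 * π * ⟪x, ξ⟫ : ℝ) : ℂ) * Complex.I) * ((g ξ : ℝ) : ℂ)

theorem cosWave_eq_waveSynthesis {n : ℕ} {f : E n → ℂ} {h : E n → ℝ}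
    (hf : ∀ ξ, FT f ξ = ((h ξ : ℝ) : ℂ)) (t : ℝ) (x : E n) :
    cosWave n f t x = waveSynthesis n h t x := by
  unfold cosWave waveSynthesis wavePhase
  simp only [hf]

theorem norm_waveSynthesis_integrand_le {n : ℕ} (g : E n → ℝ) (t : ℝ) (x ξ : E n) :
    ‖((wavePhase n t ξ : ℝ) : ℂ) *
      Complex.exp (((2 * π * ⟪x, ξ⟫ : ℝ) : ℂ) * Complex.I) * ((g ξ : ℝ) : ℂ)‖ ≤ |g ξ| := by
  rw [norm_mul, norm_mul, Complex.norm_exp_ofReal_mul_I, mul_one, Complex.norm_real,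
    Complex.norm_real, Real.norm_eq_abs, Real.norm_eq_abs]
  exact mul_le_of_le_one_left (abs_nonneg _) (abs_wavePhase_le t ξ)

theorem continuous_wavePhase_left {n : ℕ} (ξ : E n) : Continuous fun t => wavePhase n t ξ := by
  unfold wavePhase; fun_prop

theorem continuous_wavePhase_right {n : ℕ} (t : ℝ) : Continuous (wavePhase n t) := by
  unfold wavePhase; fun_prop

theorem aestronglyMeasurable_waveSynthesis_integrand {n : ℕ} {g : E n → ℝ} (hg : Integrable g)
    (t : ℝ) (x : E n) :
    AEStronglyMeasurable (fun ξ => ((wavePhase n t ξ : ℝ) : ℂ) *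
      Complex.exp (((2 * π * ⟪x, ξ⟫ : ℝ) : ℂ) * Complex.I) * ((g ξ : ℝ) : ℂ)) := by
  refine AEStronglyMeasurable.mul ?_ (Complex.continuous_ofReal.comp_aestronglyMeasurable hg.1)
  have := continuous_wavePhase_right (n := n) t
  exact Continuous.aestronglyMeasurable (by fun_prop)

theorem integrable_waveSynthesis_integrand {n : ℕ} {g : E n → ℝ} (hg : Integrable g)
    (t : ℝ) (x : E n) :
    Integrable (fun ξ => ((wavePhase n t ξ : ℝ) : ℂ) *
      Complex.exp (((2 * π * ⟪x, ξ⟫ : ℝ) : ℂ) * Complex.I) * ((g ξ : ℝ) : ℂ)) :=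
  hg.abs.mono' (aestronglyMeasurable_waveSynthesis_integrand hg t x)
    (.of_forall fun ξ => norm_waveSynthesis_integrand_le g t x ξ)

theorem continuous_waveSynthesis {n : ℕ} {g : E n → ℝ} (hg : Integrable g) :
    Continuous fun p : ℝ × E n => waveSynthesis n g p.1 p.2 := by
  unfold waveSynthesis
  refine continuous_of_dominated (bound := fun ξ => |g ξ|)
    (fun p => aestronglyMeasurable_waveSynthesis_integrand hg p.1 p.2)
    (fun p => .of_forall fun ξ => norm_waveSynthesis_integrand_le g p.1 p.2 ξ) hg.abs
    (.of_forall fun ξ => ?_)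
  have := continuous_wavePhase_left ξ
  fun_prop

theorem norm_waveSynthesis_le {n : ℕ} {g : E n → ℝ} (hg : Integrable g) (t : ℝ) (x : E n) :
    ‖waveSynthesis n g t x‖ ≤ ∫ ξ, |g ξ| :=
  norm_integral_le_of_norm_le hg.abs
    (.of_forall fun ξ => norm_waveSynthesis_integrand_le g t x ξ)

theorem waveSynthesis_sub {n : ℕ} {g h : E n → ℝ} (hg : Integrable g) (hh : Integrable h)
    (t : ℝ) (x : E n) :
    waveSynthesis n g t x - waveSynthesis n h t x = waveSynthesis n (fun ξ => g ξ - h ξ) t x := by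
  unfold waveSynthesis
  rw [← integral_sub (integrable_waveSynthesis_integrand hg t x)
    (integrable_waveSynthesis_integrand hh t x)]
  refine integral_congr_ae (.of_forall fun ξ => ?_)
  simp only
  push_cast; ring

theorem re_waveSynthesis {n : ℕ} {g : E n → ℝ} (hg : Integrable g) (t : ℝ) (x : E n) :
    (waveSynthesis n g t x).re = ∫ ξ, wavePhase n t ξ * Real.cos (2 * π * ⟪x, ξ⟫) * g ξ := by
  unfold waveSynthesis
  have := integral_re (integrable_waveSynthesis_integrand hg t x)
  simp only [RCLike.re_eq_complex_re] at this
  rw [← this]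
  refine integral_congr_ae (.of_forall fun ξ => ?_)
  simp only
  rw [Complex.re_mul_ofReal, Complex.re_ofReal_mul, Complex.exp_ofReal_mul_I_re]

theorem abs_waveKernel_integrand_le {n : ℕ} (ε t : ℝ) (x ξ : E n) :
    ‖waveWeight n ε ξ * wavePhase n t ξ * Real.cos (2 * π * ⟪x, ξ⟫)‖ ≤ waveWeight n ε ξ := by
  rw [norm_mul, norm_mul, Real.norm_of_nonneg (waveWeight_nonneg ξ), mul_assoc]
  refine mul_le_of_le_one_right (waveWeight_nonneg ξ) ?_
  exact mul_le_one₀ (abs_wavePhase_le t ξ) (norm_nonneg _) (Real.abs_cos_le_one _)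

theorem continuous_waveKernel {n : ℕ} (hn : 2 ≤ n) {ε : ℝ} (hε : 0 < ε) :
    Continuous fun p : ℝ × E n => waveKernel n ε p.1 p.2 := by
  unfold waveKernel
  refine continuous_of_dominated (bound := waveWeight n ε) (fun p => ?_)
    (fun p => .of_forall fun ξ => abs_waveKernel_integrand_le ε p.1 p.2 ξ)
    (integrable_waveWeight hn hε) (.of_forall fun ξ => ?_)
  · have := continuous_wavePhase_right (n := n) p.1
    exact (measurable_waveWeight.aestronglyMeasurable.mul this.aestronglyMeasurable).mul
      (Continuous.aestronglyMeasurable (by fun_prop))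
  · have := continuous_wavePhase_left ξ
    fun_prop

theorem abs_waveKernel_le {n : ℕ} (hn : 2 ≤ n) {ε : ℝ} (hε : 0 < ε) (t : ℝ) (x : E n) :
    |waveKernel n ε t x| ≤ ∫ ξ, waveWeight n ε ξ :=
  norm_integral_le_of_norm_le (integrable_waveWeight hn hε)
    (.of_forall fun ξ => abs_waveKernel_integrand_le ε t x ξ)

theorem integral_sin_eq_zero_of_even {n : ℕ} {μ : Measure (E n)}
    (hμ : μ.map (fun x => -x) = μ) (ξ : E n) : ∫ y, Real.sin (2 * π * ⟪y, ξ⟫) ∂μ = 0 := by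
  have h : ∫ y, Real.sin (2 * π * ⟪y, ξ⟫) ∂μ = -∫ y, Real.sin (2 * π * ⟪y, ξ⟫) ∂μ := by
    conv_lhs => rw [← hμ]
    rw [integral_map (by fun_prop) (Continuous.aestronglyMeasurable (by fun_prop)),
      ← integral_neg]
    refine integral_congr_ae (.of_forall fun y => ?_)
    simp only [inner_neg_left, mul_neg, Real.sin_neg]
  linarith

theorem integrable_waveWeight_mul_cosTransform {n : ℕ} (hn : 2 ≤ n) {ε : ℝ} (hε : 0 < ε)
    (μ : Measure (E n)) [IsFiniteMeasure μ] :
    Integrable (fun ξ => waveWeight n ε ξ * cosTransform μ ξ) := by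
  refine ((integrable_waveWeight hn hε).mul_const (μ.real Set.univ)).mono'
    (measurable_waveWeight.aestronglyMeasurable.mul
      (continuous_cosTransform μ).aestronglyMeasurable) (.of_forall fun ξ => ?_)
  rw [norm_mul, Real.norm_of_nonneg (waveWeight_nonneg ξ)]
  exact mul_le_mul_of_nonneg_left (abs_cosTransform_le μ ξ) (waveWeight_nonneg ξ)

/-- For an even measure, the wave with datum `waveWeight * cosTransform μ`, tested against `μ`,
is the average of the kernel over pairs of points. -/
theorem integral_re_waveSynthesis_eq {n : ℕ} (hn : 2 ≤ n) {ε : ℝ} (hε : 0 < ε)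
    (μ : Measure (E n)) [IsFiniteMeasure μ] (hμ : μ.map (fun x => -x) = μ) (t : ℝ) :
    ∫ x, (waveSynthesis n (fun ξ => waveWeight n ε ξ * cosTransform μ ξ) t x).re ∂μ =
      ∫ p : E n × E n, waveKernel n ε t (p.1 - p.2) ∂(μ.prod μ) := by
  have hg := integrable_waveWeight_mul_cosTransform hn hε μ
  have hph := continuous_wavePhase_right (n := n) t
  have h1 : ∫ x, (waveSynthesis n (fun ξ => waveWeight n ε ξ * cosTransform μ ξ) t x).re ∂μ =
      ∫ ξ, waveWeight n ε ξ * wavePhase n t ξ * cosTransform μ ξ ^ 2 := by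
    simp only [re_waveSynthesis hg]
    rw [integral_integral_swap]
    · refine integral_congr_ae (.of_forall fun ξ => ?_)
      simp only
      have : ∀ x : E n, wavePhase n t ξ * Real.cos (2 * π * ⟪x, ξ⟫) *
          (waveWeight n ε ξ * cosTransform μ ξ) =
          (waveWeight n ε ξ * wavePhase n t ξ * cosTransform μ ξ) *
            Real.cos (2 * π * ⟪x, ξ⟫) := fun x => by ring
      simp only [this]
      rw [integral_const_mul, ← cosTransform]
      ring
    · refine (hg.abs.comp_snd μ).mono' ?_ (.of_forall fun p => ?_)
      · refine AEStronglyMeasurable.mul (Continuous.aestronglyMeasurable (by fun_prop)) ?_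
        exact hg.1.comp_snd
      · simp only [Function.uncurry, norm_mul, Real.norm_eq_abs, abs_mul]
        refine mul_le_of_le_one_left (by positivity) ?_
        exact mul_le_one₀ (abs_wavePhase_le t _) (abs_nonneg _) (Real.abs_cos_le_one _)
  have h2 : ∫ p : E n × E n, waveKernel n ε t (p.1 - p.2) ∂(μ.prod μ) =
      ∫ ξ, waveWeight n ε ξ * wavePhase n t ξ * cosTransform μ ξ ^ 2 := by
    unfold waveKernel
    rw [integral_integral_swap]
    · refine integral_congr_ae (.of_forall fun ξ => ?_)
      simp only
      rw [integral_const_mul, integral_prod_cos_sub, integral_sin_eq_zero_of_even hμ]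
      ring
    · refine ((integrable_waveWeight hn hε).comp_snd (μ.prod μ)).mono' ?_
        (.of_forall fun p => abs_waveKernel_integrand_le ε t _ _)
      refine AEStronglyMeasurable.mul (AEStronglyMeasurable.mul ?_ ?_)
        (Continuous.aestronglyMeasurable (by fun_prop))
      · exact (measurable_waveWeight.comp measurable_snd).aestronglyMeasurable
      · exact (hph.comp continuous_snd).aestronglyMeasurable
  rw [h1, h2]

theorem setIntegral_integral_le_rpow_mul {n : ℕ} {F : ℝ × E n → ℝ} (hF : Continuous F)
    (hF0 : ∀ z, 0 ≤ F z) {B : ℝ} (hB : ∀ z, F z ≤ B) {μ : Measure (E n)} [IsFiniteMeasure μ]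
    {S : Set ℝ} (hS1 : S ⊆ Set.Ioc 0 1) {p : ℝ} (hp : 1 < p) :
    ∫ t in S, ∫ x, F (t, x) ∂μ ≤
      (∫ t in (0 : ℝ)..1, ∫ x, F (t, x) ^ p ∂μ) ^ (1 / p) *
        (volume.real S * μ.real Set.univ) ^ (1 - 1 / p) := by
  have hp0 : 0 < p := by linarith
  have hB0 : 0 ≤ B := (hF0 0).trans (hB 0)
  have hSfin : volume S ≠ ⊤ :=
    ((measure_mono hS1).trans_lt (by simp)).ne
  have : IsFiniteMeasure (volume.restrict S) := ⟨by simpa using hSfin.lt_top⟩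
  have hpq : p.HolderConjugate (Real.conjExponent p) := Real.HolderConjugate.conjExponent hp
  have hFp : Continuous fun z => F z ^ p := hF.rpow_const fun z => Or.inr hp0.le
  have hFpB : ∀ z, ‖F z ^ p‖ ≤ B ^ p := fun z => by
    rw [Real.norm_of_nonneg (Real.rpow_nonneg (hF0 z) p)]
    exact Real.rpow_le_rpow (hF0 z) (hB z) hp0.le
  have hFB : ∀ z, ‖F z‖ ≤ B := fun z => by rw [Real.norm_of_nonneg (hF0 z)]; exact hB z
  have hint1 : Integrable F ((volume.restrict S).prod μ) :=
    (integrable_const B).mono' hF.aestronglyMeasurable (.of_forall hFB)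
  have hintp : ∀ ν : Measure ℝ, IsFiniteMeasure ν →
      Integrable (fun z => F z ^ p) (ν.prod μ) := fun ν _ =>
    (integrable_const (B ^ p)).mono' hFp.aestronglyMeasurable (.of_forall hFpB)
  have hH := integral_mul_le_Lp_mul_Lq_of_nonneg (μ := (volume.restrict S).prod μ) hpq
    (f := F) (g := fun _ => 1) (.of_forall hF0) (.of_forall fun _ => zero_le_one)
    (MemLp.of_bound hF.aestronglyMeasurable B (.of_forall hFB)) (memLp_const 1)
  simp only [mul_one, Real.one_rpow, integral_const, smul_eq_mul] at hH
  rw [integral_prod _ hint1, integral_prod _ (hintp _ inferInstance)] at hH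
  have hle : ∫ t in S, ∫ x, F (t, x) ^ p ∂μ ≤ ∫ t in (0 : ℝ)..1, ∫ x, F (t, x) ^ p ∂μ := by
    rw [intervalIntegral.integral_of_le zero_le_one]
    refine setIntegral_mono_set ?_ ?_ hS1.eventuallyLE
    · exact (hintp (volume.restrict (Set.Ioc 0 1)) inferInstance).integral_prod_left
    · exact .of_forall fun t => integral_nonneg fun x => Real.rpow_nonneg (hF0 _) _
  have hreal : ((volume.restrict S).prod μ).real Set.univ = volume.real S * μ.real Set.univ := by
    rw [← Set.univ_prod_univ, measureReal_prod_prod]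
    simp
  have hexp : 1 / Real.conjExponent p = 1 - 1 / p := by
    have := hpq.inv_add_inv_eq_one
    simp only [one_div]; linarith
  rw [hreal, hexp] at hH
  refine hH.trans ?_
  gcongr
  exact integral_nonneg fun t => integral_nonneg fun x => Real.rpow_nonneg (hF0 _) _

theorem integral_waveKernel_le {n : ℕ} (hn : 2 ≤ n) {ε : ℝ} (hε : 0 < ε)
    {μ : Measure (E n)} [IsFiniteMeasure μ] (hμ : μ.map (fun x => -x) = μ)
    {S : Set ℝ} (hS1 : S ⊆ Set.Ioc 0 1) {h : E n → ℝ} (hh : Integrable h) {κ : ℝ}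
    (hκ : ∫ ξ, |h ξ - waveWeight n ε ξ * cosTransform μ ξ| ≤ κ) :
    ∫ z : ℝ × (E n × E n), waveKernel n ε z.1 (z.2.1 - z.2.2)
        ∂((volume.restrict S).prod (μ.prod μ)) ≤
      (∫ t in S, ∫ x, ‖waveSynthesis n h t x‖ ∂μ) + κ * μ.real Set.univ := by
  have hSfin : volume S ≠ ⊤ :=
    ((measure_mono hS1).trans_lt (by simp)).ne
  have : IsFiniteMeasure (volume.restrict S) := ⟨by simpa using hSfin.lt_top⟩
  have hSle : volume.real S ≤ 1 := by
    refine (measureReal_mono hS1 (by simp)).trans ?_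
    simp
  have hκ0 : 0 ≤ κ := (integral_nonneg fun ξ => abs_nonneg _).trans hκ
  set g : E n → ℝ := fun ξ => waveWeight n ε ξ * cosTransform μ ξ with hgdef
  have hg : Integrable g := integrable_waveWeight_mul_cosTransform hn hε μ
  have hKint : Integrable (fun z : ℝ × (E n × E n) => waveKernel n ε z.1 (z.2.1 - z.2.2))
      ((volume.restrict S).prod (μ.prod μ)) := by
    refine (integrable_const (∫ ξ, waveWeight n ε ξ)).mono' ?_
      (.of_forall fun z => abs_waveKernel_le hn hε _ _)
    have := (continuous_waveKernel hn hε).comp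
      (f := fun z : ℝ × (E n × E n) => (z.1, z.2.1 - z.2.2)) (by fun_prop)
    exact this.aestronglyMeasurable
  have hint : ∀ k : E n → ℝ, Integrable k → Integrable (fun z : ℝ × E n =>
      ‖waveSynthesis n k z.1 z.2‖) ((volume.restrict S).prod μ) := fun k hk =>
    (integrable_const (∫ ξ, |k ξ|)).mono' (continuous_waveSynthesis hk).norm.aestronglyMeasurable
      (.of_forall fun z => by rw [norm_norm]; exact norm_waveSynthesis_le hk _ _)
  have hpt : ∀ t x, (waveSynthesis n g t x).re ≤ ‖waveSynthesis n h t x‖ + κ := fun t x => by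
    have h1 := norm_sub_norm_le (waveSynthesis n g t x) (waveSynthesis n h t x)
    rw [norm_sub_rev, waveSynthesis_sub hh hg] at h1
    have h2 := (norm_waveSynthesis_le (hh.sub hg) t x).trans hκ
    have h3 := Complex.re_le_norm (waveSynthesis n g t x)
    simp only [Pi.sub_def] at h2
    linarith
  have hre : Integrable (fun z : ℝ × E n => (waveSynthesis n g z.1 z.2).re)
      ((volume.restrict S).prod μ) :=
    (hint g hg).mono' (Complex.continuous_re.comp
      (continuous_waveSynthesis hg)).aestronglyMeasurable
      (.of_forall fun z => Complex.abs_re_le_norm _)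
  calc _ = ∫ t in S, ∫ x, (waveSynthesis n g t x).re ∂μ := by
        rw [integral_prod _ hKint]
        simp only [hgdef, integral_re_waveSynthesis_eq hn hε μ hμ]
    _ = ∫ z : ℝ × E n, (waveSynthesis n g z.1 z.2).re ∂((volume.restrict S).prod μ) :=
        (integral_prod _ hre).symm
    _ ≤ ∫ z : ℝ × E n, (‖waveSynthesis n h z.1 z.2‖ + κ) ∂((volume.restrict S).prod μ) :=
        integral_mono hre ((hint h hh).add (integrable_const κ)) fun z => hpt z.1 z.2
    _ = (∫ t in S, ∫ x, ‖waveSynthesis n h t x‖ ∂μ) +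
        κ * (volume.real S * μ.real Set.univ) := by
        rw [integral_add (hint h hh) (integrable_const κ), integral_prod _ (hint h hh),
          integral_const, smul_eq_mul, ← Set.univ_prod_univ, measureReal_prod_prod]
        simp only [measureReal_restrict_apply_univ]
        ring
    _ ≤ _ := by
        gcongr
        exact mul_le_of_le_one_left measureReal_nonneg hSle

theorem integral_indicator_abs_rpow {σ η : ℝ} (hσ : 0 < σ) (hη : 0 < η) :
    Integrable (fun u : ℝ => (Set.Ioc 0 η).indicator (fun v => v ^ (σ - 1)) |u|) ∧
      ∫ u : ℝ, (Set.Ioc 0 η).indicator (fun v => v ^ (σ - 1)) |u| = 2 * (η ^ σ / σ) := by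
  have h : ∫ u : ℝ, (Set.Ioc 0 η).indicator (fun v => v ^ (σ - 1)) |u| = 2 * (η ^ σ / σ) := by
    rw [integral_comp_abs (f := (Set.Ioc 0 η).indicator (fun v => v ^ (σ - 1))),
      setIntegral_indicator measurableSet_Ioc,
      Set.inter_eq_right.2 fun _ hx => Set.mem_Ioi.2 hx.1,
      ← intervalIntegral.integral_of_le hη.le, integral_rpow (Or.inl (by linarith))]
    simp [hσ.ne']
  exact ⟨Integrable.of_integral_ne_zero (by rw [h]; positivity), h⟩

theorem setIntegral_abs_sub_rpow_le {σ η : ℝ} (hσ0 : 0 < σ) (hσ1 : σ < 1) (hη : 0 < η)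
    {S : Set ℝ} (hSfin : volume S ≠ ⊤) (hSη : volume.real S ≤ η) (r : ℝ) :
    IntegrableOn (fun t => |t - r| ^ (σ - 1)) S ∧
      ∫ t in S, |t - r| ^ (σ - 1) ≤ (2 / σ + 1) * η ^ σ := by
  obtain ⟨hi, hv⟩ := integral_indicator_abs_rpow hσ0 hη
  have hi' := hi.comp_sub_right r
  have hv' : ∫ t : ℝ, (Set.Ioc 0 η).indicator (fun v => v ^ (σ - 1)) |t - r| =
      2 * (η ^ σ / σ) := by
    rw [integral_sub_right_eq_self
      (fun u : ℝ => (Set.Ioc 0 η).indicator (fun v => v ^ (σ - 1)) |u|) r, hv]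
  have hnn : ∀ u : ℝ, 0 ≤ (Set.Ioc 0 η).indicator (fun v => v ^ (σ - 1)) |u| := fun u =>
    Set.indicator_nonneg (fun v hv => Real.rpow_nonneg hv.1.le _) _
  have hpt : ∀ t : ℝ, |t - r| ^ (σ - 1) ≤
      (Set.Ioc 0 η).indicator (fun v => v ^ (σ - 1)) |t - r| + η ^ (σ - 1) := fun t => by
    by_cases hmem : |t - r| ∈ Set.Ioc 0 η
    · rw [Set.indicator_of_mem hmem]
      have : 0 ≤ η ^ (σ - 1) := by positivity
      linarith
    · rw [Set.indicator_of_notMem hmem, zero_add]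
      rcases (abs_nonneg (t - r)).eq_or_lt with h0 | h0
      · rw [← h0, Real.zero_rpow (by linarith)]; positivity
      · have : η < |t - r| := by
          by_contra hle
          exact hmem ⟨h0, not_lt.1 hle⟩
        exact Real.rpow_le_rpow_of_nonpos hη this.le (by linarith)
  have hconst : IntegrableOn (fun _ : ℝ => η ^ (σ - 1)) S := integrableOn_const hSfin
  have hsum := (hi'.integrableOn (s := S)).add hconst
  have hint : IntegrableOn (fun t => |t - r| ^ (σ - 1)) S := by
    refine hsum.mono' (Measurable.aestronglyMeasurable (by fun_prop)) (.of_forall fun t => ?_)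
    rw [Real.norm_of_nonneg (by positivity)]
    exact hpt t
  refine ⟨hint, ?_⟩
  calc _ ≤ ∫ t in S, ((Set.Ioc 0 η).indicator (fun v => v ^ (σ - 1)) |t - r| + η ^ (σ - 1)) :=
        integral_mono hint hsum hpt
    _ = (∫ t in S, (Set.Ioc 0 η).indicator (fun v => v ^ (σ - 1)) |t - r|) +
        volume.real S * η ^ (σ - 1) := by
        rw [integral_add hi'.integrableOn hconst, setIntegral_const, smul_eq_mul]
    _ ≤ 2 * (η ^ σ / σ) + η * η ^ (σ - 1) := by
        gcongr
        rw [← hv']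
        exact setIntegral_le_integral hi' (.of_forall fun t => hnn _)
    _ = _ := by
        rw [Real.rpow_sub_one hη.ne']
        field_simp

theorem le_setIntegral_waveKernel {n : ℕ} (hn : 2 ≤ n) {σ R : ℝ} (hσ0 : 0 < σ) (hσ1 : σ < 1)
    (hR : 0 < R) :
    ∃ A c : ℝ, 0 < A ∧ 0 < c ∧ ∀ x : E n, 0 < ‖x‖ → ‖x‖ ≤ R → ∀ ε η : ℝ, 0 < ε → 0 < η →
      ∀ S : Set ℝ, S ⊆ Set.Ioc 0 1 → MeasurableSet S → volume.real S ≤ η →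
      (‖x‖ < 1 / 2 → Set.Ioo ‖x‖ (‖x‖ + ε) ⊆ S) →
      {y : E n | ‖y‖ < 1 / 2}.indicator (fun _ => c) x -
        A * η ^ σ * ‖x‖ ^ (-(((n : ℝ) - 1) / 2 + σ)) ≤ ∫ t in S, waveKernel n ε t x := by
  have hn' : (2 : ℝ) ≤ n := by exact_mod_cast hn
  obtain ⟨C, c, hC, hc, hest⟩ := waveKernel_asymptotic hn hσ0 hσ1 hR
  refine ⟨C * (2 / σ + 1), c / 2, by positivity, by positivity, ?_⟩
  intro x hx hxR ε η hε hη S hS1 hSm hSη hxS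
  set r := ‖x‖ with hr
  set a := ((n : ℝ) - 1) / 2 with ha
  have ha0 : 0 < a := by rw [ha]; linarith
  have hSfin : volume S ≠ ⊤ := ((measure_mono hS1).trans_lt (by simp)).ne
  obtain ⟨hRi, hRle⟩ := setIntegral_abs_sub_rpow_le hσ0 hσ1 hη hSfin hSη r
  have hK : IntegrableOn (fun t => waveKernel n ε t x) S := by
    have := (continuous_waveKernel hn hε).comp (f := fun t : ℝ => (t, x)) (by fun_prop)
    refine (integrableOn_const (C := ∫ ξ, waveWeight n ε ξ) hSfin).mono'
      this.aestronglyMeasurable (.of_forall fun t => abs_waveKernel_le hn hε _ _)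
  have hsumi := hK.add (hRi.const_mul (C * r ^ (-a - σ)))
  have hne : ∀ᵐ t ∂(volume.restrict S), t ≠ r :=
    ae_restrict_of_ae (by simp [ae_iff])
  have hmain : ∀ᵐ t ∂(volume.restrict S), c * (r ^ (-a) * (ε / (ε ^ 2 + (t - r) ^ 2))) ≤
      waveKernel n ε t x + C * r ^ (-a - σ) * |t - r| ^ (σ - 1) := by
    filter_upwards [hne, ae_restrict_mem hSm] with t ht htS
    have := (abs_le.1 (hest x hx hxR t ε (hS1 htS).1 hε ht)).1
    linarith
  have hlow : {y : E n | ‖y‖ < 1 / 2}.indicator (fun _ => c / 2) x ≤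
      ∫ t in S, (waveKernel n ε t x + C * r ^ (-a - σ) * |t - r| ^ (σ - 1)) := by
    by_cases hx2 : r < 1 / 2
    · rw [Set.indicator_of_mem (Set.mem_ofPred_eq ▸ hx2)]
      have hsub := hxS hx2
      have hra : 1 ≤ r ^ (-a) :=
        Real.one_le_rpow_of_pos_of_le_one_of_nonpos hx (by linarith) (by linarith)
      have hind : IntegrableOn ((Set.Ioo r (r + ε)).indicator fun _ => c / (2 * ε)) S :=
        (integrableOn_const hSfin).indicator measurableSet_Ioo
      have hval : ∫ t in S, (Set.Ioo r (r + ε)).indicator (fun _ => c / (2 * ε)) t = c / 2 := by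
        rw [setIntegral_indicator measurableSet_Ioo, Set.inter_eq_right.2 hsub,
          setIntegral_const, Real.volume_real_Ioo_of_le (by linarith), smul_eq_mul]
        field_simp
        ring
      rw [← hval]
      refine integral_mono_ae hind hsumi ?_
      filter_upwards [hmain] with t ht
      refine le_trans ?_ ht
      by_cases htm : t ∈ Set.Ioo r (r + ε)
      · rw [Set.indicator_of_mem htm]
        have h1 : (t - r) ^ 2 ≤ ε ^ 2 :=
          pow_le_pow_left₀ (by linarith [htm.1]) (by linarith [htm.2]) 2
        have h2 : 1 / (2 * ε) ≤ ε / (ε ^ 2 + (t - r) ^ 2) := by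
          rw [div_le_div_iff₀ (by positivity) (by positivity)]
          nlinarith
        calc c / (2 * ε) = c * (1 * (1 / (2 * ε))) := by ring
          _ ≤ _ := by gcongr
      · rw [Set.indicator_of_notMem htm]; positivity
    · rw [Set.indicator_of_notMem (Set.mem_ofPred_eq ▸ hx2)]
      refine integral_nonneg_of_ae ?_
      filter_upwards [hmain] with t ht
      exact le_trans (by positivity) ht
  rw [integral_add hK (hRi.const_mul _), integral_const_mul] at hlow
  have h3 : C * r ^ (-a - σ) * ∫ t in S, |t - r| ^ (σ - 1) ≤
      C * r ^ (-a - σ) * ((2 / σ + 1) * η ^ σ) := by gcongr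
  rw [show -(a + σ) = -a - σ by ring]
  linarith

theorem le_integral_waveKernel {n : ℕ} (hn : 2 ≤ n) {σ R : ℝ} (hσ0 : 0 < σ) (hσ1 : σ < 1)
    (hR : 0 < R) :
    ∃ A c : ℝ, 0 < A ∧ 0 < c ∧ ∀ μ : Measure (E n), IsFiniteMeasure μ →
      Integrable (fun p : E n × E n => ‖p.1 - p.2‖ ^ (-(((n : ℝ) - 1) / 2 + σ))) (μ.prod μ) →
      (∀ᵐ p : E n × E n ∂(μ.prod μ), p.1 ≠ p.2) →
      (∀ᵐ p : E n × E n ∂(μ.prod μ), ‖p.1 - p.2‖ ≤ R) →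
      ∀ ε η : ℝ, 0 < ε → 0 < η →
      ∀ S : Set ℝ, S ⊆ Set.Ioc 0 1 → MeasurableSet S → volume.real S ≤ η →
      (∀ᵐ p : E n × E n ∂(μ.prod μ), ‖p.1 - p.2‖ < 1 / 2 →
        Set.Ioo ‖p.1 - p.2‖ (‖p.1 - p.2‖ + ε) ⊆ S) →
      c * (μ.prod μ).real {p | ‖p.1 - p.2‖ < 1 / 2} -
          A * η ^ σ * ∫ p, ‖p.1 - p.2‖ ^ (-(((n : ℝ) - 1) / 2 + σ)) ∂(μ.prod μ) ≤
        ∫ z : ℝ × (E n × E n), waveKernel n ε z.1 (z.2.1 - z.2.2)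
          ∂((volume.restrict S).prod (μ.prod μ)) := by
  obtain ⟨A, c, hA, hc, hest⟩ := le_setIntegral_waveKernel hn hσ0 hσ1 hR
  refine ⟨A, c, hA, hc, ?_⟩
  intro μ _ hI hne hR ε η hε hη S hS1 hSm hSη hS
  have hSfin : volume S ≠ ⊤ := ((measure_mono hS1).trans_lt (by simp)).ne
  have : IsFiniteMeasure (volume.restrict S) := ⟨by simpa using hSfin.lt_top⟩
  have hKint : Integrable (fun z : ℝ × (E n × E n) => waveKernel n ε z.1 (z.2.1 - z.2.2))
      ((volume.restrict S).prod (μ.prod μ)) := by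
    refine (integrable_const (∫ ξ, waveWeight n ε ξ)).mono' ?_
      (.of_forall fun z => abs_waveKernel_le hn hε _ _)
    have := (continuous_waveKernel hn hε).comp
      (f := fun z : ℝ × (E n × E n) => (z.1, z.2.1 - z.2.2)) (by fun_prop)
    exact this.aestronglyMeasurable
  have hmeas : MeasurableSet {p : E n × E n | ‖p.1 - p.2‖ < 1 / 2} :=
    (isOpen_lt (by fun_prop) (by fun_prop)).measurableSet
  have hind : Integrable ({p : E n × E n | ‖p.1 - p.2‖ < 1 / 2}.indicator fun _ => c)
      (μ.prod μ) := (integrable_const c).indicator hmeas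
  rw [integral_prod_symm _ hKint]
  calc _ = ∫ p : E n × E n, ({p : E n × E n | ‖p.1 - p.2‖ < 1 / 2}.indicator (fun _ => c) p -
        A * η ^ σ * ‖p.1 - p.2‖ ^ (-(((n : ℝ) - 1) / 2 + σ))) ∂(μ.prod μ) := by
        rw [integral_sub hind (hI.const_mul _), integral_const_mul, integral_indicator hmeas,
          setIntegral_const, smul_eq_mul]
        ring
    _ ≤ _ := by
        refine integral_mono_ae (hind.sub (hI.const_mul _)) hKint.integral_prod_right ?_
        filter_upwards [hne, hR, hS] with p h1 h2 h3
        exact hest (p.1 - p.2) (norm_pos_iff.2 (sub_ne_zero.2 h1)) h2 ε η hε hη S hS1 hSm hSη h3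

theorem frostman_lt_top_of_measure_ball_le {n : ℕ} {α s C : ℝ} (hα : 0 ≤ α) (hαs : α ≤ s)
    (hC : 0 ≤ C)
    {μ : Measure (E n)} [IsFiniteMeasure μ]
    (hμ : ∀ x r, 0 < r → μ (ball x r) ≤ ENNReal.ofReal (C * r ^ s)) : frostman μ α < ⊤ := by
  refine lt_of_le_of_lt (b := ENNReal.ofReal C + μ Set.univ) ?_
    (ENNReal.add_lt_top.2 ⟨ENNReal.ofReal_lt_top, measure_lt_top _ _⟩)
  refine iSup_le fun x => iSup_le fun r => iSup_le fun hr => ?_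
  have hra : 0 < r ^ α := Real.rpow_pos_of_pos hr α
  refine ENNReal.div_le_of_le_mul ?_
  rcases le_total r 1 with h1 | h1
  · calc μ (ball x r) ≤ ENNReal.ofReal (C * r ^ s) := hμ x r hr
      _ ≤ ENNReal.ofReal (C * r ^ α) := ENNReal.ofReal_le_ofReal <|
          mul_le_mul_of_nonneg_left (Real.rpow_le_rpow_of_exponent_ge hr h1 hαs) hC
      _ = ENNReal.ofReal C * ENNReal.ofReal (r ^ α) := ENNReal.ofReal_mul hC
      _ ≤ _ := by gcongr; exact le_self_add
  · calc μ (ball x r) ≤ μ Set.univ * 1 := by rw [mul_one]; exact measure_mono (Set.subset_univ _)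
      _ ≤ (ENNReal.ofReal C + μ Set.univ) * ENNReal.ofReal (r ^ α) := by
          gcongr
          · exact le_add_self
          · exact ENNReal.one_le_ofReal.2 (Real.one_le_rpow h1 hα)

/-- A compact set of large dimension carries, after translation and symmetrisation, an even
Frostman measure for which nearby pairs of points are separated by distances of the set. -/
theorem exists_even_frostman_measure {n : ℕ} (hn : n ≠ 0) {α : ℝ} (hα : 0 ≤ α) {K : Set (E n)}
    (hK : IsCompact K) (hdim : ENNReal.ofReal α < dimH K) :
    ∃ s : ℝ, α < s ∧ ∃ C : ℝ, 0 < C ∧ ∃ μ : Measure (E n), IsFiniteMeasure μ ∧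
      μ.map (fun x => -x) = μ ∧ μ (ball (0 : E n) 4)ᶜ = 0 ∧
      (∀ x r, 0 < r → μ (ball x r) ≤ ENNReal.ofReal (C * r ^ s)) ∧
      0 < (μ.prod μ).real {p | ‖p.1 - p.2‖ < 1 / 2} ∧
      ∀ᵐ p : E n × E n ∂(μ.prod μ), ‖p.1 - p.2‖ < 1 / 2 →
        ∃ x ∈ K, ∃ y ∈ K, ‖p.1 - p.2‖ = dist x y := by
  obtain ⟨d, hd1, hd2⟩ := ENNReal.lt_iff_exists_nnreal_btwn.1 hdim
  have hαd : α < d := by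
    rw [← ENNReal.ofReal_coe_nnreal] at hd1
    exact (ENNReal.ofReal_lt_ofReal_iff_of_nonneg hα).1 hd1
  have hd0 : (0 : ℝ) < d := hα.trans_lt hαd
  obtain ⟨ν, hνfin, hνK, hν0, hνball⟩ := exists_frostman_measure hK hd0
    (by rw [hausdorffMeasure_of_lt_dimH hd2]; simp)
  obtain ⟨x₀, -, hx₀⟩ := exists_mem_forall_mem_nhdsWithin_pos_measure (μ := ν)
    (s := Set.univ) (by simpa using hν0)
  have hpos : 0 < ν (ball x₀ (1 / 4)) :=
    hx₀ _ (by rw [nhdsWithin_univ]; exact ball_mem_nhds _ (by norm_num))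
  obtain ⟨a, ha⟩ : ∃ a : E n, ‖a‖ = 2 := by
    refine ⟨EuclideanSpace.single ⟨0, Nat.pos_of_ne_zero hn⟩ 2, ?_⟩
    simp
  let f : E n → E n := fun y => y - x₀ + a
  have hf : Measurable f := by fun_prop
  have hneg : Measurable (fun x : E n => -x) := measurable_neg
  let ν' : Measure (E n) := (ν.restrict (ball x₀ (1 / 4))).map f
  have hν'fin : IsFiniteMeasure ν' := inferInstance
  let μ : Measure (E n) := ν' + ν'.map (fun x => -x)
  have hfball : ∀ x r, f ⁻¹' ball x r = ball (x - a + x₀) r := fun x r => by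
    ext y
    simp only [f, Set.mem_preimage, mem_ball, dist_eq_norm]
    rw [show y - x₀ + a - x = y - (x - a + x₀) by abel]
  have hnball : ∀ (x : E n) r, (fun x : E n => -x) ⁻¹' ball x r = ball (-x) r := fun x r => by
    ext y
    simp only [Set.mem_preimage, mem_ball, dist_eq_norm]
    rw [← norm_neg, show -(-y - x) = y - -x by abel]
  have hν'ball : ∀ x r, 0 < r → ν' (ball x r) ≤ ENNReal.ofReal ((2 * r) ^ (d : ℝ)) :=
    fun x r hr => by
    rw [Measure.map_apply hf measurableSet_ball, hfball]
    exact (Measure.restrict_le_self _).trans (hνball _ r hr)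
  have hμball : ∀ x r, 0 < r → μ (ball x r) ≤ ENNReal.ofReal (2 * 2 ^ (d : ℝ) * r ^ (d : ℝ)) :=
    fun x r hr => by
    have h2 : ENNReal.ofReal (2 * 2 ^ (d : ℝ) * r ^ (d : ℝ)) =
        ENNReal.ofReal ((2 * r) ^ (d : ℝ)) + ENNReal.ofReal ((2 * r) ^ (d : ℝ)) := by
      rw [← ENNReal.ofReal_add (by positivity) (by positivity),
        Real.mul_rpow (by norm_num) hr.le]
      congr 1; ring
    rw [Measure.add_apply, Measure.map_apply hneg measurableSet_ball, hnball, h2]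
    exact add_le_add (hν'ball x r hr) (hν'ball (-x) r hr)
  have heven : μ.map (fun x => -x) = μ := by
    have : ((fun x : E n => -x) ∘ fun x => -x) = id := by funext x; simp
    simp only [μ]
    rw [Measure.map_add _ _ hneg, Measure.map_map hneg hneg, this, Measure.map_id, add_comm]
  let T : Set (E n) := {z | ‖z - a‖ < 1 / 4 ∧ z - a + x₀ ∈ K}
  have hTm : MeasurableSet T := by
    have h1 : IsOpen {z : E n | ‖z - a‖ < 1 / 4} := isOpen_lt (by fun_prop) (by fun_prop)
    have h2 : IsClosed ((fun z : E n => z - a + x₀) ⁻¹' K) := hK.isClosed.preimage (by fun_prop)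
    exact h1.measurableSet.inter h2.measurableSet
  have hν'T : ∀ᵐ z ∂ν', z ∈ T := by
    refine (ae_map_iff hf.aemeasurable hTm).2 ?_
    have hνK' : ∀ᵐ y ∂(ν.restrict (ball x₀ (1 / 4))), y ∈ K := ae_restrict_of_ae hνK
    filter_upwards [hνK', ae_restrict_mem measurableSet_ball] with y hy hyb
    refine ⟨?_, ?_⟩
    · rw [mem_ball, dist_eq_norm] at hyb
      simpa [f] using hyb
    · simpa [f] using hy
  have hμT : ∀ᵐ z ∂μ, z ∈ T ∨ -z ∈ T := by
    refine ae_add_measure_iff.2 ⟨hν'T.mono fun z hz => Or.inl hz, ?_⟩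
    refine (ae_map_iff hneg.aemeasurable (hTm.union (hneg hTm))).2 ?_
    exact hν'T.mono fun z hz => Or.inr (by simpa using hz)
  have hTnorm : ∀ z ∈ T, ‖z‖ < 4 := fun z hz => by
    have := norm_add_le (z - a) a
    rw [sub_add_cancel, ha] at this
    linarith [hz.1]
  refine ⟨d, hαd, 2 * 2 ^ (d : ℝ), by positivity, μ, inferInstance, heven, ?_, hμball, ?_, ?_⟩
  · have : ∀ᵐ z ∂μ, z ∈ ball (0 : E n) 4 := by
      filter_upwards [hμT] with z hz
      rw [mem_ball_zero_iff]
      rcases hz with hz | hz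
      · exact hTnorm z hz
      · rw [← norm_neg]; exact hTnorm _ hz
    exact this
  · have hsub : ball a (1 / 4) ×ˢ ball a (1 / 4) ⊆ {p : E n × E n | ‖p.1 - p.2‖ < 1 / 2} := by
      rintro ⟨y, z⟩ ⟨hy, hz⟩
      have h := dist_triangle_right y z a
      rw [mem_ball] at hy hz
      simp only [Set.mem_ofPred_eq]
      rw [← dist_eq_norm]
      simp only at hy hz
      linarith
    refine lt_of_lt_of_le ?_ (measureReal_mono hsub)
    rw [measureReal_prod_prod]
    have : 0 < μ.real (ball a (1 / 4)) := by
      refine ENNReal.toReal_pos (ne_of_gt ?_) (measure_ne_top _ _)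
      refine lt_of_lt_of_le ?_ (Measure.le_add_right le_rfl _ : ν' _ ≤ μ _)
      rw [Measure.map_apply hf measurableSet_ball, hfball, sub_self, zero_add,
        Measure.restrict_apply_self]
      exact hpos
    positivity
  · filter_upwards [Measure.quasiMeasurePreserving_fst.ae hμT,
      Measure.quasiMeasurePreserving_snd.ae hμT] with p h1 h2 hp
    have hfar : ∀ y z : E n, y ∈ T → z ∈ T → ¬ ‖y + z‖ < 1 / 2 := fun y z hy hz hlt => by
      have h3 : ‖(2 : ℝ) • a‖ = 4 := by rw [norm_smul, ha]; norm_num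
      have h4 : (2 : ℝ) • a = (y + z) - ((y - a) + (z - a)) := by rw [two_smul]; abel
      have h5 := norm_sub_le (y + z) ((y - a) + (z - a))
      have h6 := norm_add_le (y - a) (z - a)
      rw [← h4, h3] at h5
      linarith [hy.1, hz.1]
    rcases h1 with h1 | h1 <;> rcases h2 with h2 | h2
    · refine ⟨_, h1.2, _, h2.2, ?_⟩
      rw [dist_eq_norm]; congr 1; abel
    · exact absurd hp (by rw [sub_eq_add_neg]; exact hfar _ _ h1 h2)
    · refine absurd hp ?_
      rw [← norm_neg, neg_sub, sub_eq_add_neg]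
      exact hfar _ _ h2 h1
    · refine ⟨_, h2.2, _, h1.2, ?_⟩
      rw [dist_eq_norm]; congr 1; abel

theorem continuous_waveWeight {n : ℕ} {ε : ℝ} : Continuous (waveWeight n ε) := by
  unfold waveWeight
  refine Continuous.mul (Continuous.rpow_const (by fun_prop) fun ξ => Or.inl ?_) (by fun_prop)
  positivity

theorem waveWeight_sq_le {n : ℕ} {ε : ℝ} (hn : 2 ≤ n) (hε : 0 < ε) (ξ : E n) :
    waveWeight n ε ξ ^ 2 ≤ (1 + ‖ξ‖ ^ 2) ^ (-(((n : ℝ) - 1) / 2)) := by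
  have hn' : (2 : ℝ) ≤ n := by exact_mod_cast hn
  have h1 : rexp (-(2 * π * ε * ‖ξ‖)) ≤ 1 := Real.exp_le_one_iff.2 (by
    have : 0 ≤ 2 * π * ε * ‖ξ‖ := by positivity
    linarith)
  have h2 : waveWeight n ε ξ ≤ (1 + ‖ξ‖) ^ (-(((n : ℝ) - 1) / 2)) :=
    mul_le_of_le_one_right (by positivity) h1
  calc waveWeight n ε ξ ^ 2 ≤ ((1 + ‖ξ‖) ^ (-(((n : ℝ) - 1) / 2))) ^ 2 :=
        pow_le_pow_left₀ (waveWeight_nonneg ξ) h2 2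
    _ = ((1 + ‖ξ‖) ^ 2) ^ (-(((n : ℝ) - 1) / 2)) := by
        rw [← Real.rpow_natCast, ← Real.rpow_mul (by positivity), mul_comm,
          Real.rpow_mul (by positivity), Real.rpow_natCast]
    _ ≤ _ := Real.rpow_le_rpow_of_nonpos (by positivity) (by nlinarith [norm_nonneg ξ])
        (by linarith)

/-- The Strichartz estimate bounds the wave kernel averaged over pairs of points and over a
small set of times. -/
theorem integral_waveKernel_le_of_strichartz {n : ℕ} (hn : 2 ≤ n) {α β p C : ℝ} (hp : 1 < p)
    (hC : 0 < C) {μ : Measure (E n)} [IsFiniteMeasure μ] (hμ : μ.map (fun x => -x) = μ)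
    (H : ∀ u₀ : SchwartzMap (E n) ℂ, (∀ x, (u₀ x).im = 0) → (∀ x, u₀ (-x) = u₀ x) →
      (∫ t in (0:ℝ)..1, ∫ x, ‖cosWave n (⇑u₀) t x‖ ^ p ∂μ) ^ (1/p) ≤
        C * (frostman μ α).toReal ^ (1/p) * sobolevNorm (⇑u₀) ((β - 1) / 2))
    (hJ : Integrable fun ξ : E n =>
      (1 + ‖ξ‖ ^ 2) ^ (-(((n : ℝ) - β) / 2)) * cosTransform μ ξ ^ 2)
    {ε η : ℝ} (hε : 0 < ε) (hη : 0 < η) (hη1 : η ≤ 1) {S : Set ℝ} (hS1 : S ⊆ Set.Ioc 0 1)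
    (hSη : volume.real S ≤ η) :
    ∫ z : ℝ × (E n × E n), waveKernel n ε z.1 (z.2.1 - z.2.2)
        ∂((volume.restrict S).prod (μ.prod μ)) ≤
      C * (frostman μ α).toReal ^ (1/p) *
        (2 * (∫ ξ : E n, (1 + ‖ξ‖ ^ 2) ^ (-(((n : ℝ) - β) / 2)) * cosTransform μ ξ ^ 2) + 1) ^
          (1/2 : ℝ) * (η * μ.real Set.univ) ^ (1 - 1 / p) + η * μ.real Set.univ := by
  set g : E n → ℝ := fun ξ => waveWeight n ε ξ * cosTransform μ ξ with hg
  have hgc : Continuous g := continuous_waveWeight.mul (continuous_cosTransform μ)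
  have hgA : ∀ ξ, |g ξ| ≤ μ.real Set.univ * rexp (-(2 * π * ε * ‖ξ‖)) := fun ξ => by
    rw [hg, abs_mul, abs_of_nonneg (waveWeight_nonneg ξ), mul_comm]
    refine mul_le_mul (abs_cosTransform_le μ ξ) ?_ (waveWeight_nonneg ξ) measureReal_nonneg
    rw [← neg_mul]
    exact waveWeight_le hn ξ
  have hge : ∀ ξ, g (-ξ) = g ξ := fun ξ => by
    simp only [hg, cosTransform_neg, waveWeight, norm_neg]
  obtain ⟨h, heven, hκ, hsob⟩ := exists_even_schwartz_approx hgc hge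
    (by positivity : 0 < 2 * π * ε) hgA ((β - 1) / 2) hη
  obtain ⟨u, hure, hueven, hFT⟩ := exists_schwartz_FT_eq h heven
  have hh : Integrable h := h.integrable
  have hgJ : ∫ ξ : E n, (1 + ‖ξ‖ ^ 2) ^ ((β - 1) / 2) * g ξ ^ 2 ≤
      ∫ ξ : E n, (1 + ‖ξ‖ ^ 2) ^ (-(((n : ℝ) - β) / 2)) * cosTransform μ ξ ^ 2 := by
    refine integral_mono_of_nonneg (.of_forall fun ξ => by positivity) hJ
      (.of_forall fun ξ => ?_)
    calc (1 + ‖ξ‖ ^ 2) ^ ((β - 1) / 2) * g ξ ^ 2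
        = (1 + ‖ξ‖ ^ 2) ^ ((β - 1) / 2) * waveWeight n ε ξ ^ 2 * cosTransform μ ξ ^ 2 := by
          rw [hg]; ring
      _ ≤ (1 + ‖ξ‖ ^ 2) ^ ((β - 1) / 2) * (1 + ‖ξ‖ ^ 2) ^ (-(((n : ℝ) - 1) / 2)) *
          cosTransform μ ξ ^ 2 := by gcongr; exact waveWeight_sq_le hn hε ξ
      _ = _ := by
          rw [← Real.rpow_add (by positivity)]
          congr 2; ring
  have hsobolev : sobolevNorm (⇑u) ((β - 1) / 2) ≤
      (2 * (∫ ξ : E n, (1 + ‖ξ‖ ^ 2) ^ (-(((n : ℝ) - β) / 2)) * cosTransform μ ξ ^ 2) + 1) ^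
          (1/2 : ℝ) := by
    unfold sobolevNorm
    refine Real.rpow_le_rpow (integral_nonneg fun ξ => by positivity) ?_ (by norm_num)
    have : ∀ ξ, ‖FT u ξ‖ ^ 2 = h ξ ^ 2 := fun ξ => by
      rw [hFT, Complex.norm_real, Real.norm_eq_abs, sq_abs]
    simp only [this]
    linarith
  have hstr := H u hure hueven
  simp only [cosWave_eq_waveSynthesis hFT] at hstr
  have hF : Continuous fun z : ℝ × E n => ‖waveSynthesis n h z.1 z.2‖ :=
    (continuous_waveSynthesis hh).norm
  have hhol := setIntegral_integral_le_rpow_mul (μ := μ) hF (fun z => norm_nonneg _)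
    (fun z => norm_waveSynthesis_le hh z.1 z.2) hS1 hp
  have hup := integral_waveKernel_le hn hε hμ hS1 hh hκ
  refine hup.trans ?_
  gcongr
  refine hhol.trans ?_
  have hexp : 0 ≤ 1 - 1 / p := by
    rw [sub_nonneg, div_le_one (by linarith)]; exact hp.le
  gcongr
  refine hstr.trans ?_
  gcongr

/-- if the Strichartz estimate for the wave equation with respect to fractal
measures holds with `(n+1)/2 - α` derivatives of smoothing (for some `p > 1`, for every
`γ < (n+1)/2 - α`), then compact sets of Hausdorff dimension greater than `α` have distance
sets of positive Lebesgue measure. -/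
theorem falconer_via_strichartz (n : ℕ) (hn : 2 ≤ n) (α : ℝ)
    (hα₁ : ((n : ℝ) - 1) / 2 < α) (hα₂ : α < ((n : ℝ) + 1) / 2)
    (H : ∀ γ : ℝ, γ < ((n : ℝ) + 1) / 2 - α →
      ∃ p : ℝ, 1 < p ∧ ∃ C : ℝ, 0 < C ∧
        ∀ (u₀ : SchwartzMap (E n) ℂ), (∀ x, (u₀ x).im = 0) → (∀ x, u₀ (-x) = u₀ x) →
          ∀ (μ : Measure (E n)), IsFiniteMeasure μ →
            μ.map (fun x => -x) = μ →
            μ (Metric.ball (0 : E n) 4)ᶜ = 0 →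
            frostman μ α < ⊤ →
            (∫ t in (0:ℝ)..1, ∫ x, ‖cosWave n (⇑u₀) t x‖ ^ p ∂μ) ^ (1/p) ≤
              C * (frostman μ α).toReal ^ (1/p) *
                sobolevNorm (⇑u₀) (((n : ℝ) - α) / 2 - γ))
    (K : Set (E n)) (hK : IsCompact K) (hdim : ENNReal.ofReal α < dimH K) :
    0 < volume {d : ℝ | ∃ x ∈ K, ∃ y ∈ K, d = dist x y} := by
  have hn' : (2 : ℝ) ≤ n := by exact_mod_cast hn
  by_contra hcon
  have hnull : volume {d : ℝ | ∃ x ∈ K, ∃ y ∈ K, d = dist x y} = 0 := by simpa using hcon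
  set D : Set ℝ := {d : ℝ | ∃ x ∈ K, ∃ y ∈ K, d = dist x y} with hD
  have hDc : IsCompact D := by
    have : D = (fun p : E n × E n => dist p.1 p.2) '' (K ×ˢ K) := by
      ext d
      simp only [hD, Set.mem_ofPred_eq, Set.mem_image, Set.mem_prod, Prod.exists]
      exact ⟨fun ⟨x, hx, y, hy, h⟩ => ⟨x, y, ⟨hx, hy⟩, h.symm⟩,
        fun ⟨x, y, ⟨hx, hy⟩, h⟩ => ⟨x, hx, y, hy, h.symm⟩⟩
    rw [this]
    exact (hK.prod hK).image (by fun_prop)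
  have hα0 : 0 < α := by linarith
  obtain ⟨s, hαs, C₀, hC₀, μ, hμfin, hμeven, hμsupp, hμball, hμpos, hμD⟩ :=
    exists_even_frostman_measure (by lia) hα0.le hK hdim
  obtain ⟨β, hαβ, hβ⟩ := exists_between (lt_min hαs (by linarith : α < n))
  obtain ⟨q, hβq, hqs⟩ := exists_between (hβ.trans_le (min_le_left _ _))
  have hβn : β < n := hβ.trans_le (min_le_right _ _)
  have hne := ae_prod_ne_of_measure_ball_le (by linarith : 0 < s) hμball
  have hIq := integrable_norm_sub_rpow_neg (by linarith : 0 < q) hqs hC₀.le hμball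
  have hIα := integrable_norm_sub_rpow_neg hα0 hαs hC₀.le hμball
  have hJ := integrable_bessel_mul_cosTransform_sq (by linarith : 0 < q) hβq hβn hIq hne
  have hfro := frostman_lt_top_of_measure_ball_le hα0.le hαs.le hC₀.le hμball
  have hfar : ∀ᵐ p : E n × E n ∂(μ.prod μ), ‖p.1 - p.2‖ ≤ 8 := by
    have h4 : ∀ᵐ x ∂μ, x ∈ ball (0 : E n) 4 := hμsupp
    filter_upwards [Measure.quasiMeasurePreserving_fst.ae h4,
      Measure.quasiMeasurePreserving_snd.ae h4] with p h1 h2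
    rw [mem_ball_zero_iff] at h1 h2
    linarith [norm_sub_le p.1 p.2]
  obtain ⟨p, hp, C, hC, hstr⟩ := H (((n : ℝ) + 1) / 2 - α - (β - α) / 2) (by linarith)
  rw [show ((n : ℝ) - α) / 2 - (((n : ℝ) + 1) / 2 - α - (β - α) / 2) = (β - 1) / 2 by ring]
    at hstr
  set σ := α - ((n : ℝ) - 1) / 2 with hσ
  have hσ0 : 0 < σ := by rw [hσ]; linarith
  have hσ1 : σ < 1 := by rw [hσ]; linarith
  obtain ⟨A, c, hA, hc, hlow⟩ := le_integral_waveKernel hn hσ0 hσ1 (by norm_num : (0 : ℝ) < 8)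
  rw [show ((n : ℝ) - 1) / 2 + σ = α by rw [hσ]; ring] at hlow
  set I := ∫ p : E n × E n, ‖p.1 - p.2‖ ^ (-α) ∂(μ.prod μ) with hI
  set Q := C * (frostman μ α).toReal ^ (1/p) *
    (2 * (∫ ξ : E n, (1 + ‖ξ‖ ^ 2) ^ (-(((n : ℝ) - β) / 2)) * cosTransform μ ξ ^ 2) + 1) ^
      (1/2 : ℝ) with hQ
  set m := (μ.prod μ).real {p : E n × E n | ‖p.1 - p.2‖ < 1 / 2} with hm
  have hkey : ∀ η : ℝ, 0 < η → η ≤ 1 → c * m ≤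
      A * η ^ σ * I + (Q * (η * μ.real Set.univ) ^ (1 - 1 / p) + η * μ.real Set.univ) := by
    intro η hη hη1
    obtain ⟨U, hDU, hUo, hUη⟩ := D.exists_isOpen_lt_of_lt (ENNReal.ofReal η)
      (by rw [hnull]; exact ENNReal.ofReal_pos.2 hη)
    obtain ⟨δ, hδ, hδU⟩ := hDc.exists_thickening_subset_open hUo hDU
    have hSη : volume.real (U ∩ Set.Ioo 0 1) ≤ η := by
      refine ENNReal.toReal_le_of_le_ofReal hη.le ?_
      exact (measure_mono Set.inter_subset_left).trans hUη.le
    have hS1 : U ∩ Set.Ioo 0 1 ⊆ Set.Ioc (0 : ℝ) 1 :=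
      Set.inter_subset_right.trans Set.Ioo_subset_Ioc_self
    have hε : 0 < min δ (1 / 2) := by positivity
    have h1 := hlow μ hμfin hIα hne hfar (min δ (1 / 2)) η hε hη _ hS1
      (hUo.measurableSet.inter measurableSet_Ioo) hSη (by
        filter_upwards [hμD] with z hz hz2 t ht
        have ht1 := ht.1
        have ht2 := ht.2
        have hm1 := min_le_left δ (1 / 2)
        have hm2 := min_le_right δ (1 / 2)
        refine ⟨hδU (mem_thickening_iff.2 ⟨_, hz hz2, ?_⟩), ?_, ?_⟩
        · rw [Real.dist_eq, abs_of_pos (by linarith)]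
          linarith
        · exact (norm_nonneg _).trans_lt ht1
        · linarith)
    have h2 := integral_waveKernel_le_of_strichartz hn hp hC hμeven
      (fun u hu1 hu2 => hstr u hu1 hu2 μ hμfin hμeven hμsupp hfro) hJ hε hη hη1 hS1 hSη
    linarith
  have hθ : 0 < 1 - 1 / p := by
    rw [sub_pos, div_lt_one (by linarith)]; exact hp
  have hcont : ContinuousAt (fun η : ℝ => A * η ^ σ * I +
      (Q * (η * μ.real Set.univ) ^ (1 - 1 / p) + η * μ.real Set.univ)) 0 := by
    have h1 : Continuous fun η : ℝ => η ^ σ :=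
      continuous_id.rpow_const fun _ => Or.inr hσ0.le
    have h2 : Continuous fun η : ℝ => (η * μ.real Set.univ) ^ (1 - 1 / p) :=
      Continuous.rpow_const (by fun_prop) fun _ => Or.inr hθ.le
    exact Continuous.continuousAt (by fun_prop)
  have hlim := hcont.tendsto.mono_left (nhdsWithin_le_nhds (s := Set.Ioi 0))
  simp only [Real.zero_rpow hσ0.ne', zero_mul, Real.zero_rpow hθ.ne', mul_zero, add_zero] at hlim
  have hle : c * m ≤ 0 := by
    refine ge_of_tendsto hlim ?_
    filter_upwards [Ioc_mem_nhdsGT (zero_lt_one' ℝ)] with η hη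
    exact hkey η hη.1 hη.2
  exact absurd hle (not_le.2 (mul_pos hc hμpos))
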